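/- Every convex polyhedron is a combinatorial space-filler: for every convex 3-polytope P in ℝ³ (the convex hull of a finite set of points with nonempty interior), there exists a locally finite tiling of ℝ³ by convex 3-polytopes each of which is combinatorially equivalent to P (the tiling need not be face-to-face, and may require infinitely many congruence classes of tiles). -/

import Mathlib

open Set

noncomputable section

abbrev Euc (d : ℕ) := EuclideanSpace ℝ (Fin d)

/-- A tiling of `ℝ^d`: a family of closed sets covering the space with pairwise
disjoint interiors. -/
def IsTiling {d : ℕ} (𝒯 : Set (Set (Euc d))) : Prop :=
  (∀ T ∈ 𝒯, IsClosed T) ∧ ⋃₀ 𝒯 = Set.univ ∧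
    𝒯.Pairwise fun S T => interior S ∩ interior T = ∅

/-- Local finiteness: every compact set meets only finitely many tiles. -/
def LocallyFiniteTiling {d : ℕ} (𝒯 : Set (Set (Euc d))) : Prop :=
  ∀ K : Set (Euc d), IsCompact K → {T ∈ 𝒯 | (T ∩ K).Nonempty}.Finite

/-- `S` is an isometric copy of `T`. -/
def IsometricCopy {d : ℕ} (S T : Set (Euc d)) : Prop :=
  ∃ g : Euc d ≃ᵢ Euc d, g '' T = S

/-- A monohedral tiling with prototile `T`. -/
def Monohedral {d : ℕ} (𝒯 : Set (Set (Euc d))) (T : Set (Euc d)) : Prop :=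
  ∀ S ∈ 𝒯, IsometricCopy S T

/-- A convex `d`-polytope in `ℝ^d`: convex hull of a finite set, with nonempty interior. -/
def IsConvexPolytope {d : ℕ} (P : Set (Euc d)) : Prop :=
  (∃ V : Finset (Euc d), P = convexHull ℝ (V : Set (Euc d))) ∧ (interior P).Nonempty

/-- A tiling is face-to-face if the intersection of any two distinct tiles is a
face (extreme subset), possibly empty, of each of them. -/
def FaceToFace {d : ℕ} (𝒯 : Set (Set (Euc d))) : Prop :=
  ∀ S ∈ 𝒯, ∀ T ∈ 𝒯, S ≠ T → IsExtreme ℝ S (S ∩ T) ∧ IsExtreme ℝ T (S ∩ T)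

/-- Combinatorial equivalence: an order isomorphism between the face posets
(posets of extreme subsets ordered by inclusion). -/
def CombEquiv {d e : ℕ} (P : Set (Euc d)) (Q : Set (Euc e)) : Prop :=
  Nonempty ({F : Set (Euc d) // IsExtreme ℝ P F} ≃o {F : Set (Euc e) // IsExtreme ℝ Q F})

/-- A facet: a maximal proper nonempty face. -/
def IsFacet {d : ℕ} (Q F : Set (Euc d)) : Prop :=
  IsExtreme ℝ Q F ∧ F.Nonempty ∧ F ≠ Q ∧
    ∀ G : Set (Euc d), IsExtreme ℝ Q G → G ≠ Q → F ⊆ G → G = F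


section Cones

variable {E : Type*} [AddCommGroup E] [Module ℝ E]

/-- The convex cone generated by a finite set of vectors. -/
def ccone (S : Finset E) : Set E :=
  {x | ∃ c : E → ℝ, (∀ s ∈ S, 0 ≤ c s) ∧ ∑ s ∈ S, c s • s = x}

lemma mem_ccone_of_mem {S : Finset E} {s : E} (hs : s ∈ S) : s ∈ ccone S := by
  classical
  refine ⟨fun x => if x = s then 1 else 0, fun x _ => by dsimp only; split_ifs <;> norm_num, ?_⟩
  simp [Finset.sum_ite_eq', hs]

lemma zero_mem_ccone (S : Finset E) : (0 : E) ∈ ccone S :=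
  ⟨fun _ => 0, fun _ _ => le_rfl, by simp⟩

lemma add_mem_ccone {S : Finset E} {x y : E} (hx : x ∈ ccone S) (hy : y ∈ ccone S) :
    x + y ∈ ccone S := by
  obtain ⟨c, hc, rfl⟩ := hx
  obtain ⟨d, hd, rfl⟩ := hy
  exact ⟨fun s => c s + d s, fun s hs => add_nonneg (hc s hs) (hd s hs), by
    simp [add_smul, Finset.sum_add_distrib]⟩

lemma smul_mem_ccone {S : Finset E} {x : E} {r : ℝ} (hr : 0 ≤ r) (hx : x ∈ ccone S) :
    r • x ∈ ccone S := by
  obtain ⟨c, hc, rfl⟩ := hx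
  exact ⟨fun s => r * c s, fun s hs => mul_nonneg hr (hc s hs), by
    simp [mul_smul, Finset.smul_sum]⟩

lemma sum_mem_ccone {ι : Type*} {S : Finset E} (I : Finset ι) {f : ι → E}
    (h : ∀ i ∈ I, f i ∈ ccone S) : ∑ i ∈ I, f i ∈ ccone S := by
  classical
  induction I using Finset.induction_on with
  | empty => simpa using zero_mem_ccone S
  | insert a I ha ih =>
    rw [Finset.sum_insert ha]
    exact add_mem_ccone (h a (by simp)) (ih fun i hi => h i (by simp [hi]))

lemma ccone_subset {S T : Finset E} (h : ∀ s ∈ S, s ∈ ccone T) : ccone S ⊆ ccone T := by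
  rintro _ ⟨c, hc, rfl⟩
  exact sum_mem_ccone S fun s hs => smul_mem_ccone (hc s hs) (h s hs)

lemma ccone_mono {S T : Finset E} (h : S ⊆ T) : ccone S ⊆ ccone T :=
  ccone_subset fun _ hs => mem_ccone_of_mem (h hs)

lemma nonneg_of_mem_ccone {S : Finset E} {φ : E →ₗ[ℝ] ℝ} (h : ∀ s ∈ S, 0 ≤ φ s) {x : E}
    (hx : x ∈ ccone S) : 0 ≤ φ x := by
  obtain ⟨c, hc, rfl⟩ := hx
  simp only [map_sum, map_smul, smul_eq_mul]
  exact Finset.sum_nonneg fun s hs => mul_nonneg (hc s hs) (h s hs)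

lemma mem_ccone_insert [DecidableEq E] {S : Finset E} {v x : E} :
    x ∈ ccone (insert v S) ↔ ∃ c : ℝ, 0 ≤ c ∧ x - c • v ∈ ccone S := by
  constructor
  · rintro ⟨c, hc, rfl⟩
    by_cases hv : v ∈ S
    · refine ⟨0, le_rfl, c, fun s hs => hc s (by simp [hs]), ?_⟩
      simp [hv]
    · refine ⟨c v, hc v (by simp), c, fun s hs => hc s (by simp [hs]), ?_⟩
      rw [Finset.sum_insert hv]; abel
  · rintro ⟨c, hc, hx⟩
    have h1 : x - c • v ∈ ccone (insert v S) := ccone_mono (Finset.subset_insert _ _) hx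
    have h2 : c • v ∈ ccone (insert v S) :=
      smul_mem_ccone hc (mem_ccone_of_mem (Finset.mem_insert_self _ _))
    simpa using add_mem_ccone h1 h2

/-- Weyl's theorem, by Fourier–Motzkin elimination. -/
theorem exists_dual_description [FiniteDimensional ℝ E] (S : Finset E) :
    ∃ Φ : Finset (Module.Dual ℝ E), ∀ x, x ∈ ccone S ↔ ∀ φ ∈ Φ, 0 ≤ φ x := by
  classical
  induction S using Finset.induction_on with
  | empty =>
    let b := Module.finBasis ℝ E
    refine ⟨Finset.univ.image b.coord ∪ Finset.univ.image (fun i => - b.coord i), fun x => ?_⟩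
    constructor
    · rintro ⟨c, -, rfl⟩
      simp
    · intro h
      have : x = 0 := by
        rw [← b.forall_coord_eq_zero_iff]
        intro i
        have h1 := h (b.coord i) (by simp)
        have h2 := h (- b.coord i) (by simp)
        simp only [LinearMap.neg_apply] at h2
        linarith
      rw [this]
      exact zero_mem_ccone _
  | insert v S hv ih =>
    obtain ⟨Φ, hΦ⟩ := ih
    refine ⟨Φ.filter (fun φ => 0 ≤ φ v) ∪
      ((Φ ×ˢ Φ).filter (fun q => 0 < q.1 v ∧ q.2 v < 0)).image
        (fun q => q.1 v • q.2 - q.2 v • q.1), fun x => ?_⟩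
    rw [mem_ccone_insert]
    simp only [hΦ, map_sub, map_smul, smul_eq_mul]
    constructor
    · rintro ⟨c, hc, hx⟩ φ hφ
      simp only [Finset.mem_union, Finset.mem_filter, Finset.mem_image, Finset.mem_product,
        Prod.exists] at hφ
      rcases hφ with ⟨h1, h2⟩ | ⟨p, q, ⟨⟨hp, hq⟩, hpv, hqv⟩, rfl⟩
      · have := hx φ h1
        have := mul_nonneg hc h2
        linarith
      · have h1 := hx p hp
        have h2 := hx q hq
        simp only [LinearMap.sub_apply, LinearMap.smul_apply, smul_eq_mul]
        nlinarith
    · intro h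
      have hpos : ∀ φ ∈ Φ, 0 ≤ φ v → 0 ≤ φ x := fun φ h1 h2 => h φ (by simp [h1, h2])
      have hpair : ∀ p ∈ Φ, ∀ q ∈ Φ, 0 < p v → q v < 0 → 0 ≤ p v * q x - q v * p x := by
        intro p hp q hq h1 h2
        have := h (p v • q - q v • p) (by
          simp only [Finset.mem_union, Finset.mem_image, Finset.mem_filter, Finset.mem_product,
            Prod.exists]
          exact Or.inr ⟨p, q, ⟨⟨hp, hq⟩, h1, h2⟩, rfl⟩)
        simpa using this
      obtain ⟨c, hc, hL, hU⟩ : ∃ c : ℝ, 0 ≤ c ∧ (∀ q ∈ Φ, q v < 0 → q x / q v ≤ c) ∧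
          (∀ p ∈ Φ, 0 < p v → c ≤ p x / p v) := by
        let L : Finset ℝ := insert 0 ((Φ.filter fun q => q v < 0).image fun q => q x / q v)
        have hne : L.Nonempty := ⟨0, by simp [L]⟩
        refine ⟨L.max' hne, L.le_max' 0 (by simp [L]), fun q hq hqv => L.le_max' _ ?_,
          fun p hp hpv => L.max'_le _ _ fun y hy => ?_⟩
        · simp only [L, Finset.mem_insert, Finset.mem_image, Finset.mem_filter]
          exact Or.inr ⟨q, ⟨hq, hqv⟩, rfl⟩
        · simp only [L, Finset.mem_insert, Finset.mem_image, Finset.mem_filter] at hy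
          rcases hy with rfl | ⟨q, ⟨hq, hqv⟩, rfl⟩
          · exact div_nonneg (hpos p hp hpv.le) hpv.le
          · have := hpair p hp q hq hpv hqv
            rw [div_le_iff_of_neg hqv, div_mul_eq_mul_div, div_le_iff₀ hpv]
            linarith
      refine ⟨c, hc, fun φ hφ => ?_⟩
      rcases lt_trichotomy (φ v) 0 with h1 | h1 | h1
      · have := hL φ hφ h1
        rw [div_le_iff_of_neg h1] at this
        linarith
      · simpa [h1] using hpos φ hφ h1.ge
      · have := hU φ hφ h1
        rw [le_div_iff₀ h1] at this
        linarith

/-- Farkas' lemma. -/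
theorem mem_ccone_dual [FiniteDimensional ℝ E] {Φ : Finset (Module.Dual ℝ E)}
    {ψ : Module.Dual ℝ E} (h : ∀ x, (∀ φ ∈ Φ, 0 ≤ φ x) → 0 ≤ ψ x) : ψ ∈ ccone Φ := by
  obtain ⟨F, hF⟩ := exists_dual_description Φ
  rw [hF]
  intro f hf
  obtain ⟨x, rfl⟩ := (Module.evalEquiv ℝ E).surjective f
  exact h x fun φ hφ => (hF φ).1 (mem_ccone_of_mem hφ) _ hf

/-- Minkowski's theorem. -/
theorem exists_generators [FiniteDimensional ℝ E] (Φ : Finset (Module.Dual ℝ E)) :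
    ∃ S : Finset E, ∀ x, x ∈ ccone S ↔ ∀ φ ∈ Φ, 0 ≤ φ x := by
  classical
  obtain ⟨F, hF⟩ := exists_dual_description Φ
  let S : Finset E := F.image (Module.evalEquiv ℝ E).symm
  have hS : ∀ ψ : Module.Dual ℝ E, ψ ∈ ccone Φ ↔ ∀ v ∈ S, 0 ≤ ψ v := by
    intro ψ
    rw [hF]
    simp [S]
  refine ⟨S, fun x => ⟨fun hx φ hφ => ?_, fun hx => ?_⟩⟩
  · exact nonneg_of_mem_ccone ((hS φ).1 (mem_ccone_of_mem hφ)) hx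
  · obtain ⟨Ψ, hΨ⟩ := exists_dual_description S
    rw [hΨ]
    intro ψ hψ
    have h1 : ψ ∈ ccone Φ := (hS ψ).2 fun v hv => (hΨ v).1 (mem_ccone_of_mem hv) ψ hψ
    exact nonneg_of_mem_ccone (φ := Module.Dual.eval ℝ E x) hx h1

/-- No element of `S` is generated by the others. -/
def Irred [DecidableEq E] (S : Finset E) : Prop := ∀ s ∈ S, s ∉ ccone (S.erase s)

lemma exists_irred [DecidableEq E] (S : Finset E) :
    ∃ T ⊆ S, ccone T = ccone S ∧ Irred T := by
  induction S using Finset.strongInduction with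
  | H S ih =>
    by_cases h : Irred S
    · exact ⟨S, subset_rfl, rfl, h⟩
    · simp only [Irred, not_forall, not_not] at h
      obtain ⟨s, hs, hs'⟩ := h
      obtain ⟨T, hT, hTS, hI⟩ := ih _ (Finset.erase_ssubset hs)
      refine ⟨T, hT.trans (Finset.erase_subset _ _), hTS.trans ?_, hI⟩
      refine (ccone_mono (Finset.erase_subset _ _)).antisymm (ccone_subset fun x hx => ?_)
      by_cases hxs : x = s
      · exact hxs ▸ hs'
      · exact mem_ccone_of_mem (Finset.mem_erase.2 ⟨hxs, hx⟩)

lemma Irred.mono [DecidableEq E] {S T : Finset E} (h : Irred T) (hS : S ⊆ T) : Irred S :=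
  fun s hs hs' => h s (hS hs) (ccone_mono (Finset.erase_subset_erase _ hS) hs')

/-- A generator which is extreme: the only segments of the cone centered at it are multiples. -/
lemma Irred.eq_smul [DecidableEq E] {G : Finset E} (hG : Irred G) {t : E →ₗ[ℝ] ℝ}
    (ht : ∀ g ∈ G, 0 < t g) {g x : E} (hg : g ∈ G) (h1 : g + x ∈ ccone G)
    (h2 : g - x ∈ ccone G) : ∃ r : ℝ, x = r • g := by
  rw [← Finset.insert_erase hg, mem_ccone_insert] at h1 h2
  obtain ⟨a, ha, ha'⟩ := h1
  obtain ⟨b, hb, hb'⟩ := h2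
  have ht' : ∀ s ∈ G.erase g, 0 ≤ t s := fun s hs => (ht s (Finset.mem_of_mem_erase hs)).le
  have hsum := add_mem_ccone ha' hb'
  have e : (g + x - a • g) + (g - x - b • g) = (2 - a - b) • g := by module
  rw [e] at hsum
  have hab : 2 - a - b ≤ 0 := by
    by_contra! hlt
    refine hG g hg ?_
    have := smul_mem_ccone (inv_nonneg.2 hlt.le) hsum
    rwa [smul_smul, inv_mul_cancel₀ hlt.ne', one_smul] at this
  have n1 := nonneg_of_mem_ccone ht' ha'
  have n2 := nonneg_of_mem_ccone ht' hb'
  have hzero : t (g + x - a • g) = 0 := by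
    have := ht g hg
    simp only [map_add, map_sub, map_smul, smul_eq_mul] at n1 n2 ⊢
    nlinarith
  obtain ⟨c, hc, hcx⟩ := ha'
  have hcs : ∀ s ∈ G.erase g, c s = 0 := by
    have h0 : ∑ s ∈ G.erase g, c s * t s = 0 := by
      rw [← hzero, ← hcx]; simp
    intro s hs
    have := (Finset.sum_eq_zero_iff_of_nonneg
      (fun s hs => mul_nonneg (hc s hs) (ht' s hs))).1 h0 s hs
    rcases mul_eq_zero.1 this with h | h
    · exact h
    · exact absurd h (ht s (Finset.mem_of_mem_erase hs)).ne'
  have : g + x - a • g = 0 := by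
    rw [← hcx]
    exact Finset.sum_eq_zero fun s hs => by rw [hcs s hs, zero_smul]
  exact ⟨a - 1, by rw [sub_smul, one_smul, ← sub_eq_zero, ← this]; abel⟩

lemma exists_pos_forall_le {ι : Type*} (I : Finset ι) (a b : ι → ℝ) (h : ∀ i ∈ I, 0 < a i) :
    ∃ ε : ℝ, 0 < ε ∧ ∀ i ∈ I, ε * |b i| ≤ a i := by
  classical
  induction I using Finset.induction_on with
  | empty => exact ⟨1, one_pos, by simp⟩
  | insert j I hj ih =>
    obtain ⟨ε, hε, hI⟩ := ih fun i hi => h i (by simp [hi])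
    have hj' := h j (by simp)
    have hb : 0 < |b j| + 1 := by positivity
    refine ⟨min ε (a j / (|b j| + 1)), by positivity, fun i hi => ?_⟩
    rcases Finset.mem_insert.1 hi with rfl | hi
    · calc _ ≤ a i / (|b i| + 1) * |b i| := by gcongr; exact min_le_right _ _
        _ ≤ a i / (|b i| + 1) * (|b i| + 1) := by gcongr; linarith
        _ = a i := div_mul_cancel₀ _ hb.ne'
    · exact (mul_le_mul_of_nonneg_right (min_le_left _ _) (abs_nonneg _)).trans (hI i hi)

/-- A vector killed by all constraints tight at an extreme generator is a multiple of it. -/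
lemma Irred.eq_smul_of_tight [DecidableEq E] {G : Finset E} (hG : Irred G) {t : E →ₗ[ℝ] ℝ}
    (ht : ∀ g ∈ G, 0 < t g) {Φ : Finset (Module.Dual ℝ E)}
    (hΦ : ∀ x, x ∈ ccone G ↔ ∀ φ ∈ Φ, 0 ≤ φ x) {g x : E} (hg : g ∈ G)
    (hx : ∀ φ ∈ Φ, φ g = 0 → φ x = 0) : ∃ r : ℝ, x = r • g := by
  classical
  have hn : ∀ φ ∈ Φ, 0 ≤ φ g := (hΦ g).1 (mem_ccone_of_mem hg)
  obtain ⟨ε, hε, hle⟩ := exists_pos_forall_le (Φ.filter fun φ => φ g ≠ 0) (fun φ => φ g)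
    (fun φ => φ x) (fun φ hφ => by
      rw [Finset.mem_filter] at hφ
      exact lt_of_le_of_ne (hn φ hφ.1) hφ.2.symm)
  have key : ∀ φ ∈ Φ, |φ (ε • x)| ≤ φ g := by
    intro φ hφ
    by_cases h : φ g = 0
    · simp [hx φ hφ h, h]
    · rw [map_smul, smul_eq_mul, abs_mul, abs_of_pos hε]
      exact hle φ (by simp [hφ, h])
  obtain ⟨r, hr⟩ := hG.eq_smul ht (x := ε • x) hg
    ((hΦ _).2 fun φ hφ => by rw [map_add]; linarith [neg_abs_le (φ (ε • x)), key φ hφ])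
    ((hΦ _).2 fun φ hφ => by rw [map_sub]; linarith [le_abs_self (φ (ε • x)), key φ hφ])
  exact ⟨ε⁻¹ * r, by rw [mul_smul, ← hr, smul_smul, inv_mul_cancel₀ hε.ne', one_smul]⟩

end Cones

section Counting

set_option linter.unusedSectionVars false

variable {E : Type*} [AddCommGroup E] [Module ℝ E] [FiniteDimensional ℝ E]

lemma card_le_finrank_of_mem {k : ℕ} {v : Fin k → E} (hv : LinearIndependent ℝ v)
    {N : Submodule ℝ E} (hN : ∀ i, v i ∈ N) : k ≤ Module.finrank ℝ N := by
  have h := finrank_span_eq_card hv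
  rw [Fintype.card_fin] at h
  rw [← h]
  exact Submodule.finrank_mono (Submodule.span_le.2 (by rintro _ ⟨i, rfl⟩; exact hN i))

omit [FiniteDimensional ℝ E] in
lemma coeffs_eq_zero_of_not_mem_cone {a b c : E} {t : E →ₗ[ℝ] ℝ} (ta : 0 < t a) (tb : 0 < t b)
    (tc : 0 < t c) (ha : ∀ p q : ℝ, 0 ≤ p → 0 ≤ q → a ≠ p • b + q • c)
    (hb : ∀ p q : ℝ, 0 ≤ p → 0 ≤ q → b ≠ p • a + q • c)
    (hc : ∀ p q : ℝ, 0 ≤ p → 0 ≤ q → c ≠ p • a + q • b) {α β γ : ℝ}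
    (h : α • a + β • b + γ • c = 0) : α = 0 ∧ β = 0 ∧ γ = 0 := by
  have solve : ∀ {x y z : E} {p q r : ℝ}, p • x + q • y + r • z = 0 → p ≠ 0 →
      x = (-q / p) • y + (-r / p) • z := by
    intro x y z p q r h hp
    have : x = p⁻¹ • (p • x) := by rw [smul_smul, inv_mul_cancel₀ hp, one_smul]
    rw [this, show p • x = -(q • y) - r • z by rw [← sub_eq_zero, ← h]; abel]
    module
  have T : α * t a + β * t b + γ * t c = 0 := by simpa using congrArg t h
  have e : ∀ x y : ℝ, (y < 0 ∧ 0 ≤ x) ∨ (0 < y ∧ x ≤ 0) → 0 ≤ -x / y := by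
    rintro x y (⟨h1, h2⟩ | ⟨h1, h2⟩)
    · exact div_nonneg_of_nonpos (by linarith) h1.le
    · exact div_nonneg (by linarith) h1.le
  have na : ¬ ((α < 0 ∧ 0 ≤ β ∧ 0 ≤ γ) ∨ (0 < α ∧ β ≤ 0 ∧ γ ≤ 0)) := fun hs =>
    ha _ _ (e β α (by grind)) (e γ α (by grind)) (solve h (by grind))
  have nb : ¬ ((β < 0 ∧ 0 ≤ α ∧ 0 ≤ γ) ∨ (0 < β ∧ α ≤ 0 ∧ γ ≤ 0)) := fun hs =>
    hb _ _ (e α β (by grind)) (e γ β (by grind)) (solve (by rw [← h]; abel) (by grind))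
  have nc : ¬ ((γ < 0 ∧ 0 ≤ α ∧ 0 ≤ β) ∨ (0 < γ ∧ α ≤ 0 ∧ β ≤ 0)) := fun hs =>
    hc _ _ (e α γ (by grind)) (e β γ (by grind)) (solve (by rw [← h]; abel) (by grind))
  have np : ¬ (0 ≤ α ∧ 0 ≤ β ∧ 0 ≤ γ ∧ (0 < α ∨ 0 < β ∨ 0 < γ)) := by
    rintro ⟨h1, h2, h3, h4 | h4 | h4⟩ <;>
      linarith [mul_nonneg h1 ta.le, mul_nonneg h2 tb.le, mul_nonneg h3 tc.le, mul_pos h4 ta,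
        mul_pos h4 tb, mul_pos h4 tc]
  have nn : ¬ (α ≤ 0 ∧ β ≤ 0 ∧ γ ≤ 0 ∧ (α < 0 ∨ β < 0 ∨ γ < 0)) := by
    rintro ⟨h1, h2, h3, h4 | h4 | h4⟩ <;>
      linarith [mul_nonneg (neg_nonneg.2 h1) ta.le, mul_nonneg (neg_nonneg.2 h2) tb.le,
        mul_nonneg (neg_nonneg.2 h3) tc.le, mul_pos (neg_pos.2 h4) ta, mul_pos (neg_pos.2 h4) tb,
        mul_pos (neg_pos.2 h4) tc]
  clear ha hb hc solve e h T
  grind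

omit [FiniteDimensional ℝ E] in
lemma Irred.ne_combo [DecidableEq E] {G : Finset E} (hG : Irred G) {a b c : E} (ha : a ∈ G)
    (hb : b ∈ G) (hc : c ∈ G) (hab : a ≠ b) (hac : a ≠ c) (p q : ℝ) (hp : 0 ≤ p) (hq : 0 ≤ q) :
    a ≠ p • b + q • c := by
  intro h
  refine hG a ha ?_
  have h1 : b ∈ ccone (G.erase a) := mem_ccone_of_mem (Finset.mem_erase.2 ⟨hab.symm, hb⟩)
  have h2 : c ∈ ccone (G.erase a) := mem_ccone_of_mem (Finset.mem_erase.2 ⟨hac.symm, hc⟩)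
  have h3 := add_mem_ccone (smul_mem_ccone hp h1) (smul_mem_ccone hq h2)
  rwa [← h] at h3

omit [FiniteDimensional ℝ E] in
lemma Irred.linearIndependent_three [DecidableEq E] {G : Finset E} (hG : Irred G)
    {t : E →ₗ[ℝ] ℝ} (ht : ∀ g ∈ G, 0 < t g) {a b c : E} (ha : a ∈ G) (hb : b ∈ G) (hc : c ∈ G)
    (hab : a ≠ b) (hac : a ≠ c) (hbc : b ≠ c) : LinearIndependent ℝ ![a, b, c] := by
  rw [Fintype.linearIndependent_iff]
  intro g hg
  simp only [Fin.sum_univ_three, Matrix.cons_val] at hg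
  obtain ⟨h0, h1, h2⟩ := coeffs_eq_zero_of_not_mem_cone (ht a ha) (ht b hb) (ht c hc)
    (hG.ne_combo ha hb hc hab hac) (hG.ne_combo hb ha hc hab.symm hbc)
    (hG.ne_combo hc ha hb hac.symm hbc.symm) hg
  intro i
  fin_cases i
  exacts [h0, h1, h2]

/-- A pointed full-dimensional polyhedral cone with irredundant generators and facets. -/
structure ConePair [DecidableEq E] [DecidableEq (Module.Dual ℝ E)] (V : Finset E)
    (Φ : Finset (Module.Dual ℝ E)) (t : E →ₗ[ℝ] ℝ) : Prop where
  irredV : Irred V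
  irredΦ : Irred Φ
  mem_iff : ∀ x, x ∈ ccone V ↔ ∀ φ ∈ Φ, 0 ≤ φ x
  tpos : ∀ v ∈ V, 0 < t v
  exists_interior : ∃ o, ∀ φ ∈ Φ, 0 < φ o

variable [DecidableEq E] [DecidableEq (Module.Dual ℝ E)]

lemma exists_conePair {V : Finset E} {t : E →ₗ[ℝ] ℝ} (hV : Irred V) (ht : ∀ v ∈ V, 0 < t v)
    (hs : ∀ ψ : Module.Dual ℝ E, (∀ v ∈ V, ψ v = 0) → ψ = 0) : ∃ Φ, ConePair V Φ t := by
  obtain ⟨Φ₀, h₀⟩ := exists_dual_description V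
  obtain ⟨Φ, hsub, hc, hI⟩ := exists_irred Φ₀
  have hmem : ∀ x, x ∈ ccone V ↔ ∀ φ ∈ Φ, 0 ≤ φ x := by
    intro x
    refine ⟨fun hx φ hφ => (h₀ x).1 hx φ (hsub hφ), fun hx => (h₀ x).2 fun φ hφ => ?_⟩
    have h1 : φ ∈ ccone Φ := hc ▸ mem_ccone_of_mem hφ
    exact nonneg_of_mem_ccone (φ := Module.Dual.eval ℝ E x) hx h1
  refine ⟨Φ, hV, hI, hmem, ht, ∑ v ∈ V, v, fun φ hφ => ?_⟩
  have hn : ∀ v ∈ V, 0 ≤ φ v := fun v hv => (hmem v).1 (mem_ccone_of_mem hv) φ hφ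
  rw [map_sum]
  refine lt_of_le_of_ne (Finset.sum_nonneg hn) fun h => hI φ hφ ?_
  rw [hs φ fun v hv => (Finset.sum_eq_zero_iff_of_nonneg hn).1 h.symm v hv]
  exact zero_mem_ccone _

namespace ConePair

variable {V : Finset E} {Φ : Finset (Module.Dual ℝ E)} {t : E →ₗ[ℝ] ℝ} (h : ConePair V Φ t)

include h

lemma nonneg {v : E} (hv : v ∈ V) {φ : Module.Dual ℝ E} (hφ : φ ∈ Φ) : 0 ≤ φ v :=
  (h.mem_iff v).1 (mem_ccone_of_mem hv) φ hφ

lemma mem_dual_iff (ψ : Module.Dual ℝ E) : ψ ∈ ccone Φ ↔ ∀ v ∈ V, 0 ≤ ψ v := by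
  refine ⟨fun hψ v hv => nonneg_of_mem_ccone (φ := Module.Dual.eval ℝ E v)
    (fun φ hφ => h.nonneg hv hφ) hψ, fun hψ => mem_ccone_dual fun x hx => ?_⟩
  exact nonneg_of_mem_ccone hψ ((h.mem_iff x).2 hx)

lemma eq_smul_vertex {v x : E} (hv : v ∈ V) (hx : ∀ φ ∈ Φ, φ v = 0 → φ x = 0) :
    ∃ r : ℝ, x = r • v :=
  h.irredV.eq_smul_of_tight h.tpos h.mem_iff hv hx

lemma eq_smul_facet {φ ψ : Module.Dual ℝ E} (hφ : φ ∈ Φ) (hψ : ∀ v ∈ V, φ v = 0 → ψ v = 0) :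
    ∃ r : ℝ, ψ = r • φ := by
  classical
  obtain ⟨o, ho⟩ := h.exists_interior
  refine h.irredΦ.eq_smul_of_tight (t := Module.Dual.eval ℝ E o) ho
    (Φ := V.image (Module.Dual.eval ℝ E)) (fun ψ => ?_) hφ ?_
  · rw [h.mem_dual_iff]
    simp
  · simpa using hψ

lemma finrank_span_facet {φ : Module.Dual ℝ E} (hφ : φ ∈ Φ) :
    Module.finrank ℝ E ≤
      Module.finrank ℝ (Submodule.span ℝ (V.filter fun v => φ v = 0 : Set E)) + 1 := by
  set N := Submodule.span ℝ (V.filter fun v => φ v = 0 : Set E)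
  have h1 := Subspace.finrank_add_finrank_dualAnnihilator_eq N
  have h2 : N.dualAnnihilator ≤ Submodule.span ℝ {φ} := by
    intro ψ hψ
    rw [Submodule.mem_dualAnnihilator] at hψ
    obtain ⟨r, rfl⟩ := h.eq_smul_facet (ψ := ψ) hφ fun v hv hv0 =>
      hψ v (Submodule.subset_span (by simp [hv, hv0]))
    exact Submodule.smul_mem _ _ (Submodule.mem_span_singleton_self φ)
  have h3 := (Submodule.finrank_mono h2).trans
    ((finrank_span_le_card ({φ} : Set _)).trans (by simp : _ ≤ 1))
  omega

lemma card_facet {φ : Module.Dual ℝ E} (hφ : φ ∈ Φ) :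
    Module.finrank ℝ E ≤ (V.filter fun v => φ v = 0).card + 1 :=
  (h.finrank_span_facet hφ).trans (by gcongr; exact finrank_span_finset_le_card _)

lemma card_vertex {v : E} (hv : v ∈ V) :
    Module.finrank ℝ E ≤ (Φ.filter fun φ => φ v = 0).card + 1 := by
  set N := Submodule.span ℝ (Φ.filter fun φ => φ v = 0 : Set (Module.Dual ℝ E))
  have h1 := Subspace.finrank_add_finrank_dualCoannihilator_eq N
  have h2 : N.dualCoannihilator ≤ Submodule.span ℝ {v} := by
    intro x hx
    rw [Submodule.mem_dualCoannihilator] at hx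
    obtain ⟨r, rfl⟩ := h.eq_smul_vertex (x := x) hv fun φ hφ hφ0 =>
      hx φ (Submodule.subset_span (by simp [hφ, hφ0]))
    exact Submodule.smul_mem _ _ (Submodule.mem_span_singleton_self v)
  have h3 := (Submodule.finrank_mono h2).trans
    ((finrank_span_le_card ({v} : Set _)).trans (by simp : _ ≤ 1))
  have h4 : Module.finrank ℝ N ≤ (Φ.filter fun φ => φ v = 0).card :=
    finrank_span_finset_le_card _
  omega

lemma ne_smul {φ ψ : Module.Dual ℝ E} (hφ : φ ∈ Φ) (hψ : ψ ∈ Φ) (hne : φ ≠ ψ) (r : ℝ) :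
    ψ ≠ r • φ := by
  rintro rfl
  obtain ⟨o, ho⟩ := h.exists_interior
  have h1 := ho φ hφ
  have h2 := ho _ hψ
  rw [LinearMap.smul_apply, smul_eq_mul] at h2
  have hr : 0 ≤ r := by by_contra! hr; nlinarith
  exact h.irredΦ _ hψ (smul_mem_ccone hr (mem_ccone_of_mem (Finset.mem_erase.2 ⟨hne, hφ⟩)))

lemma facet_ne_zero {φ : Module.Dual ℝ E} (hφ : φ ∈ Φ) : φ ≠ 0 := by
  rintro rfl
  exact h.irredΦ _ hφ (zero_mem_ccone _)

/-- Two distinct facets of a four-dimensional cone share at most two generators. -/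
lemma not_three_common (hd : Module.finrank ℝ E = 4) {φ ψ : Module.Dual ℝ E} (hφ : φ ∈ Φ)
    (hψ : ψ ∈ Φ) (hne : φ ≠ ψ) {a b c : E} (ha : a ∈ V) (hb : b ∈ V) (hc : c ∈ V) (hab : a ≠ b)
    (hac : a ≠ c) (hbc : b ≠ c) (h1 : φ a = 0 ∧ φ b = 0 ∧ φ c = 0)
    (h2 : ψ a = 0 ∧ ψ b = 0 ∧ ψ c = 0) : False := by
  have hli := h.irredV.linearIndependent_three h.tpos ha hb hc hab hac hbc
  set N := Submodule.span ℝ (Set.range ![a, b, c])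
  have e1 : Module.finrank ℝ N = 3 := (finrank_span_eq_card hli).trans (Fintype.card_fin 3)
  have e2 := Subspace.finrank_add_finrank_dualAnnihilator_eq N
  have hli2 : LinearIndependent ℝ ![φ, ψ] := by
    rw [LinearIndependent.pair_iff' (h.facet_ne_zero hφ)]
    exact fun r hr => h.ne_smul hφ hψ hne r hr.symm
  have mem : ∀ χ : Module.Dual ℝ E, χ a = 0 ∧ χ b = 0 ∧ χ c = 0 → χ ∈ N.dualAnnihilator := by
    intro χ hχ
    rw [Submodule.mem_dualAnnihilator]
    intro w hw
    have : N ≤ LinearMap.ker χ := Submodule.span_le.2 (by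
      rintro _ ⟨i, rfl⟩
      fin_cases i
      exacts [hχ.1, hχ.2.1, hχ.2.2])
    exact this hw
  have := card_le_finrank_of_mem hli2 (N := N.dualAnnihilator) (fun i => by
    fin_cases i
    exacts [mem φ h1, mem ψ h2])
  omega

/-- Incidence count for a four-dimensional cone, by sweeping a generic hyperplane. -/
lemma sum_card_lt (hd : Module.finrank ℝ E = 4) (hV : V.Nonempty) :
    ∑ φ ∈ Φ, (V.filter fun v => φ v = 0).card < 2 * Φ.card + 2 * V.card := by
  classical
  obtain ⟨f, hf⟩ : ∃ f : Module.Dual ℝ E, ∀ v ∈ V, ∀ w ∈ V, v ≠ w → f v / t v ≠ f w / t w := by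
    let S : Finset E := (V.offDiag).image fun q => t q.2 • q.1 - t q.1 • q.2
    have hS0 : ∀ x : S, (x : E) ≠ 0 := by
      rintro ⟨x, hx⟩ h0
      simp only [S, Finset.mem_image, Finset.mem_offDiag, Prod.exists] at hx
      obtain ⟨v, w, ⟨hv, hw, hne⟩, rfl⟩ := hx
      have hvw : v = (t v / t w) • w + (0 : ℝ) • w := by
        have := h.tpos w hw
        rw [zero_smul, add_zero, div_eq_inv_mul, mul_smul, ← sub_eq_zero.1 h0, smul_smul,
          inv_mul_cancel₀ this.ne', one_smul]
      exact h.irredV.ne_combo hv hw hw hne hne _ _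
        (div_nonneg (h.tpos v hv).le (h.tpos w hw).le) le_rfl hvw
    obtain ⟨f, hf⟩ := Module.exists_dual_forall_apply_ne_zero (K := ℝ) (fun x : S => (x : E)) hS0
    refine ⟨f, fun v hv w hw hne heq => ?_⟩
    have hmem : t w • v - t v • w ∈ S :=
      Finset.mem_image.2 ⟨(v, w), Finset.mem_offDiag.2 ⟨hv, hw, hne⟩, rfl⟩
    refine hf ⟨_, hmem⟩ ?_
    rw [div_eq_div_iff (h.tpos v hv).ne' (h.tpos w hw).ne'] at heq
    simp only [map_sub, map_smul, smul_eq_mul]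
    linarith
  let m : E → ℝ := fun v => f v / t v
  let side : E → Module.Dual ℝ E → Prop := fun v φ =>
    φ v = 0 ∧ (∃ w ∈ V, φ w = 0 ∧ m v < m w) ∧ ∃ w ∈ V, φ w = 0 ∧ m w < m v
  have facet_card_le : ∀ φ ∈ Φ,
      (V.filter fun v => φ v = 0).card ≤ 2 + (V.filter fun v => side v φ).card := by
    intro φ _
    rcases (V.filter fun v => φ v = 0).eq_empty_or_nonempty with h0 | hne
    · simp [h0]
    obtain ⟨p, hp, hp'⟩ := Finset.exists_min_image _ m hne
    obtain ⟨q, hq, hq'⟩ := Finset.exists_max_image _ m hne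
    have : (V.filter fun v => φ v = 0) ⊆ {p, q} ∪ (V.filter fun v => side v φ) := by
      intro v hv
      by_cases hvp : v = p
      · simp [hvp]
      by_cases hvq : v = q
      · simp [hvq]
      simp only [Finset.mem_filter] at hv hp hq
      have h1 := hp' v (by simpa using hv)
      have h2 := hq' v (by simpa using hv)
      have n1 := hf v hv.1 p hp.1 hvp
      have n2 := hf v hv.1 q hq.1 hvq
      refine Finset.mem_union_right _ (Finset.mem_filter.2 ⟨hv.1, hv.2, ⟨q, hq.1, hq.2, ?_⟩,
        ⟨p, hp.1, hp.2, ?_⟩⟩)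
      · exact lt_of_le_of_ne h2 n2
      · exact lt_of_le_of_ne h1 n1.symm
    exact (Finset.card_le_card this).trans ((Finset.card_union_le _ _).trans (by
      gcongr; exact Finset.card_le_two))
  have side_card_le : ∀ v ∈ V, (Φ.filter fun φ => side v φ).card ≤ 2 := by
    intro v hv
    by_contra! hlt
    obtain ⟨φ₁, h1, φ₂, h2, φ₃, h3, h12, h13, h23⟩ := Finset.two_lt_card.1 hlt
    simp only [Finset.mem_filter] at h1 h2 h3
    have tv := h.tpos v hv
    let g : E →ₗ[ℝ] ℝ := f - m v • t
    have gw : ∀ w ∈ V, g w = t w * (m w - m v) := by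
      intro w hw
      have := h.tpos w hw
      simp only [g, m, LinearMap.sub_apply, LinearMap.smul_apply, smul_eq_mul]
      field_simp
    have gv : g v = 0 := by rw [gw v hv]; ring
    have build : ∀ φ ∈ Φ, side v φ → ∃ y, φ y = 0 ∧ g y = 0 ∧
        ∀ ψ ∈ Φ, φ ≠ ψ → ψ v = 0 → 0 < ψ y := by
      rintro φ hφ ⟨hφv, ⟨w, hw, hφw, hlt⟩, ⟨w', hw', hφw', hlt'⟩⟩
      have p1 : 0 < g w := by
        rw [gw w hw]; exact mul_pos (h.tpos w hw) (by linarith)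
      have p2 : g w' < 0 := by
        rw [gw w' hw']; exact mul_neg_of_pos_of_neg (h.tpos w' hw') (by linarith)
      refine ⟨g w • w' - g w' • w, by simp [hφw, hφw'], by simp; ring, fun ψ hψ hne hψv => ?_⟩
      have n1 := h.nonneg hw hψ
      have n2 := h.nonneg hw' hψ
      simp only [map_sub, map_smul, smul_eq_mul]
      by_contra! hle
      have e1 : ψ w = 0 := by nlinarith [mul_nonneg p1.le n2]
      have e2 : ψ w' = 0 := by nlinarith [mul_nonneg (neg_nonneg.2 p2.le) n1]
      exact h.not_three_common hd hφ hψ hne hv hw hw' (by rintro rfl; exact hlt.false)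
        (by rintro rfl; exact hlt'.false) (by rintro rfl; exact (hlt.trans hlt').false)
        ⟨hφv, hφw, hφw'⟩ ⟨hψv, e1, e2⟩
    obtain ⟨y₁, z1, g1, q1⟩ := build φ₁ h1.1 h1.2
    obtain ⟨y₂, z2, g2, q2⟩ := build φ₂ h2.1 h2.2
    obtain ⟨y₃, z3, g3, q3⟩ := build φ₃ h3.1 h3.2
    have g0 : g ≠ 0 := by
      obtain ⟨-, ⟨w, hw, -, hlt⟩, -⟩ := h1.2
      intro h0
      have := gw w hw
      rw [h0, LinearMap.zero_apply] at this
      nlinarith [h.tpos w hw]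
    have hker := Module.Dual.finrank_ker_add_one_of_ne_zero g0
    have hli : LinearIndependent ℝ ![y₁, y₂, y₃, v] := by
      rw [Fintype.linearIndependent_iff]
      intro c hc
      simp only [Fin.sum_univ_four, Matrix.cons_val] at hc
      have a12 := q1 φ₂ h2.1 h12 h2.2.1
      have a13 := q1 φ₃ h3.1 h13 h3.2.1
      have a21 := q2 φ₁ h1.1 h12.symm h1.2.1
      have a23 := q2 φ₃ h3.1 h23 h3.2.1
      have a31 := q3 φ₁ h1.1 h13.symm h1.2.1
      have a32 := q3 φ₂ h2.1 h23.symm h2.2.1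
      have e1 := congrArg φ₁ hc
      have e2 := congrArg φ₂ hc
      have e3 := congrArg φ₃ hc
      simp only [map_add, map_smul, map_zero, smul_eq_mul, z1, z2, z3, h1.2.1, h2.2.1, h3.2.1,
        mul_zero, add_zero, zero_add] at e1 e2 e3
      have opp : ∀ {x y p q : ℝ}, 0 < p → 0 < q → x * p + y * q = 0 →
          (x = 0 ∧ y = 0) ∨ (x < 0 ∧ 0 < y) ∨ (0 < x ∧ y < 0) := by
        intro x y p q hp hq hxy
        rcases lt_trichotomy x 0 with hx | hx | hx
        · exact Or.inr (Or.inl ⟨hx, by nlinarith⟩)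
        · left
          refine ⟨hx, ?_⟩
          rw [hx, zero_mul, zero_add] at hxy
          exact (mul_eq_zero.1 hxy).resolve_right hq.ne'
        · exact Or.inr (Or.inr ⟨hx, by nlinarith⟩)
      have o1 := opp a21 a31 e1
      have o2 := opp a12 a32 e2
      have o3 := opp a13 a23 e3
      have c0 : c 0 = 0 := by grind
      have c1 : c 1 = 0 := by grind
      have c2 : c 2 = 0 := by grind
      have c3 : c 3 = 0 := by
        rw [c0, c1, c2] at hc
        have := congrArg t hc
        simp only [map_add, map_smul, map_zero, smul_eq_mul, zero_mul, zero_add] at this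
        exact (mul_eq_zero.1 this).resolve_right tv.ne'
      intro i
      fin_cases i
      exacts [c0, c1, c2, c3]
    have := card_le_finrank_of_mem hli (N := LinearMap.ker g) (fun i => by
      fin_cases i
      exacts [g1, g2, g3, gv])
    omega
  obtain ⟨v₀, hv₀, hmin⟩ := Finset.exists_min_image V m hV
  have side_card_lt : (Φ.filter fun φ => side v₀ φ).card < 2 := by
    rw [Finset.filter_false_of_mem]
    · simp
    · rintro φ - ⟨-, -, w, hw, -, hlt⟩
      exact absurd (hmin w hw) (not_le.2 hlt)
  calc ∑ φ ∈ Φ, (V.filter fun v => φ v = 0).card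
      ≤ ∑ φ ∈ Φ, (2 + (V.filter fun v => side v φ).card) := Finset.sum_le_sum facet_card_le
    _ = 2 * Φ.card + ∑ φ ∈ Φ, (V.filter fun v => side v φ).card := by
      rw [Finset.sum_add_distrib, Finset.sum_const, smul_eq_mul, mul_comm]
    _ = 2 * Φ.card + ∑ v ∈ V, (Φ.filter fun φ => side v φ).card := by
      congr 1
      exact (Finset.sum_card_bipartiteAbove_eq_sum_card_bipartiteBelow
        (s := V) (t := Φ) side).symm
    _ < 2 * Φ.card + ∑ v ∈ V, 2 := by
      gcongr 2 * Φ.card + ?_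
      exact Finset.sum_lt_sum side_card_le ⟨v₀, hv₀, side_card_lt⟩
    _ = _ := by rw [Finset.sum_const, smul_eq_mul, mul_comm V.card]

lemma sum_card_comm : ∑ v ∈ V, (Φ.filter fun φ => φ v = 0).card =
    ∑ φ ∈ Φ, (V.filter fun v => φ v = 0).card :=
  Finset.sum_card_bipartiteAbove_eq_sum_card_bipartiteBelow
    (s := V) (t := Φ) (fun (v : E) (φ : Module.Dual ℝ E) => φ v = 0)

lemma exists_small_facet (hd : Module.finrank ℝ E = 4) (hV : V.Nonempty) :
    ∃ φ ∈ Φ, (V.filter fun v => φ v = 0).card ≤ 5 := by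
  by_contra! hlt
  have h1 := h.sum_card_lt hd hV
  have h2 := Finset.card_nsmul_le_sum Φ _ 6 hlt
  have h3 := Finset.card_nsmul_le_sum V (fun v => (Φ.filter fun φ => φ v = 0).card) 3
    (fun v hv => by have := h.card_vertex hv; omega)
  rw [h.sum_card_comm] at h3
  simp only [smul_eq_mul] at h2 h3
  omega

lemma exists_small_vertex (hd : Module.finrank ℝ E = 4) (hV : V.Nonempty) :
    ∃ v ∈ V, (Φ.filter fun φ => φ v = 0).card ≤ 5 := by
  by_contra! hlt
  have h1 := h.sum_card_lt hd hV
  have h2 := Finset.card_nsmul_le_sum V _ 6 hlt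
  have h3 := Finset.card_nsmul_le_sum Φ (fun φ => (V.filter fun v => φ v = 0).card) 3
    (fun φ hφ => by have := h.card_facet hφ; omega)
  rw [h.sum_card_comm] at h2
  simp only [smul_eq_mul] at h2 h3
  omega

/-- A three-dimensional cone has at most as many generators as facets. -/
lemma card_le_card (hd : Module.finrank ℝ E = 3) : V.card ≤ Φ.card := by
  have h2 : ∀ φ ∈ Φ, (V.filter fun v => φ v = 0).card ≤ 2 := by
    intro φ hφ
    by_contra! hlt
    obtain ⟨a, ha, b, hb, c, hc, hab, hac, hbc⟩ := Finset.two_lt_card.1 hlt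
    simp only [Finset.mem_filter] at ha hb hc
    have hli := h.irredV.linearIndependent_three h.tpos ha.1 hb.1 hc.1 hab hac hbc
    have := card_le_finrank_of_mem hli (N := LinearMap.ker φ) (fun i => by
      fin_cases i
      exacts [ha.2, hb.2, hc.2])
    have := Module.Dual.finrank_ker_add_one_of_ne_zero (h.facet_ne_zero hφ)
    omega
  have h3 := Finset.sum_le_card_nsmul Φ _ 2 h2
  have h4 := Finset.card_nsmul_le_sum V (fun v => (Φ.filter fun φ => φ v = 0).card) 2
    (fun v hv => by have := h.card_vertex hv; omega)
  rw [h.sum_card_comm] at h4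
  simp only [smul_eq_mul] at h3 h4
  omega

end ConePair

end Counting

/-- Coordinate space: base plane times height. -/
abbrev Col := (ℝ × ℝ) × ℝ

/-- The determinant of three vectors. -/
def dt (a b c : Col) : ℝ :=
  a.1.1 * (b.1.2 * c.2 - b.2 * c.1.2) - a.1.2 * (b.1.1 * c.2 - b.2 * c.1.1) +
    a.2 * (b.1.1 * c.1.2 - b.1.2 * c.1.1)

lemma dt_relation (a b c d : Col) :
    dt b c d • a - dt a c d • b + dt a b d • c - dt a b c • d = 0 := by
  simp only [dt]
  ext <;> simp <;> ring

lemma finrank_col : Module.finrank ℝ Col = 3 := by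
  simp [Col]

/-- The cone generated by a finite family of vectors. -/
def coneF {E : Type*} [AddCommGroup E] [Module ℝ E] {n : ℕ} (v : Fin n → E) : Set E :=
  {x | ∃ c : Fin n → ℝ, (∀ i, 0 ≤ c i) ∧ ∑ i, c i • v i = x}

section Labeling

variable {E : Type*} [AddCommGroup E] [Module ℝ E]

lemma coneF_eq_ccone [DecidableEq E] {n : ℕ} {v : Fin n → E} (hv : Function.Injective v)
    {G : Finset E} (hG : Finset.univ.image v = G) : coneF v = ccone G := by
  subst hG
  ext x
  constructor
  · rintro ⟨c, hc, rfl⟩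
    exact sum_mem_ccone _ fun i _ => smul_mem_ccone (hc i) (mem_ccone_of_mem (by simp))
  · rintro ⟨c, hc, rfl⟩
    refine ⟨fun i => c (v i), fun i => hc _ (by simp), ?_⟩
    rw [Finset.sum_image fun _ _ _ _ h => hv h]

variable [FiniteDimensional ℝ E]

lemma Irred.exists_support [DecidableEq E] {G : Finset E} (hG : Irred G) {t : E →ₗ[ℝ] ℝ}
    (ht : ∀ g ∈ G, 0 < t g) {v : E} (hv : v ∈ G) :
    ∃ f : E →ₗ[ℝ] ℝ, f v = 0 ∧ ∀ g ∈ G, g ≠ v → 0 < f g := by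
  obtain ⟨Φ, hΦ⟩ := exists_dual_description (G.erase v)
  have h1 : ∃ φ ∈ Φ, φ v < 0 := by
    by_contra! h
    exact hG v hv ((hΦ v).2 h)
  obtain ⟨φ, hφ, hneg⟩ := h1
  refine ⟨t v • φ - φ v • t, by simp; ring, fun g hg hne => ?_⟩
  have h2 : 0 ≤ φ g := (hΦ g).1 (mem_ccone_of_mem (Finset.mem_erase.2 ⟨hne, hg⟩)) φ hφ
  have h3 := ht g hg
  have h4 := ht v hv
  simp only [LinearMap.sub_apply, LinearMap.smul_apply, smul_eq_mul]
  nlinarith [mul_nonneg h4.le h2]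

lemma dt_ne_zero {a b c : Col} (h : LinearIndependent ℝ ![a, b, c]) : dt a b c ≠ 0 := by
  intro h0
  rw [Fintype.linearIndependent_iff] at h
  have key : ∀ d : Col, dt a b d = 0 := by
    intro d
    have h1 := dt_relation a b c d
    rw [h0, zero_smul, sub_zero] at h1
    exact h ![dt b c d, -dt a c d, dt a b d] (by
      simp only [Fin.sum_univ_three, Matrix.cons_val]
      rw [← h1]; module) 2
  have k1 := key ((1, 0), 0)
  have k2 := key ((0, 1), 0)
  have k3 := key ((0, 0), 1)
  simp only [dt] at k1 k2 k3
  have l1 := h ![b.1.1, -a.1.1, 0] (by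
    simp only [Fin.sum_univ_three, Matrix.cons_val]
    ext <;> simp <;> linarith) 1
  have l2 := h ![b.1.2, -a.1.2, 0] (by
    simp only [Fin.sum_univ_three, Matrix.cons_val]
    ext <;> simp <;> linarith) 1
  have l3 := h ![b.2, -a.2, 0] (by
    simp only [Fin.sum_univ_three, Matrix.cons_val]
    ext <;> simp <;> linarith) 1
  simp only [Matrix.cons_val, neg_eq_zero] at l1 l2 l3
  have := h ![1, 0, 0] (by
    simp only [Fin.sum_univ_three, Matrix.cons_val]
    ext <;> simp [l1, l2, l3]) 0
  simp at this

/-- The extreme rays of a three-dimensional pointed cone can be put in cyclic order. -/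
lemma exists_labeling [DecidableEq E] (e : E ≃ₗ[ℝ] Col) {G : Finset E} (hG : Irred G)
    {t : E →ₗ[ℝ] ℝ} (ht : ∀ g ∈ G, 0 < t g) {m : ℕ} (hmpos : 0 < m)
    (hm : G.card = m + 1) :
    ∃ v : Fin (m + 1) → E, Function.Injective v ∧ Finset.univ.image v = G ∧
      ∀ i j k, i < j → j < k → 0 < dt (e (v i)) (e (v j)) (e (v k)) := by
  classical
  have rel : ∀ a b c d : E, dt (e b) (e c) (e d) • a - dt (e a) (e c) (e d) • b +
      dt (e a) (e b) (e d) • c - dt (e a) (e b) (e c) • d = 0 := by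
    intro a b c d
    apply e.injective
    simpa using dt_relation (e a) (e b) (e c) (e d)
  have hne : G.Nonempty := Finset.card_pos.1 (by omega)
  obtain ⟨p, hp⟩ := hne
  obtain ⟨f, hfp, hf⟩ := hG.exists_support ht hp
  have hcard : (G.erase p).card = m := by rw [Finset.card_erase_of_mem hp]; omega
  obtain ⟨o, ho⟩ := Finset.card_pos.1 (hcard.symm ▸ hmpos)
  have fpos : ∀ a ∈ G.erase p, 0 < f a := fun a ha =>
    hf a (Finset.mem_of_mem_erase ha) (Finset.ne_of_mem_erase ha)
  let s : E → ℝ := fun a => dt (e p) (e o) (e a) / f a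
  have hs : ∀ a ∈ G.erase p, ∀ b ∈ G.erase p,
      dt (e p) (e a) (e b) * f o = f a * f b * (s b - s a) := by
    intro a ha b hb
    have h1 := congrArg f (rel p o a b)
    simp only [map_add, map_sub, map_smul, smul_eq_mul, hfp, map_zero] at h1
    have ha' := (fpos a ha).ne'
    have hb' := (fpos b hb).ne'
    simp only [s]
    field_simp
    linarith
  have hinj : ∀ a ∈ G.erase p, ∀ b ∈ G.erase p, s a = s b → a = b := by
    intro a ha b hb hab
    by_contra hne
    have h0 : dt (e p) (e a) (e b) = 0 := by
      have := hs a ha b hb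
      rw [hab, sub_self, mul_zero] at this
      exact (mul_eq_zero.1 this).resolve_right (fpos o ho).ne'
    have hli := hG.linearIndependent_three ht hp (Finset.mem_of_mem_erase ha)
      (Finset.mem_of_mem_erase hb) (Finset.ne_of_mem_erase ha).symm
      (Finset.ne_of_mem_erase hb).symm hne
    have h4 : LinearIndependent ℝ ![e p, e a, e b] := by
      have h5 := hli.map' e.toLinearMap e.ker
      have h6 : (e.toLinearMap ∘ ![p, a, b] : Fin 3 → Col) = ![e p, e a, e b] := by
        funext i
        fin_cases i <;> rfl
      rwa [h6] at h5
    exact dt_ne_zero h4 h0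
  set T := (G.erase p).image s with hT
  have hTc : T.card = m := by
    rw [hT, Finset.card_image_of_injOn, hcard]
    exact fun a ha b hb h => hinj a ha b hb h
  have hw : ∀ i : Fin m, ∃ a ∈ G.erase p, s a = T.orderEmbOfFin hTc i := fun i =>
    Finset.mem_image.1 (Finset.orderEmbOfFin_mem T hTc i)
  choose w hwm hws using hw
  have wmono : ∀ i j, i < j → s (w i) < s (w j) := fun i j hij => by
    rw [hws, hws]; exact (T.orderEmbOfFin hTc).strictMono hij
  have winj : Function.Injective w := by
    intro i j hij
    by_contra hne
    rcases lt_or_gt_of_ne hne with h | h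
    · exact absurd (wmono _ _ h) (by rw [hij]; exact lt_irrefl _)
    · exact absurd (wmono _ _ h) (by rw [hij]; exact lt_irrefl _)
  have h0 : ∀ i j, i < j → 0 < dt (e p) (e (w i)) (e (w j)) := by
    intro i j hij
    have h1 := hs _ (hwm i) _ (hwm j)
    have h2 := fpos _ (hwm i)
    have h3 := fpos _ (hwm j)
    have h4 := sub_pos.2 (wmono _ _ hij)
    have h5 : 0 < dt (e p) (e (w i)) (e (w j)) * f o := by rw [h1]; positivity
    exact (pos_iff_pos_of_mul_pos h5).2 (fpos o ho)
  have hinjv : Function.Injective (Fin.cons p w : Fin (m + 1) → E) :=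
    Fin.cons_injective_iff.2 ⟨by
      rintro ⟨i, hi⟩
      exact Finset.ne_of_mem_erase (hwm i) hi, winj⟩
  refine ⟨Fin.cons p w, hinjv, ?_, ?_⟩
  · refine Finset.eq_of_subset_of_card_le ?_ ?_
    · intro x hx
      obtain ⟨i, -, rfl⟩ := Finset.mem_image.1 hx
      refine Fin.cases hp (fun i => ?_) i
      exact Finset.mem_of_mem_erase (hwm i)
    · rw [Finset.card_image_of_injective _ hinjv, hm]; simp
  · intro i j k hij hjk
    induction j using Fin.cases with
    | zero => exact absurd hij (Fin.not_lt_zero _)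
    | succ j =>
    induction k using Fin.cases with
    | zero => exact absurd hjk (Fin.not_lt_zero _)
    | succ k =>
    rw [Fin.succ_lt_succ_iff] at hjk
    induction i using Fin.cases with
    | zero => simpa using h0 j k hjk
    | succ i =>
    rw [Fin.succ_lt_succ_iff] at hij
    simp only [Fin.cons_succ]
    by_contra! hneg
    have r := rel p (w i) (w j) (w k)
    have hik := h0 i k (hij.trans hjk)
    apply hG (w j) (Finset.mem_of_mem_erase (hwm j))
    have m1 : ∀ x ∈ G, x ≠ w j → x ∈ ccone (G.erase (w j)) := fun x hx hne =>
      mem_ccone_of_mem (Finset.mem_erase.2 ⟨hne, hx⟩)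
    have e1 : w j = (dt (e p) (e (w i)) (e (w k)))⁻¹ • (dt (e p) (e (w j)) (e (w k)) • w i +
        dt (e p) (e (w i)) (e (w j)) • w k + (-dt (e (w i)) (e (w j)) (e (w k))) • p) := by
      rw [eq_inv_smul_iff₀ hik.ne', ← sub_eq_zero, ← r]
      module
    obtain ⟨S, hS⟩ : ∃ S, S = G.erase (w j) := ⟨_, rfl⟩
    rw [← hS] at m1 ⊢
    rw [e1]
    refine smul_mem_ccone (inv_nonneg.2 hik.le) (add_mem_ccone (add_mem_ccone ?_ ?_) ?_)
    · exact smul_mem_ccone (h0 j k hjk).le (m1 _ (Finset.mem_of_mem_erase (hwm i))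
        fun h => hij.ne (winj h))
    · exact smul_mem_ccone (h0 i j hij).le (m1 _ (Finset.mem_of_mem_erase (hwm k))
        fun h => hjk.ne' (winj h))
    · exact smul_mem_ccone (neg_nonneg.2 hneg) (m1 _ hp (Finset.ne_of_mem_erase (hwm j)).symm)

end Labeling

section CellDecompositions

lemma linearIndependent_of_dt {a b c : Col} (h : dt a b c ≠ 0) :
    LinearIndependent ℝ ![a, b, c] := by
  rw [Fintype.linearIndependent_iff]
  intro g hg
  simp only [Fin.sum_univ_three, Matrix.cons_val] at hg
  have h1 := congrArg (fun x => dt x b c) hg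
  have h2 := congrArg (fun x => dt a x c) hg
  have h3 := congrArg (fun x => dt a b x) hg
  simp only [dt, Prod.fst_add, Prod.snd_add, Prod.smul_fst, Prod.smul_snd, Prod.fst_zero,
    Prod.snd_zero, smul_eq_mul] at h1 h2 h3
  have k1 : g 0 * dt a b c = 0 := by simp only [dt]; linear_combination h1
  have k2 : g 1 * dt a b c = 0 := by simp only [dt]; linear_combination h2
  have k3 : g 2 * dt a b c = 0 := by simp only [dt]; linear_combination h3
  intro i
  fin_cases i
  · exact (mul_eq_zero.1 k1).resolve_right h
  · exact (mul_eq_zero.1 k2).resolve_right h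
  · exact (mul_eq_zero.1 k3).resolve_right h

lemma exists_equiv_col {E : Type*} [AddCommGroup E] [Module ℝ E]
    (hE : Module.finrank ℝ E = 3) {a b c : E} (h : LinearIndependent ℝ ![a, b, c]) {p q r : Col}
    (hd : dt p q r ≠ 0) : ∃ ρ : E ≃ₗ[ℝ] Col, ρ a = p ∧ ρ b = q ∧ ρ c = r := by
  let B := basisOfLinearIndependentOfCardEqFinrank h (by simp [hE])
  let B' := basisOfLinearIndependentOfCardEqFinrank (linearIndependent_of_dt hd)
    (by simp)
  refine ⟨B.equiv B' (Equiv.refl _), ?_, ?_, ?_⟩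
  · have := B.equiv_apply 0 B' (Equiv.refl _)
    simpa [B, B'] using this
  · have := B.equiv_apply 1 B' (Equiv.refl _)
    simpa [B, B'] using this
  · have := B.equiv_apply 2 B' (Equiv.refl _)
    simpa [B, B'] using this

lemma mem_coneF_congr {E F : Type*} [AddCommGroup E] [Module ℝ E] [AddCommGroup F] [Module ℝ F]
    {n : ℕ} {v : Fin n → E} {w : Fin n → F} (ρ : E ≃ₗ[ℝ] F) {μ : Fin n → ℝ} (hμ : ∀ i, 0 < μ i)
    (h : ∀ i, ρ (v i) = μ i • w i) (x : E) : x ∈ coneF v ↔ ρ x ∈ coneF w := by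
  constructor
  · rintro ⟨c, hc, rfl⟩
    refine ⟨fun i => c i * μ i, fun i => mul_nonneg (hc i) (hμ i).le, ?_⟩
    simp [h, mul_smul]
  · rintro ⟨c, hc, hx⟩
    refine ⟨fun i => c i / μ i, fun i => div_nonneg (hc i) (hμ i).le, ?_⟩
    apply ρ.injective
    rw [← hx, map_sum]
    refine Finset.sum_congr rfl fun i _ => ?_
    rw [map_smul, h, smul_smul, div_mul_cancel₀ _ (hμ i).ne']

/-- The positive octant. -/
def oct : Set Col := {Y | 0 ≤ Y.1.1 ∧ 0 ≤ Y.1.2 ∧ 0 ≤ Y.2}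

/-- The octant decomposes into finitely many linear copies of `K`, namely the domains of linearity
of a convex piecewise linear function, only one of which contains the first axis. -/
def CellDecomp {E : Type*} [AddCommGroup E] [Module ℝ E] (K : Set E) : Prop :=
  ∃ (ι : Type) (_ : Finite ι) (g : ι → Col →ₗ[ℝ] ℝ) (κ : ι → E ≃ₗ[ℝ] Col),
    Function.Injective g ∧
    (∀ j x, x ∈ K ↔ κ j x ∈ oct ∧ ∀ k, g k (κ j x) ≤ g j (κ j x)) ∧
    ∃ j₀, ∀ k, k ≠ j₀ → g k ((1, 0), 0) < g j₀ ((1, 0), 0)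

/-- The linear functional with given coefficients. -/
def lin (a b c : ℝ) : Col →ₗ[ℝ] ℝ where
  toFun Y := a * Y.1.1 + b * Y.1.2 + c * Y.2
  map_add' X Y := by simp; ring
  map_smul' r X := by simp; ring

@[simp] lemma lin_apply (a b c : ℝ) (Y : Col) : lin a b c Y = a * Y.1.1 + b * Y.1.2 + c * Y.2 := rfl

/-- Cyclic permutation of the coordinates. -/
def cyc : Col ≃ₗ[ℝ] Col where
  toFun Y := ((Y.1.2, Y.2), Y.1.1)
  invFun Y := ((Y.2, Y.1.1), Y.1.2)
  map_add' X Y := by simp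
  map_smul' r X := by simp
  left_inv X := by simp
  right_inv X := by simp

@[simp] lemma cyc_apply (Y : Col) : cyc Y = ((Y.1.2, Y.2), Y.1.1) := rfl

variable {E : Type*} [AddCommGroup E] [Module ℝ E]

lemma cellDecomp_three (hE : Module.finrank ℝ E = 3) {v : Fin 3 → E}
    (hv : LinearIndependent ℝ ![v 0, v 1, v 2]) : CellDecomp (coneF v) := by
  obtain ⟨ρ, h0, h1, h2⟩ := exists_equiv_col hE hv (p := ((1, 0), 0)) (q := ((0, 1), 0))
    (r := ((0, 0), 1)) (by simp [dt])
  refine ⟨Unit, inferInstance, fun _ => 0, fun _ => ρ, fun _ _ _ => rfl, fun _ x => ?_,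
    (), fun k hk => absurd rfl hk⟩
  rw [mem_coneF_congr (w := ![((1, 0), 0), ((0, 1), 0), ((0, 0), 1)]) ρ (μ := 1) (by simp)
    (by intro i; fin_cases i <;> simp [h0, h1, h2])]
  simp only [LinearMap.zero_apply, le_refl, implies_true, and_true]
  constructor
  · rintro ⟨c, hc, hx⟩
    rw [← hx]
    simp [Fin.sum_univ_three, oct, hc]
  · rintro ⟨hx, hy, hz⟩
    refine ⟨![(ρ x).1.1, (ρ x).1.2, (ρ x).2], ?_, ?_⟩
    · intro i; fin_cases i <;> simpa
    · ext <;> simp [Fin.sum_univ_three]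

lemma mem_coneF_square (Y : Col) :
    Y ∈ coneF ![(((0, 0), 1) : Col), ((1, 0), 1), ((1, 1), 1), ((0, 1), 1)] ↔
      0 ≤ Y.1.1 ∧ 0 ≤ Y.1.2 ∧ Y.1.1 ≤ Y.2 ∧ Y.1.2 ≤ Y.2 := by
  obtain ⟨⟨x, y⟩, z⟩ := Y
  constructor
  · rintro ⟨c, hc, hx⟩
    simp [Fin.sum_univ_four] at hx
    obtain ⟨⟨rfl, rfl⟩, rfl⟩ := hx
    refine ⟨?_, ?_, ?_, ?_⟩ <;> dsimp only <;> linarith [hc 0, hc 1, hc 2, hc 3]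
  · rintro ⟨hx, hy, hxz, hyz⟩
    dsimp only at *
    rcases (hx.trans hxz).eq_or_lt with rfl | hz
    · obtain rfl : x = 0 := le_antisymm hxz hx
      obtain rfl : y = 0 := le_antisymm hyz hy
      exact ⟨0, by simp, by simp; rfl⟩
    · refine ⟨![(z - x) * (z - y) / z, x * (z - y) / z, x * y / z, (z - x) * y / z], ?_, ?_⟩
      · intro i
        have h1 := sub_nonneg.2 hxz
        have h2 := sub_nonneg.2 hyz
        fin_cases i <;> simp <;> positivity
      · simp [Fin.sum_univ_four]
        refine ⟨⟨?_, ?_⟩, ?_⟩ <;> field_simp <;> ring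

lemma cellDecomp_four (hE : Module.finrank ℝ E = 3) {v : Fin 4 → E}
    (hv : LinearIndependent ℝ ![v 0, v 1, v 2]) {α β γ : ℝ} (hα : 0 < α) (hβ : 0 < β) (hγ : 0 < γ)
    (h3 : v 3 = α • v 0 - β • v 1 + γ • v 2) : CellDecomp (coneF v) := by
  obtain ⟨ρ, h0, h1, h2⟩ := exists_equiv_col hE hv (p := ((0, 0), α⁻¹)) (q := ((β⁻¹, 0), β⁻¹))
    (r := ((γ⁻¹, γ⁻¹), γ⁻¹)) (by simp [dt, hα.ne', hβ.ne', hγ.ne'])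
  have key : ∀ x, x ∈ coneF v ↔ 0 ≤ (ρ x).1.1 ∧ 0 ≤ (ρ x).1.2 ∧ (ρ x).1.1 ≤ (ρ x).2 ∧
      (ρ x).1.2 ≤ (ρ x).2 := by
    intro x
    rw [← mem_coneF_square]
    refine mem_coneF_congr ρ (μ := ![α⁻¹, β⁻¹, γ⁻¹, 1]) ?_ ?_ x
    · intro i; fin_cases i <;> simp [hα, hβ, hγ]
    · intro i
      fin_cases i
      · simp [h0]
      · simp [h1]
      · simp [h2]
      · simp [h3, h0, h1, h2, hα.ne', hβ.ne', hγ.ne']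
  refine ⟨Fin 3, inferInstance, ![lin 1 0 0, lin 0 1 0, lin 0 0 1],
    ![ρ.trans (cyc.trans cyc), ρ.trans cyc, ρ], ?_, ?_, 0, ?_⟩
  · intro i j hij
    have h1 := LinearMap.congr_fun hij ((1, 0), 0)
    have h2 := LinearMap.congr_fun hij ((0, 1), 0)
    fin_cases i <;> fin_cases j <;> simp at h1 h2 <;> rfl
  · intro j x
    rw [key]
    fin_cases j <;> simp [oct, Fin.forall_fin_succ] <;> grind
  · intro k hk
    fin_cases k
    · exact absurd rfl hk
    · simp
    · simp

lemma exists_shear {F : Type*} [AddCommGroup F] [Module ℝ F] {f : F →ₗ[ℝ] ℝ} {u : F}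
    (h : f u ≠ 1) : ∃ S : F ≃ₗ[ℝ] F, ∀ Y, S Y = Y - f Y • u := by
  have h' : 1 - f u ≠ 0 := sub_ne_zero.2 h.symm
  refine ⟨{ toFun := fun Y => Y - f Y • u
            invFun := fun X => X + (f X / (1 - f u)) • u
            map_add' := fun X Y => by simp only [map_add]; module
            map_smul' := fun r X => by simp only [map_smul, smul_eq_mul, RingHom.id_apply]; module
            left_inv := fun X => ?_
            right_inv := fun X => ?_ }, fun Y => rfl⟩
  · have : f (X - f X • u) / (1 - f u) = f X := by
      rw [div_eq_iff h', map_sub, map_smul, smul_eq_mul]; ring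
    dsimp only
    rw [this, sub_add_cancel]
  · have : f (X + (f X / (1 - f u)) • u) = f X / (1 - f u) := by
      rw [map_add, map_smul, smul_eq_mul]; field_simp; ring
    dsimp only
    rw [this, add_sub_cancel_right]

/-- A symmetric polyhedral cone condition: the cells around a vertex of a polyhedron seen from that
vertex. -/
lemma cellDecomp_of_facets {K : Set E} {L : Set (Col →ₗ[ℝ] ℝ)} (hL : L.Finite) {u D : Col}
    {f₀ f₁ f₂ f₃ : Col →ₗ[ℝ] ℝ} (τ : Col ≃ₗ[ℝ] Col) (hτ : ∀ X, τ X = ((-f₁ X, -f₂ X), -f₃ X))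
    (m0 : f₀ ∈ L) (m1 : f₁ ∈ L) (m2 : f₂ ∈ L) (m3 : f₃ ∈ L) (u0 : f₀ u < 1) (u1 : f₁ u = 1)
    (u2 : f₂ u = 1) (u3 : f₃ u = 1) (hu : ∀ f ∈ L, f = f₁ ∨ f = f₂ ∨ f = f₃ ∨ f u < 1)
    (hρ : ∀ f ∈ L, ∃ ρ : E ≃ₗ[ℝ] Col, ∀ x, x ∈ K ↔ ∀ h ∈ L, h (ρ x) ≤ f (ρ x))
    (d0 : f₀ D = 1) (d2 : f₂ D = 1) (d3 : f₃ D = 1)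
    (hd : ∀ f ∈ L, f = f₀ ∨ f = f₂ ∨ f = f₃ ∨ f D < 1) : CellDecomp K := by
  have hs : ∀ f : {f // f ∈ L ∧ f u < 1}, ∃ S : Col ≃ₗ[ℝ] Col, ∀ Y, S Y = Y - f.1 Y • u :=
    fun f => exists_shear f.2.2.ne
  choose S hS using hs
  choose ρ hρ using hρ
  have hD1 : f₁ D < 1 := by
    rcases hd f₁ m1 with h | h | h | h
    · rw [← h, u1] at u0; exact absurd u0 (lt_irrefl _)
    · exfalso
      have := τ.surjective ((1, 0), 0)
      obtain ⟨X, hX⟩ := this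
      rw [hτ, h] at hX
      simp at hX
      linarith [hX.1.1, hX.1.2]
    · exfalso
      have := τ.surjective ((1, 0), 0)
      obtain ⟨X, hX⟩ := this
      rw [hτ, h] at hX
      simp at hX
      linarith [hX.1.1, hX.2]
    · exact h
  have hfin : Finite {f // f ∈ L ∧ f u < 1} := (hL.subset fun f hf => hf.1).to_subtype
  have hfS : ∀ (f : {f // f ∈ L ∧ f u < 1}) Y, (1 - f.1 u)⁻¹ * f.1 (S f Y) = f.1 Y := by
    intro f Y
    have := (sub_pos.2 f.2.2).ne'
    rw [hS, map_sub, map_smul, smul_eq_mul]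
    field_simp
  refine ⟨{f // f ∈ L ∧ f u < 1}, hfin, fun f => ((1 - f.1 u)⁻¹ • f.1) ∘ₗ τ.symm.toLinearMap,
    fun f => (ρ f.1 f.2.1).trans ((S f).trans τ), ?_, ?_, ⟨f₀, m0, u0⟩, ?_⟩
  · intro f h hfh
    have e : ∀ X, (1 - f.1 u)⁻¹ * f.1 X = (1 - h.1 u)⁻¹ * h.1 X := by
      intro X
      have := LinearMap.congr_fun hfh (τ X)
      simpa using this
    have pf := sub_pos.2 f.2.2
    have ph := sub_pos.2 h.2.2
    have e1 : f.1 u = h.1 u := by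
      have := e u
      field_simp at this
      linarith
    apply Subtype.ext
    refine LinearMap.ext fun X => ?_
    have := e X
    rw [e1] at this
    exact mul_left_cancel₀ (inv_ne_zero ph.ne') this
  · intro f x
    rw [hρ f.1 f.2.1]
    set Y := ρ f.1 f.2.1 x with hY
    have hSY : ∀ h : Col →ₗ[ℝ] ℝ, h (S f Y) = h Y - f.1 Y * h u := fun h => by
      rw [hS, map_sub, map_smul, smul_eq_mul]
    simp only [LinearEquiv.trans_apply, LinearMap.comp_apply, LinearEquiv.coe_coe,
      LinearEquiv.symm_apply_apply, LinearMap.smul_apply, smul_eq_mul, ← hY, hfS]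
    rw [hτ]
    simp only [oct, Set.mem_ofPred_eq, hSY, u1, u2, u3, mul_one]
    constructor
    · intro h
      refine ⟨⟨by linarith [h _ m1], by linarith [h _ m2], by linarith [h _ m3]⟩, fun k => ?_⟩
      rw [inv_mul_le_iff₀ (sub_pos.2 k.2.2)]
      linarith [h _ k.2.1]
    · rintro ⟨⟨h1, h2, h3⟩, h4⟩ h hh
      rcases hu h hh with rfl | rfl | rfl | hlt
      · linarith
      · linarith
      · linarith
      · have := h4 ⟨h, hh, hlt⟩
        rw [inv_mul_le_iff₀ (sub_pos.2 hlt)] at this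
        dsimp only at this
        linarith
  · rintro ⟨f, hf, hfu⟩ hne
    have hD : ((1, 0), 0) = τ ((1 - f₁ D)⁻¹ • (D - u)) := by
      have := (sub_pos.2 hD1).ne'
      rw [map_smul, hτ]
      simp [u1, u2, u3, d2, d3]
      field_simp
    have hne' : f ≠ f₀ := fun h => hne (Subtype.ext h)
    have hfD : f D < 1 := by
      rcases hd f hf with h | h | h | h
      · exact absurd h hne'
      · rw [h, u2] at hfu; exact absurd hfu (lt_irrefl _)
      · rw [h, u3] at hfu; exact absurd hfu (lt_irrefl _)
      · exact h
    rw [hD]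
    have p0 := sub_pos.2 u0
    have pf := sub_pos.2 hfu
    simp only [LinearMap.comp_apply, LinearEquiv.coe_coe,
      LinearEquiv.symm_apply_apply, LinearMap.smul_apply, smul_eq_mul, map_smul, map_sub, d0]
    have e0 : (1 - f₀ u)⁻¹ * 1 - (1 - f₀ u)⁻¹ * f₀ u = 1 := by
      field_simp
    rw [e0, ← mul_sub, mul_one]
    apply mul_lt_of_lt_one_right (inv_pos.2 (sub_pos.2 hD1))
    rw [inv_mul_lt_one₀ pf]
    linarith

end CellDecompositions

section Pentagons

lemma CellDecomp.congr {E F : Type*} [AddCommGroup E] [Module ℝ E] [AddCommGroup F] [Module ℝ F]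
    {K : Set E} {K' : Set F} (ρ : E ≃ₗ[ℝ] F) (h : ∀ x, x ∈ K ↔ ρ x ∈ K') (hK : CellDecomp K') :
    CellDecomp K := by
  obtain ⟨ι, hι, g, κ, hg, hκ, hj⟩ := hK
  exact ⟨ι, hι, g, fun j => ρ.trans (κ j), hg, fun j x => by rw [h, hκ j]; rfl, hj⟩

lemma mem_coneF {E : Type*} [AddCommGroup E] [Module ℝ E] {n : ℕ} (v : Fin n → E) (i : Fin n) :
    v i ∈ coneF v := by
  refine ⟨Pi.single i 1, fun j => ?_, ?_⟩
  · by_cases h : j = i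
    · subst h; simp
    · simp [h]
  · simp [Pi.single_apply]

lemma add_mem_coneF {E : Type*} [AddCommGroup E] [Module ℝ E] {n : ℕ} {v : Fin n → E} {x y : E}
    (hx : x ∈ coneF v) (hy : y ∈ coneF v) : x + y ∈ coneF v := by
  obtain ⟨c, hc, rfl⟩ := hx
  obtain ⟨d, hd, rfl⟩ := hy
  exact ⟨c + d, fun i => add_nonneg (hc i) (hd i), by simp [add_smul, Finset.sum_add_distrib]⟩

lemma smul_mem_coneF {E : Type*} [AddCommGroup E] [Module ℝ E] {n : ℕ} {v : Fin n → E} {r : ℝ}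
    (hr : 0 ≤ r) {x : E} (hx : x ∈ coneF v) : r • x ∈ coneF v := by
  obtain ⟨c, hc, rfl⟩ := hx
  exact ⟨fun i => r * c i, fun i => mul_nonneg hr (hc i), by simp [mul_smul, Finset.smul_sum]⟩

/-- Fan triangulation of a pentagonal cone. -/
lemma mem_coneF_five {v : Fin 5 → Col} (h1 : 0 < dt (v 0) (v 1) (v 2))
    (h2 : 0 < dt (v 0) (v 2) (v 3)) (h3 : 0 < dt (v 0) (v 3) (v 4)) {Y : Col}
    (e1 : 0 ≤ dt (v 0) (v 1) Y) (e2 : 0 ≤ dt (v 1) (v 2) Y) (e3 : 0 ≤ dt (v 2) (v 3) Y)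
    (e4 : 0 ≤ dt (v 3) (v 4) Y) (e5 : 0 ≤ dt (v 4) (v 0) Y) : Y ∈ coneF v := by
  have e5' : dt (v 0) (v 4) Y ≤ 0 := by
    have : dt (v 0) (v 4) Y = - dt (v 4) (v 0) Y := by simp only [dt]; ring
    linarith
  have key : ∀ a b c : Fin 5, 0 < dt (v a) (v b) (v c) →
      0 ≤ dt (v b) (v c) Y → dt (v a) (v c) Y ≤ 0 → 0 ≤ dt (v a) (v b) Y → Y ∈ coneF v := by
    intro a b c hd p q r
    have hY : Y = (dt (v a) (v b) (v c))⁻¹ • (dt (v b) (v c) Y • v a +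
        (-dt (v a) (v c) Y) • v b + dt (v a) (v b) Y • v c) := by
      rw [eq_inv_smul_iff₀ hd.ne', eq_comm, ← sub_eq_zero, ← dt_relation (v a) (v b) (v c) Y]
      module
    obtain ⟨x, hx⟩ : ∃ x, x = dt (v b) (v c) Y := ⟨_, rfl⟩
    obtain ⟨y, hy⟩ : ∃ y, y = -dt (v a) (v c) Y := ⟨_, rfl⟩
    obtain ⟨z, hz⟩ : ∃ z, z = dt (v a) (v b) Y := ⟨_, rfl⟩
    rw [← hx, ← hy, ← hz] at hY
    rw [hY]
    exact smul_mem_coneF (inv_nonneg.2 hd.le) (add_mem_coneF (add_mem_coneF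
      (smul_mem_coneF (hx ▸ p) (mem_coneF v a))
      (smul_mem_coneF (hy ▸ neg_nonneg.2 q) (mem_coneF v b)))
      (smul_mem_coneF (hz ▸ r) (mem_coneF v c)))
  rcases le_or_gt (dt (v 0) (v 2) Y) 0 with hA | hA
  · exact key 0 1 2 h1 e2 hA e1
  rcases le_or_gt (dt (v 0) (v 3) Y) 0 with hB | hB
  · exact key 0 2 3 h2 e3 hB hA.le
  · exact key 0 3 4 h3 e4 e5' hB.le

/-- The orbit of a functional under the rotation group of the tetrahedron. -/
def tetraOrbit (a b c : ℝ) : Set (Col →ₗ[ℝ] ℝ) :=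
  {f | ∃ s t : ℝ, (s = 1 ∨ s = -1) ∧ (t = 1 ∨ t = -1) ∧
    (f = lin (s * a) (t * b) (s * t * c) ∨ f = lin (s * b) (t * c) (s * t * a) ∨
      f = lin (s * c) (t * a) (s * t * b))}

lemma tetraOrbit_finite (a b c : ℝ) : (tetraOrbit a b c).Finite := by
  have : tetraOrbit a b c ⊆ ⋃ s ∈ ({1, -1} : Set ℝ), ⋃ t ∈ ({1, -1} : Set ℝ),
      {lin (s * a) (t * b) (s * t * c), lin (s * b) (t * c) (s * t * a),
        lin (s * c) (t * a) (s * t * b)} := by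
    rintro f ⟨s, t, hs, ht, h⟩
    simp only [mem_iUnion]
    exact ⟨s, hs, t, ht, h⟩
  refine Set.Finite.subset ?_ this
  refine Set.Finite.biUnion (by simp) fun s _ => Set.Finite.biUnion (by simp) fun t _ => ?_
  simp

/-- Changing the signs of two coordinates. -/
def flip2 (s t : ℝ) (hs : s = 1 ∨ s = -1) (ht : t = 1 ∨ t = -1) : Col ≃ₗ[ℝ] Col where
  toFun Y := ((s * Y.1.1, t * Y.1.2), s * t * Y.2)
  invFun Y := ((s * Y.1.1, t * Y.1.2), s * t * Y.2)
  map_add' X Y := by ext <;> simp <;> ring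
  map_smul' r X := by ext <;> simp <;> ring
  left_inv X := by rcases hs with rfl | rfl <;> rcases ht with rfl | rfl <;> simp
  right_inv X := by rcases hs with rfl | rfl <;> rcases ht with rfl | rfl <;> simp

lemma flip2_apply {s t : ℝ} (hs : s = 1 ∨ s = -1) (ht : t = 1 ∨ t = -1) (Y : Col) :
    flip2 s t hs ht Y = ((s * Y.1.1, t * Y.1.2), s * t * Y.2) := rfl

lemma sign_or_mul {s t : ℝ} (hs : s = 1 ∨ s = -1) (ht : t = 1 ∨ t = -1) :
    s * t = 1 ∨ s * t = -1 := by
  rcases hs with rfl | rfl <;> rcases ht with rfl | rfl <;> simp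

lemma tetraOrbit_cyc {a b c : ℝ} {f : Col →ₗ[ℝ] ℝ} (hf : f ∈ tetraOrbit a b c) :
    f ∘ₗ cyc.toLinearMap ∈ tetraOrbit a b c := by
  obtain ⟨s, t, hs, ht, h⟩ := hf
  refine ⟨s * t, s, sign_or_mul hs ht, hs, ?_⟩
  have e : s * t * s = t := by rcases hs with rfl | rfl <;> simp
  rcases h with rfl | rfl | rfl
  · refine Or.inr (Or.inr ?_)
    refine LinearMap.ext fun X => ?_
    simp [e]; ring
  · refine Or.inl ?_
    refine LinearMap.ext fun X => ?_
    simp [e]; ring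
  · refine Or.inr (Or.inl ?_)
    refine LinearMap.ext fun X => ?_
    simp [e]; ring

lemma tetraOrbit_flip {a b c s t : ℝ} (hs : s = 1 ∨ s = -1) (ht : t = 1 ∨ t = -1)
    {f : Col →ₗ[ℝ] ℝ} (hf : f ∈ tetraOrbit a b c) :
    f ∘ₗ (flip2 s t hs ht).toLinearMap ∈ tetraOrbit a b c := by
  obtain ⟨s', t', hs', ht', h⟩ := hf
  refine ⟨s' * s, t' * t, sign_or_mul hs' hs, sign_or_mul ht' ht, ?_⟩
  rcases h with rfl | rfl | rfl
  · refine Or.inl ?_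
    refine LinearMap.ext fun X => ?_
    simp [flip2_apply]; ring
  · refine Or.inr (Or.inl ?_)
    refine LinearMap.ext fun X => ?_
    simp [flip2_apply]; ring
  · refine Or.inr (Or.inr ?_)
    refine LinearMap.ext fun X => ?_
    simp [flip2_apply]; ring

lemma tetraOrbit_transitive {a b c : ℝ} {f : Col →ₗ[ℝ] ℝ} (hf : f ∈ tetraOrbit a b c) :
    ∃ A : Col ≃ₗ[ℝ] Col, (∀ Y, f (A Y) = lin a b c Y) ∧
      (∀ h ∈ tetraOrbit a b c, h ∘ₗ A.toLinearMap ∈ tetraOrbit a b c) ∧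
      ∀ h ∈ tetraOrbit a b c, h ∘ₗ A.symm.toLinearMap ∈ tetraOrbit a b c := by
  have hcs : ∀ h ∈ tetraOrbit a b c, h ∘ₗ cyc.symm.toLinearMap ∈ tetraOrbit a b c := by
    intro h hh
    have : h ∘ₗ cyc.symm.toLinearMap = (h ∘ₗ cyc.toLinearMap) ∘ₗ cyc.toLinearMap := by
      refine LinearMap.ext fun X => ?_
      simp; rfl
    rw [this]
    exact tetraOrbit_cyc (tetraOrbit_cyc hh)
  obtain ⟨s, t, hs, ht, h⟩ := hf
  have es : s * s = 1 := by rcases hs with rfl | rfl <;> simp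
  have et : t * t = 1 := by rcases ht with rfl | rfl <;> simp
  have hF : ∀ h ∈ tetraOrbit a b c, h ∘ₗ (flip2 s t hs ht).toLinearMap ∈ tetraOrbit a b c :=
    fun h => tetraOrbit_flip hs ht
  have hF' : ∀ h ∈ tetraOrbit a b c, h ∘ₗ (flip2 s t hs ht).symm.toLinearMap ∈ tetraOrbit a b c :=
    fun h => tetraOrbit_flip hs ht
  rcases h with rfl | rfl | rfl
  · refine ⟨flip2 s t hs ht, fun Y => ?_, hF, hF'⟩
    simp only [flip2_apply, lin_apply]
    linear_combination (a * Y.1.1 + c * t * t * Y.2) * es + (b * Y.1.2 + c * Y.2) * et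
  · refine ⟨cyc.trans (flip2 s t hs ht), fun Y => ?_, fun h hh => tetraOrbit_cyc (hF h hh),
      fun h hh => hF' _ (hcs h hh)⟩
    simp only [flip2_apply, lin_apply, LinearEquiv.trans_apply, cyc_apply]
    linear_combination (b * Y.1.2 + a * t * t * Y.1.1) * es + (c * Y.2 + a * Y.1.1) * et
  · refine ⟨cyc.symm.trans (flip2 s t hs ht), fun Y => ?_, fun h hh => hcs _ (hF h hh),
      fun h hh => hF' _ (tetraOrbit_cyc hh)⟩
    have : cyc.symm Y = ((Y.2, Y.1.1), Y.1.2) := rfl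
    simp only [flip2_apply, lin_apply, LinearEquiv.trans_apply, this]
    linear_combination (c * Y.2 + b * t * t * Y.1.2) * es + (a * Y.1.1 + b * Y.1.2) * et

/-- The vertices of a face of the tetartoid with parameters `u`, `w`. -/
def pent (u w : ℝ) : Fin 5 → Col :=
  ![((u + w, u - w), u + w + 2), ((1, 1), 1), ((u - w, u + w + 2), u + w), ((-1, 1), 1),
    ((-(u + w), -(u - w)), u + w + 2)]

lemma mem_pent {u w : ℝ} (hu : 0 < u) (hw : 0 < w) (Y : Col) : Y ∈ coneF (pent u w) ↔
    ∀ h ∈ tetraOrbit (w - u) (u + w) (u + w + 2 * u * w),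
      h Y ≤ lin (w - u) (u + w) (u + w + 2 * u * w) Y := by
  have m1 := mul_pos hu hw
  have m2 := mul_pos hu hu
  have m3 := mul_pos hw hw
  have m4 := mul_pos m1 hu
  have m5 := mul_pos m1 hw
  constructor
  · rintro ⟨k, hk, rfl⟩ h hh
    rw [map_sum, map_sum]
    refine Finset.sum_le_sum fun i _ => ?_
    rw [map_smul, map_smul, smul_eq_mul, smul_eq_mul]
    refine mul_le_mul_of_nonneg_left ?_ (hk i)
    obtain ⟨s, t, hs, ht, h⟩ := hh
    rcases hs with rfl | rfl <;> rcases ht with rfl | rfl <;> rcases h with rfl | rfl | rfl <;>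
      fin_cases i <;> simp [pent] <;> nlinarith
  · intro h
    have k8 := h (lin (u + w + 2 * u * w) (w - u) (u + w))
      ⟨1, 1, Or.inl rfl, Or.inl rfl, by simp⟩
    have k4 := h (lin (u + w) (u + w + 2 * u * w) (w - u))
      ⟨1, 1, Or.inl rfl, Or.inl rfl, by simp⟩
    have k6 := h (lin (-(u + w)) (u + w + 2 * u * w) (-(w - u)))
      ⟨-1, 1, Or.inr rfl, Or.inl rfl, by simp⟩
    have k11 := h (lin (-(u + w + 2 * u * w)) (-(w - u)) (u + w))
      ⟨-1, -1, Or.inr rfl, Or.inr rfl, by simp⟩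
    have k3 := h (lin (-(w - u)) (-(u + w)) (u + w + 2 * u * w))
      ⟨-1, -1, Or.inr rfl, Or.inr rfl, by simp⟩
    simp only [lin_apply] at k8 k4 k6 k11 k3
    apply mem_coneF_five
    · simp [pent, dt]; nlinarith
    · simp [pent, dt]; nlinarith
    · simp [pent, dt]; nlinarith
    · refine nonneg_of_mul_nonneg_right (a := u) ?_ hu
      simp [pent, dt]; linarith
    · refine nonneg_of_mul_nonneg_right (a := u) ?_ hu
      simp [pent, dt]; linarith
    · refine nonneg_of_mul_nonneg_right (a := w) ?_ hw
      simp [pent, dt]; linarith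
    · refine nonneg_of_mul_nonneg_right (a := w) ?_ hw
      simp [pent, dt]; linarith
    · have : dt (pent u w 4) (pent u w 0) Y = (2 + u + w) *
          ((2 * w - 2 * u) * Y.1.1 + (2 * u + 2 * w) * Y.1.2) := by simp [pent, dt]; ring
      rw [this]
      refine mul_nonneg (by positivity) (by linarith)

end Pentagons

section Tetartoid

lemma cellDecomp_pent {u w : ℝ} (hu : 0 < u) (hw : 0 < w) : CellDecomp (coneF (pent u w)) := by
  have m1 := mul_pos hu hw
  have m2 := mul_pos hu hu
  have m3 := mul_pos hw hw
  have m4 := mul_pos m1 hu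
  have m5 := mul_pos m1 hw
  obtain ⟨a, ha⟩ : ∃ a, a = w - u := ⟨_, rfl⟩
  obtain ⟨b, hb⟩ : ∃ b, b = u + w := ⟨_, rfl⟩
  obtain ⟨c, hc⟩ : ∃ c, c = u + w + 2 * u * w := ⟨_, rfl⟩
  have hL : ∀ f ∈ tetraOrbit a b c, ∃ ρ : Col ≃ₗ[ℝ] Col, ∀ x, x ∈ coneF (pent u w) ↔
      ∀ h ∈ tetraOrbit a b c, h (ρ x) ≤ f (ρ x) := by
    intro f hf
    obtain ⟨A, h1, h2, h3⟩ := tetraOrbit_transitive hf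
    refine ⟨A, fun x => ?_⟩
    rw [mem_pent hu hw, ← ha, ← hc, ← hb]
    constructor
    · intro h k hk
      rw [h1]
      exact h _ (h2 k hk)
    · intro h k hk
      have := h _ (h3 k hk)
      rw [h1] at this
      simpa using this
  have hdet : 0 < a ^ 3 + b ^ 3 + c ^ 3 - 3 * a * b * c := by
    have : a ^ 3 + b ^ 3 + c ^ 3 - 3 * a * b * c =
      (a + b + c) * ((a - b) ^ 2 + (b - c) ^ 2 + (c - a) ^ 2) / 2 := by ring
    rw [this]
    have h1 : 0 < a + b + c := by rw [ha, hb, hc]; nlinarith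
    have h2 : 0 < b - a := by rw [ha, hb]; linarith
    have h3 : 0 < (a - b) ^ 2 := by nlinarith
    positivity
  let τ₀ : Col →ₗ[ℝ] Col := ((-lin c a b).prod (-lin a b c)).prod (-lin b c a)
  have hτ₀ : Function.Injective τ₀ := by
    rw [← LinearMap.ker_eq_bot, LinearMap.ker_eq_bot']
    rintro ⟨⟨x, y⟩, z⟩ h
    have h1 : -lin c a b ((x, y), z) = 0 := congrArg (fun p : Col => p.1.1) h
    have h2 : -lin a b c ((x, y), z) = 0 := congrArg (fun p : Col => p.1.2) h
    have h3 : -lin b c a ((x, y), z) = 0 := congrArg (fun p : Col => p.2) h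
    rw [neg_eq_zero, lin_apply] at h1 h2 h3
    have e1 : (a ^ 3 + b ^ 3 + c ^ 3 - 3 * a * b * c) * x = 0 := by
      linear_combination (c ^ 2 - a * b) * h1 + (a ^ 2 - b * c) * h2 + (b ^ 2 - a * c) * h3
    have e2 : (a ^ 3 + b ^ 3 + c ^ 3 - 3 * a * b * c) * y = 0 := by
      linear_combination (a ^ 2 - b * c) * h1 + (b ^ 2 - a * c) * h2 + (c ^ 2 - a * b) * h3
    have e3 : (a ^ 3 + b ^ 3 + c ^ 3 - 3 * a * b * c) * z = 0 := by
      linear_combination (b ^ 2 - a * c) * h1 + (c ^ 2 - a * b) * h2 + (a ^ 2 - b * c) * h3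
    rw [mul_eq_zero] at e1 e2 e3
    simp [e1.resolve_left hdet.ne', e2.resolve_left hdet.ne', e3.resolve_left hdet.ne']
  have pA : 0 < a + b + c := by rw [ha, hb, hc]; nlinarith
  obtain ⟨N, hN⟩ : ∃ N, N = a * (u - w) + b * (u + w + 2) + c * (u + w) := ⟨_, rfl⟩
  have pN : 0 < N := by rw [hN, ha, hb, hc]; nlinarith
  have pN' := pN.ne'
  have pA' := pA.ne'
  refine cellDecomp_of_facets (tetraOrbit_finite a b c) (u := (a + b + c)⁻¹ • ((1, 1), 1))
    (D := N⁻¹ • ((u - w, u + w + 2), u + w)) (f₁ := lin c a b) (f₂ := lin a b c) (f₃ := lin b c a)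
    (f₀ := lin (-b) c (-a)) (LinearEquiv.ofInjectiveEndo τ₀ hτ₀) (fun X => rfl)
    ⟨-1, 1, Or.inr rfl, Or.inl rfl, by simp⟩ ⟨1, 1, Or.inl rfl, Or.inl rfl, by simp⟩
    ⟨1, 1, Or.inl rfl, Or.inl rfl, by simp⟩ ⟨1, 1, Or.inl rfl, Or.inl rfl, by simp⟩
    ?_ ?_ ?_ ?_ ?_ hL ?_ ?_ ?_ ?_
  · rw [map_smul, smul_eq_mul, inv_mul_lt_one₀ pA]; simp [ha, hb, hc]; linarith
  · rw [map_smul, smul_eq_mul, inv_mul_eq_one₀ pA']; simp; ring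
  · rw [map_smul, smul_eq_mul, inv_mul_eq_one₀ pA']; simp
  · rw [map_smul, smul_eq_mul, inv_mul_eq_one₀ pA']; simp; ring
  · rintro f ⟨s, t, hs, ht, h⟩
    rw [map_smul, smul_eq_mul, inv_mul_lt_one₀ pA]
    rcases hs with rfl | rfl <;> rcases ht with rfl | rfl
    · rcases h with rfl | rfl | rfl <;> simp
    all_goals
      refine Or.inr (Or.inr (Or.inr ?_))
      rcases h with rfl | rfl | rfl <;> simp [ha, hb, hc] <;> linarith
  · rw [map_smul, smul_eq_mul, inv_mul_eq_one₀ pN', hN]; simp [ha, hb, hc]; ring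
  · rw [map_smul, smul_eq_mul, inv_mul_eq_one₀ pN', hN]; simp [ha, hb, hc]
  · rw [map_smul, smul_eq_mul, inv_mul_eq_one₀ pN', hN]; simp [ha, hb, hc]; ring
  · have key : ∀ s t : ℝ, ∀ x y z,
        (s * x * (u - w) + t * y * (u + w + 2) + s * t * z * (u + w) < N) →
        lin (s * x) (t * y) (s * t * z) (N⁻¹ • ((u - w, u + w + 2), u + w)) < 1 := by
      intro s t x y z h
      rw [map_smul, smul_eq_mul, inv_mul_lt_one₀ pN]
      simpa using h
    rintro f ⟨s, t, hs, ht, h⟩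
    rcases h with rfl | rfl | rfl
    · rcases hs with rfl | rfl <;> rcases ht with rfl | rfl
      · simp
      all_goals
        refine Or.inr (Or.inr (Or.inr (key _ _ _ _ _ ?_)))
        rw [hN, ha, hb, hc]
        nlinarith
    · rcases hs with rfl | rfl <;> rcases ht with rfl | rfl
      · simp
      rotate_left
      · simp
      all_goals
        refine Or.inr (Or.inr (Or.inr (key _ _ _ _ _ ?_)))
        rw [hN, ha, hb, hc]
        nlinarith
    · refine Or.inr (Or.inr (Or.inr (key _ _ _ _ _ ?_)))
      rw [hN, ha, hb, hc]
      rcases hs with rfl | rfl <;> rcases ht with rfl | rfl <;> nlinarith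

end Tetartoid

section PentagonModuli

lemma exists_tetartoid_params {P Q : ℝ} (hP : 0 < P) (hPQ : P ≤ Q) (h1 : P * Q < 1)
    (h2 : 1 ≤ P * (1 + Q)) : ∃ u w : ℝ, 0 < u ∧ 0 < w ∧
      w * (1 + u + u ^ 2) = P * (u * (1 + u + 2 * w + u * w)) ∧
      u * (1 + w + w ^ 2) = Q * (w * (1 + w + 2 * u + u * w)) := by
  have hP1 : P < 1 := by nlinarith
  let d : ℝ → ℝ := fun u => u ^ 2 + u + 1 - P * (u ^ 2 + 2 * u)
  let G : ℝ → ℝ := fun u => d u ^ 2 + u * (P * (1 + u)) * d u + u ^ 2 * (P * (1 + u)) ^ 2 -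
    Q * (P * (1 + u)) * (d u + u * (P * (1 + u)) + 2 * u * d u + u ^ 2 * (P * (1 + u)))
  have hG : Continuous G := by fun_prop
  have hG0 : 0 ≤ G 0 := by simp [G, d]; nlinarith
  have hG1 : G 1 ≤ 0 := by
    have e : G 1 = 9 - 12 * P + 7 * P ^ 2 - 2 * (P * Q) * (9 - 5 * P) := by simp only [G, d]; ring
    rw [e]
    rcases le_total P (31 / 50) with h | h
    · have : 1 - P ≤ P * Q := by linarith
      nlinarith [mul_le_mul_of_nonneg_right this (by linarith : 0 ≤ 2 * (9 - 5 * P))]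
    · have : P * P ≤ P * Q := by nlinarith
      nlinarith [mul_le_mul_of_nonneg_right this (by linarith : 0 ≤ 2 * (9 - 5 * P)),
        mul_nonneg (sub_nonneg.2 h) (sub_nonneg.2 hP1.le),
        mul_nonneg (mul_nonneg (sub_nonneg.2 h) (sub_nonneg.2 hP1.le)) hP.le]
  obtain ⟨u, ⟨hu0, hu1⟩, hu⟩ := intermediate_value_Icc' (zero_le_one) hG.continuousOn ⟨hG1, hG0⟩
  have hupos : 0 < u := by
    rcases hu0.eq_or_lt with rfl | h
    · simp [G, d] at hu
      nlinarith
    · exact h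
  have hd : 0 < d u := by
    simp only [d]
    nlinarith [mul_pos (sub_pos.2 hP1) hupos, mul_pos (mul_pos (sub_pos.2 hP1) hupos) hupos]
  have e : d u = u ^ 2 + u + 1 - P * (u ^ 2 + 2 * u) := rfl
  simp only [G] at hu
  generalize d u = D at *
  refine ⟨u, u * (P * (1 + u)) / D, hupos, by positivity, ?_, ?_⟩
  · field_simp
    rw [e]; ring
  · field_simp
    linear_combination hu

/-- All ordered triples are positively oriented. -/
def Pos (v : Fin 5 → Col) : Prop := ∀ i j k, i < j → j < k → 0 < dt (v i) (v j) (v k)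

lemma dt_cyc (a b c : Col) : dt a b c = dt b c a := by simp only [dt]; ring

lemma Pos.rot {v : Fin 5 → Col} (h : Pos v) (r : Fin 5) : Pos fun i => v (i + r) := by
  intro i j k hij hjk
  have : ∀ r i j k : Fin 5, i < j → j < k → (i + r < j + r ∧ j + r < k + r) ∨
      (j + r < k + r ∧ k + r < i + r) ∨ (k + r < i + r ∧ i + r < j + r) := by decide
  rcases this r i j k hij hjk with ⟨h1, h2⟩ | ⟨h1, h2⟩ | ⟨h1, h2⟩
  · exact h _ _ _ h1 h2
  · rw [dt_cyc]; exact h _ _ _ h1 h2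
  · rw [dt_cyc, dt_cyc]; exact h _ _ _ h1 h2

lemma coneF_perm {E : Type*} [AddCommGroup E] [Module ℝ E] {n : ℕ} (v : Fin n → E)
    (σ : Equiv.Perm (Fin n)) : coneF (fun i => v (σ i)) = coneF v := by
  ext x
  constructor
  · rintro ⟨c, hc, rfl⟩
    exact ⟨fun i => c (σ.symm i), fun i => hc _, by
      rw [← Equiv.sum_comp σ]; simp⟩
  · rintro ⟨c, hc, rfl⟩
    exact ⟨fun i => c (σ i), fun i => hc _, Equiv.sum_comp σ fun i => c i • v i⟩

/-- Reflection in the base plane. -/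
def refl3 : Col ≃ₗ[ℝ] Col where
  toFun Y := (Y.1, -Y.2)
  invFun Y := (Y.1, -Y.2)
  map_add' X Y := by ext <;> simp; ring
  map_smul' r X := by ext <;> simp
  left_inv X := by simp
  right_inv X := by simp

lemma dt_refl3 (a b c : Col) : dt (refl3 a) (refl3 b) (refl3 c) = dt c b a := by
  simp only [dt, refl3, LinearEquiv.coe_mk, LinearMap.coe_mk, AddHom.coe_mk]; ring

/-- Determinants of triples of a pentagon. -/
abbrev dd (v : Fin 5 → Col) (i j k : Fin 5) : ℝ := dt (v i) (v j) (v k)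

lemma pent_cramer (v : Fin 5 → Col) (h : dd v 0 2 4 ≠ 0) (i : Fin 5) :
    v i = (dd v i 2 4 / dd v 0 2 4) • v 0 + (dd v 0 i 4 / dd v 0 2 4) • v 2 +
      (dd v 0 2 i / dd v 0 2 4) • v 4 := by
  have h1 := dt_relation (v 0) (v 2) (v 4) (v i)
  have h2 : dd v 0 2 4 • v i = dd v i 2 4 • v 0 + dd v 0 i 4 • v 2 + dd v 0 2 i • v 4 := by
    have e1 : dd v i 2 4 = dt (v 2) (v 4) (v i) := dt_cyc _ _ _
    have e2 : dd v 0 i 4 = - dt (v 0) (v 4) (v i) := by simp only [dd, dt]; ring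
    rw [e1, e2, eq_comm, ← sub_eq_zero, ← h1]
    module
  rw [← eq_inv_smul_iff₀ h] at h2
  refine h2.trans ?_
  simp only [smul_add, smul_smul, div_eq_inv_mul]

lemma exists_equiv_pent {v w : Fin 5 → Col} (hv : Pos v) (hw : Pos w)
    (hP : dd v 0 1 4 * dd v 2 3 4 * (dd w 1 2 4 * dd w 0 3 4) =
      dd w 0 1 4 * dd w 2 3 4 * (dd v 1 2 4 * dd v 0 3 4))
    (hQ : dd v 0 3 4 * dd v 0 1 2 * (dd w 0 1 4 * dd w 0 2 3) =
      dd w 0 3 4 * dd w 0 1 2 * (dd v 0 1 4 * dd v 0 2 3)) :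
    ∃ (ρ : Col ≃ₗ[ℝ] Col) (μ : Fin 5 → ℝ), (∀ i, 0 < μ i) ∧ ∀ i, ρ (v i) = μ i • w i := by
  have pv : ∀ i j k : Fin 5, i < j → j < k → 0 < dd v i j k := hv
  have pw : ∀ i j k : Fin 5, i < j → j < k → 0 < dd w i j k := hw
  have v024 := pv 0 2 4 (by decide) (by decide)
  have v014 := pv 0 1 4 (by decide) (by decide)
  have v234 := pv 2 3 4 (by decide) (by decide)
  have v124 := pv 1 2 4 (by decide) (by decide)
  have v034 := pv 0 3 4 (by decide) (by decide)
  have v012 := pv 0 1 2 (by decide) (by decide)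
  have v023 := pv 0 2 3 (by decide) (by decide)
  have w024 := pw 0 2 4 (by decide) (by decide)
  have w014 := pw 0 1 4 (by decide) (by decide)
  have w234 := pw 2 3 4 (by decide) (by decide)
  have w124 := pw 1 2 4 (by decide) (by decide)
  have w034 := pw 0 3 4 (by decide) (by decide)
  have w012 := pw 0 1 2 (by decide) (by decide)
  have w023 := pw 0 2 3 (by decide) (by decide)
  have s1 : ∀ z : Fin 5 → Col, dd z 0 2 1 = - dd z 0 1 2 := fun z => by simp only [dd, dt]; ring
  have s2 : ∀ z : Fin 5 → Col, dd z 3 2 4 = - dd z 2 3 4 := fun z => by simp only [dd, dt]; ring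
  have cv1 := pent_cramer v v024.ne' 1
  have cv3 := pent_cramer v v024.ne' 3
  have cw1 := pent_cramer w w024.ne' 1
  have cw3 := pent_cramer w w024.ne' 3
  rw [s1] at cv1 cw1
  rw [s2] at cv3 cw3
  generalize dd v 0 2 4 = v1 at *
  generalize dd v 0 1 4 = v2 at *
  generalize dd v 2 3 4 = v3 at *
  generalize dd v 1 2 4 = v4 at *
  generalize dd v 0 3 4 = v5 at *
  generalize dd v 0 1 2 = v6 at *
  generalize dd v 0 2 3 = v7 at *
  generalize dd w 0 1 4 = w2 at *
  generalize dd w 2 3 4 = w3 at *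
  generalize dd w 1 2 4 = w4 at *
  generalize dd w 0 3 4 = w5 at *
  generalize dd w 0 1 2 = w6 at *
  generalize dd w 0 2 3 = w7 at *
  have hli : LinearIndependent ℝ ![v 0, v 2, v 4] :=
    linearIndependent_of_dt (pv 0 2 4 (by decide) (by decide)).ne'
  have hdw : dt (w 0) (w 2) (w 4) ≠ 0 := (pw 0 2 4 (by decide) (by decide)).ne'
  obtain ⟨m0, hm0⟩ : ∃ m, m = v2 * w4 / (v4 * w2) := ⟨_, rfl⟩
  obtain ⟨m4, hm4⟩ : ∃ m, m = v2 * w6 / (v6 * w2) := ⟨_, rfl⟩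
  obtain ⟨m1, hm1⟩ : ∃ m, m = v2 * dd w 0 2 4 / (v1 * w2) := ⟨_, rfl⟩
  obtain ⟨m3, hm3⟩ : ∃ m, m = v5 * dd w 0 2 4 / (v1 * w5) := ⟨_, rfl⟩
  generalize dd w 0 2 4 = w1 at *
  have p0 : 0 < m0 := by rw [hm0]; positivity
  have p1 : 0 < m1 := by rw [hm1]; positivity
  have p3 : 0 < m3 := by rw [hm3]; positivity
  have p4 : 0 < m4 := by rw [hm4]; positivity
  obtain ⟨ρ, h0, h2, h4⟩ := exists_equiv_col finrank_col hli (p := m0 • w 0) (q := w 2)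
    (r := m4 • w 4) (by
      have : dt (m0 • w 0) (w 2) (m4 • w 4) = m0 * m4 * dt (w 0) (w 2) (w 4) := by
        simp only [dt, Prod.smul_fst, Prod.smul_snd, smul_eq_mul]; ring
      rw [this]
      positivity)
  refine ⟨ρ, ![m0, m1, 1, m3, m4], ?_, ?_⟩
  · intro i; fin_cases i <;> simp [p0, p1, p3, p4]
  · intro i
    fin_cases i
    · simp [h0]
    · simp only [Matrix.cons_val, Fin.mk_one]
      rw [cv1, cw1]
      simp only [map_add, map_smul, h0, h2, h4, smul_add, smul_smul]
      have e0 : v4 / v1 * m0 = m1 * (w4 / w1) := by rw [hm0, hm1]; field_simp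
      have e2 : v2 / v1 = m1 * (w2 / w1) := by rw [hm1]; field_simp
      have e4 : -v6 / v1 * m4 = m1 * (-w6 / w1) := by rw [hm4, hm1]; field_simp
      rw [e0, e2, e4]
    · simp [h2]
    · simp only [Fin.reduceFinMk, Matrix.cons_val]
      rw [cv3, cw3]
      simp only [map_add, map_smul, h0, h2, h4, smul_add, smul_smul]
      have e0 : -v3 / v1 * m0 = m3 * (-w3 / w1) := by
        rw [hm0, hm3]; field_simp; linarith
      have e2 : v5 / v1 = m3 * (w5 / w1) := by rw [hm3]; field_simp
      have e4 : v7 / v1 * m4 = m3 * (w7 / w1) := by rw [hm4, hm3]; field_simp; linarith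
      rw [e0, e2, e4]
    · simp [h4]

lemma pos_pent {u w : ℝ} (hu : 0 < u) (hw : 0 < w) : Pos (pent u w) := by
  have m1 := mul_pos hu hw
  have m2 := mul_pos hu hu
  have m3 := mul_pos hw hw
  have m4 := mul_pos m1 hu
  have m5 := mul_pos m1 hw
  intro i j k hij hjk
  fin_cases i <;> fin_cases j <;> first
    | exact absurd hij (by decide)
    | (fin_cases k <;> first
        | exact absurd hjk (by decide)
        | (simp [pent, dt]; nlinarith))

end PentagonModuli

section SmallCones

lemma cellDecomp_of_moduli {v : Fin 5 → Col} (hv : Pos v) {P Q : ℝ}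
    (hP : dd v 0 1 4 * dd v 2 3 4 = P * (dd v 1 2 4 * dd v 0 3 4))
    (hQ : dd v 0 3 4 * dd v 0 1 2 = Q * (dd v 0 1 4 * dd v 0 2 3))
    (hPQ : P ≤ Q) (h1 : P * Q < 1) (h2 : 1 ≤ P * (1 + Q)) : CellDecomp (coneF v) := by
  have pv : ∀ i j k : Fin 5, i < j → j < k → 0 < dd v i j k := hv
  have hP0 : 0 < P := by
    have k1 := mul_pos (pv 0 1 4 (by decide) (by decide)) (pv 2 3 4 (by decide) (by decide))
    have k2 := mul_pos (pv 1 2 4 (by decide) (by decide)) (pv 0 3 4 (by decide) (by decide))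
    rw [hP] at k1
    exact (pos_iff_pos_of_mul_pos k1).2 k2
  obtain ⟨u, w, hu, hw, e1, e2⟩ := exists_tetartoid_params hP0 hPQ h1 h2
  obtain ⟨ρ, μ, hμ, h⟩ := exists_equiv_pent hv (pos_pent hu hw) (by
      rw [hP]
      have : dd (pent u w) 0 1 4 * dd (pent u w) 2 3 4 =
          P * (dd (pent u w) 1 2 4 * dd (pent u w) 0 3 4) := by
        simp [dd, pent, dt]
        linear_combination (16 * (2 + u + w)) * e1
      rw [this]; ring) (by
      rw [hQ]
      have : dd (pent u w) 0 3 4 * dd (pent u w) 0 1 2 =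
          Q * (dd (pent u w) 0 1 4 * dd (pent u w) 0 2 3) := by
        simp [dd, pent, dt]
        linear_combination (16 * (2 + u + w)) * e2
      rw [this]; ring)
  exact (cellDecomp_pent hu hw).congr ρ (mem_coneF_congr ρ hμ h)

lemma cellDecomp_five {v : Fin 5 → Col} (hv : Pos v) : CellDecomp (coneF v) := by
  let X : Fin 5 → ℝ := fun k => dd v (0 + k) (1 + k) (2 + k) * dd v (2 + k) (3 + k) (4 + k) /
    (dd v (1 + k) (2 + k) (4 + k) * dd v (0 + k) (2 + k) (3 + k))
  obtain ⟨k, -, hk⟩ := Finset.exists_max_image Finset.univ X Finset.univ_nonempty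
  suffices key : ∀ v : Fin 5 → Col, Pos v →
      dd v 3 4 0 * dd v 0 1 2 / (dd v 4 0 2 * dd v 3 0 1) ≤
        dd v 0 1 2 * dd v 2 3 4 / (dd v 1 2 4 * dd v 0 2 3) →
      dd v 2 3 4 * dd v 4 0 1 / (dd v 3 4 1 * dd v 2 4 0) ≤
        dd v 0 1 2 * dd v 2 3 4 / (dd v 1 2 4 * dd v 0 2 3) → CellDecomp (coneF v) by
    have h := key _ (hv.rot k) (by
      have := hk (3 + k) (Finset.mem_univ _)
      simp only [X, ← add_assoc] at this
      exact this) (by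
      have := hk (2 + k) (Finset.mem_univ _)
      simp only [X, ← add_assoc] at this
      exact this)
    have e : coneF (fun i => v (i + k)) = coneF v := coneF_perm v (Equiv.addRight k)
    rwa [e] at h
  clear X hk k hv v
  intro v hv h1 h2
  have pv : ∀ i j k : Fin 5, i < j → j < k → 0 < dd v i j k := hv
  have v024 := pv 0 2 4 (by decide) (by decide)
  have v014 := pv 0 1 4 (by decide) (by decide)
  have v234 := pv 2 3 4 (by decide) (by decide)
  have v124 := pv 1 2 4 (by decide) (by decide)
  have v034 := pv 0 3 4 (by decide) (by decide)
  have v012 := pv 0 1 2 (by decide) (by decide)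
  have v023 := pv 0 2 3 (by decide) (by decide)
  have v123 := pv 1 2 3 (by decide) (by decide)
  have v134 := pv 1 3 4 (by decide) (by decide)
  have v013 := pv 0 1 3 (by decide) (by decide)
  have q1 : dd v 4 0 2 * dd v 3 0 1 = dd v 0 3 4 * dd v 0 1 2 + dd v 0 1 4 * dd v 0 2 3 := by
    simp only [dd, dt]; ring
  have q2 : dd v 3 4 1 * dd v 2 4 0 = dd v 2 3 4 * dd v 0 1 4 + dd v 1 2 4 * dd v 0 3 4 := by
    simp only [dd, dt]; ring
  have q3 : dd v 1 2 4 * dd v 0 2 3 - dd v 2 3 4 * dd v 0 1 2 = dd v 1 2 3 * dd v 0 2 4 := by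
    simp only [dd, dt]; ring
  have c1 : dd v 3 4 0 = dd v 0 3 4 := (dt_cyc _ _ _).symm
  have c2 : dd v 4 0 1 = dd v 0 1 4 := dt_cyc _ _ _
  rw [q1, c1, div_le_div_iff₀ (by positivity) (by positivity)] at h1
  rw [q2, c2, div_le_div_iff₀ (by positivity) (by positivity)] at h2
  obtain ⟨P, hP⟩ : ∃ P, P = dd v 0 1 4 * dd v 2 3 4 / (dd v 1 2 4 * dd v 0 3 4) := ⟨_, rfl⟩
  obtain ⟨Q, hQ⟩ : ∃ Q, Q = dd v 0 3 4 * dd v 0 1 2 / (dd v 0 1 4 * dd v 0 2 3) := ⟨_, rfl⟩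
  have hPQ : P * Q < 1 := by
    have : P * Q = dd v 2 3 4 * dd v 0 1 2 / (dd v 1 2 4 * dd v 0 2 3) := by
      rw [hP, hQ]; field_simp
    rw [this, div_lt_one (by positivity)]
    have := mul_pos v123 v024
    linarith
  have hP2 : 1 ≤ P * (1 + Q) := by
    have : P * (1 + Q) = dd v 2 3 4 * (dd v 0 3 4 * dd v 0 1 2 + dd v 0 1 4 * dd v 0 2 3) /
        (dd v 1 2 4 * dd v 0 3 4 * dd v 0 2 3) := by
      rw [hP, hQ]; field_simp; ring
    rw [this, one_le_div (by positivity)]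
    have := le_of_mul_le_mul_left (a := dd v 0 1 2) (by linarith :
      dd v 0 1 2 * (dd v 1 2 4 * dd v 0 3 4 * dd v 0 2 3) ≤ dd v 0 1 2 * (dd v 2 3 4 *
        (dd v 0 3 4 * dd v 0 1 2 + dd v 0 1 4 * dd v 0 2 3))) v012
    exact this
  have hQ2 : 1 ≤ Q * (1 + P) := by
    have : Q * (1 + P) = dd v 0 1 2 * (dd v 2 3 4 * dd v 0 1 4 + dd v 1 2 4 * dd v 0 3 4) /
        (dd v 0 1 4 * dd v 0 2 3 * dd v 1 2 4) := by
      rw [hP, hQ]; field_simp; ring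
    rw [this, one_le_div (by positivity)]
    have := le_of_mul_le_mul_left (a := dd v 2 3 4) (by linarith :
      dd v 2 3 4 * (dd v 0 1 4 * dd v 0 2 3 * dd v 1 2 4) ≤ dd v 2 3 4 * (dd v 0 1 2 *
        (dd v 2 3 4 * dd v 0 1 4 + dd v 1 2 4 * dd v 0 3 4))) v234
    exact this
  rw [eq_div_iff (by positivity)] at hP hQ
  rcases le_total P Q with hle | hle
  · exact cellDecomp_of_moduli hv hP.symm hQ.symm hle hPQ hP2
  · have hrev : Pos fun i => refl3 (v (Fin.revPerm i)) := by
      intro i j k hij hjk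
      rw [dt_refl3]
      exact hv _ _ _ (Fin.rev_lt_rev.2 hjk) (Fin.rev_lt_rev.2 hij)
    have hr : ∀ i j k, dd (fun i => refl3 (v (Fin.revPerm i))) i j k =
        dd v (Fin.rev k) (Fin.rev j) (Fin.rev i) := fun i j k => dt_refl3 _ _ _
    have r0 : Fin.rev (0 : Fin 5) = 4 := rfl
    have r1 : Fin.rev (1 : Fin 5) = 3 := rfl
    have r2 : Fin.rev (2 : Fin 5) = 2 := rfl
    have r3 : Fin.rev (3 : Fin 5) = 1 := rfl
    have r4 : Fin.rev (4 : Fin 5) = 0 := rfl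
    have h := cellDecomp_of_moduli hrev (P := Q) (Q := P)
      (by simp only [hr, r0, r1, r2, r3, r4]; linarith)
      (by simp only [hr, r0, r1, r2, r3, r4]; linarith)
      hle (by linarith) hQ2
    rw [← coneF_perm v Fin.revPerm]
    exact h.congr refl3 (mem_coneF_congr refl3 (μ := 1) (by simp) (by simp))

variable {E : Type*} [AddCommGroup E] [Module ℝ E] [FiniteDimensional ℝ E]

/-- Pointed three-dimensional cones with at most five extreme rays have a cell decomposition. -/
theorem cellDecomp_ccone [DecidableEq E] (hE : Module.finrank ℝ E = 3) {G : Finset E}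
    (hG : Irred G) {t : E →ₗ[ℝ] ℝ} (ht : ∀ g ∈ G, 0 < t g) (h3 : 3 ≤ G.card) (h5 : G.card ≤ 5) :
    CellDecomp (ccone G) := by
  have e : E ≃ₗ[ℝ] Col := LinearEquiv.ofFinrankEq E Col (by rw [hE, finrank_col])
  obtain ⟨m, hm⟩ : ∃ m, G.card = m + 1 := ⟨G.card - 1, by omega⟩
  obtain ⟨v, hinj, himg, hv⟩ := exists_labeling e hG ht (by omega) hm
  rw [← coneF_eq_ccone hinj himg]
  have hli : ∀ i j k, i < j → j < k → LinearIndependent ℝ ![v i, v j, v k] := by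
    intro i j k hij hjk
    exact hG.linearIndependent_three ht (by simp [← himg]) (by simp [← himg]) (by simp [← himg])
      (fun h => hij.ne (hinj h)) (fun h => (hij.trans hjk).ne (hinj h)) fun h => hjk.ne (hinj h)
  obtain rfl | rfl | rfl : m = 2 ∨ m = 3 ∨ m = 4 := by omega
  · exact cellDecomp_three hE (hli 0 1 2 (by decide) (by decide))
  · have p012 := hv 0 1 2 (by decide) (by decide)
    have p013 := hv 0 1 3 (by decide) (by decide)
    have p023 := hv 0 2 3 (by decide) (by decide)
    have p123 := hv 1 2 3 (by decide) (by decide)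
    refine cellDecomp_four hE (hli 0 1 2 (by decide) (by decide)) (div_pos p123 p012)
      (div_pos p023 p012) (div_pos p013 p012) ?_
    have h := dt_relation (e (v 0)) (e (v 1)) (e (v 2)) (e (v 3))
    have h' : dt (e (v 0)) (e (v 1)) (e (v 2)) • v 3 = dt (e (v 1)) (e (v 2)) (e (v 3)) • v 0 -
        dt (e (v 0)) (e (v 2)) (e (v 3)) • v 1 + dt (e (v 0)) (e (v 1)) (e (v 3)) • v 2 := by
      apply e.injective
      rw [eq_comm, ← sub_eq_zero, ← map_sub, ← h]
      simp
    rw [← eq_inv_smul_iff₀ p012.ne'] at h'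
    refine h'.trans ?_
    simp only [smul_add, smul_sub, smul_smul, div_eq_inv_mul]
  · refine CellDecomp.congr e (mem_coneF_congr e (w := fun i => e (v i)) (μ := 1) (by simp)
      (by simp)) (cellDecomp_five ?_)
    exact hv

end SmallCones

section ProjectiveEquivalence

variable {E F : Type*} [AddCommGroup E] [Module ℝ E] [AddCommGroup F] [Module ℝ F]

/-- The cone (without apex) over `S × {1}`. -/
def homog (S : Set E) : Set (E × ℝ) := {p | 0 < p.2 ∧ p.2⁻¹ • p.1 ∈ S}

/-- `S` and `T` are related by a projective map that is admissible on `S`. -/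
def ProjEq (S : Set E) (T : Set F) : Prop :=
  ∃ M : (E × ℝ) ≃ₗ[ℝ] (F × ℝ), ∀ p, p ∈ homog S ↔ M p ∈ homog T

/-- The image of `S` under the projective map induced by `M`. -/
def proj (M : (E × ℝ) ≃ₗ[ℝ] (F × ℝ)) (S : Set E) : Set F := {y | M.symm (y, 1) ∈ homog S}

lemma mem_homog_one {S : Set E} {x : E} : (x, (1 : ℝ)) ∈ homog S ↔ x ∈ S := by
  simp [homog]

lemma smul_mem_homog {S : Set E} {p : E × ℝ} {r : ℝ} (hr : 0 < r) (hp : p ∈ homog S) :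
    r • p ∈ homog S := by
  refine ⟨mul_pos hr hp.1, ?_⟩
  have : (r • p).2⁻¹ • (r • p).1 = p.2⁻¹ • p.1 := by
    simp only [Prod.smul_fst, Prod.smul_snd, smul_eq_mul, smul_smul]
    congr 1
    have := hr.ne'
    have := hp.1.ne'
    field_simp
  rw [this]; exact hp.2

lemma homog_eq {S : Set E} {p : E × ℝ} (hp : p ∈ homog S) :
    p = p.2 • (p.2⁻¹ • p.1, (1 : ℝ)) := by
  ext
  · simp [smul_smul, hp.1.ne']
  · simp

lemma homog_mono {S T : Set E} (h : S ⊆ T) : homog S ⊆ homog T := fun _ hp => ⟨hp.1, h hp.2⟩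

lemma convex_iff_homog {S : Set E} :
    Convex ℝ S ↔ ∀ p ∈ homog S, ∀ q ∈ homog S, p + q ∈ homog S := by
  constructor
  · intro hS p hp q hq
    have h0 : 0 < p.2 + q.2 := add_pos hp.1 hq.1
    refine ⟨h0, ?_⟩
    have := hS hp.2 hq.2 (div_pos hp.1 h0).le (div_pos hq.1 h0).le
      (by rw [← add_div, div_self h0.ne'])
    convert this using 1
    simp only [Prod.fst_add, Prod.snd_add, smul_add, smul_smul]
    have := hp.1.ne'
    have := hq.1.ne'
    congr 2 <;> field_simp
  · intro h x hx y hy a b ha hb hab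
    rcases ha.eq_or_lt with rfl | ha
    · simp at hab; subst hab; simpa using hy
    rcases hb.eq_or_lt with rfl | hb
    · simp at hab; subst hab; simpa using hx
    have := h _ (smul_mem_homog ha (mem_homog_one.2 hx)) _ (smul_mem_homog hb (mem_homog_one.2 hy))
    rw [← mem_homog_one]
    convert this using 1
    ext <;> simp [hab]

lemma isExtreme_iff_homog {P F : Set E} : IsExtreme ℝ P F ↔
    F ⊆ P ∧ ∀ p ∈ homog P, ∀ q ∈ homog P, p + q ∈ homog F → p ∈ homog F := by
  constructor
  · refine fun h => ⟨h.subset, fun p hp q hq hpq => ⟨hp.1, ?_⟩⟩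
    have h0 : 0 < p.2 + q.2 := hpq.1
    refine h.left_mem_of_mem_openSegment hp.2 hq.2 hpq.2
      ⟨p.2 / (p.2 + q.2), q.2 / (p.2 + q.2), div_pos hp.1 h0, div_pos hq.1 h0,
        by rw [← add_div, div_self h0.ne'], ?_⟩
    simp only [Prod.fst_add, Prod.snd_add, smul_add, smul_smul]
    have := hp.1.ne'
    have := hq.1.ne'
    congr 2 <;> field_simp
  · rintro ⟨h1, h2⟩
    refine ⟨h1, fun x hx y hy z hz => ?_⟩
    rintro ⟨a, b, ha, hb, hab, rfl⟩
    have := h2 _ (smul_mem_homog ha (mem_homog_one.2 hx)) _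
      (smul_mem_homog hb (mem_homog_one.2 hy)) (by
        have := mem_homog_one.2 hz
        convert this using 1
        ext <;> simp [hab])
    have := smul_mem_homog (inv_pos.2 ha) this
    rwa [smul_smul, inv_mul_cancel₀ ha.ne', one_smul, mem_homog_one] at this

lemma mem_proj_homog {M : (E × ℝ) ≃ₗ[ℝ] (F × ℝ)} {S : Set E} (h : ∀ p ∈ homog S, 0 < (M p).2)
    (p : E × ℝ) : p ∈ homog S ↔ M p ∈ homog (proj M S) := by
  constructor
  · intro hp
    refine ⟨h p hp, ?_⟩
    have := smul_mem_homog (inv_pos.2 (h p hp)) hp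
    change M.symm _ ∈ homog S
    convert this using 1
    rw [LinearEquiv.symm_apply_eq, map_smul]
    ext
    · simp
    · simp [(h p hp).ne']
  · intro hp
    have h1 : M.symm ((M p).2⁻¹ • (M p).1, (1 : ℝ)) ∈ homog S := hp.2
    have := smul_mem_homog hp.1 h1
    rwa [← map_smul, ← homog_eq hp, LinearEquiv.symm_apply_apply] at this

lemma projEq_proj {M : (E × ℝ) ≃ₗ[ℝ] (F × ℝ)} {S : Set E} (h : ∀ p ∈ homog S, 0 < (M p).2) :
    ProjEq S (proj M S) := ⟨M, mem_proj_homog h⟩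

lemma ProjEq.symm {S : Set E} {T : Set F} (h : ProjEq S T) : ProjEq T S := by
  obtain ⟨M, hM⟩ := h
  exact ⟨M.symm, fun p => by rw [hM]; simp⟩

lemma ProjEq.trans {G : Type*} [AddCommGroup G] [Module ℝ G] {S : Set E} {T : Set F} {U : Set G}
    (h : ProjEq S T) (h' : ProjEq T U) : ProjEq S U := by
  obtain ⟨M, hM⟩ := h
  obtain ⟨N, hN⟩ := h'
  exact ⟨M.trans N, fun p => by rw [hM, hN]; simp⟩

lemma projEq_image (L : E ≃ₗ[ℝ] F) (a : F) (S : Set E) : ProjEq S ((fun x => a + L x) '' S) := by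
  refine ⟨LinearEquiv.ofLinearMap
    (((L : E →ₗ[ℝ] F).comp (LinearMap.fst ℝ E ℝ) +
      (LinearMap.snd ℝ E ℝ).smulRight a).prod (LinearMap.snd ℝ E ℝ))
    (((L.symm : F →ₗ[ℝ] E).comp (LinearMap.fst ℝ F ℝ -
      (LinearMap.snd ℝ F ℝ).smulRight a)).prod (LinearMap.snd ℝ F ℝ)) ?_ ?_, fun p => ?_⟩
  · ext <;> simp
  · ext <;> simp
  · change (0 < p.2 ∧ p.2⁻¹ • p.1 ∈ S) ↔
      (0 < p.2 ∧ p.2⁻¹ • (L p.1 + p.2 • a) ∈ (fun x => a + L x) '' S)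
    refine and_congr_right fun hp => ?_
    simp only [smul_add, smul_smul, inv_mul_cancel₀ hp.ne', one_smul, Set.mem_image, ← map_smul]
    constructor
    · exact fun h => ⟨_, h, add_comm _ _⟩
    · rintro ⟨x, hx, h⟩
      rw [add_comm, add_right_cancel_iff] at h
      rwa [← L.injective h]

lemma ProjEq.image {G : Type*} [AddCommGroup G] [Module ℝ G] {S : Set E} {T : Set F}
    (h : ProjEq S T) (L : F ≃ₗ[ℝ] G) (a : G) : ProjEq S ((fun x => a + L x) '' T) :=
  h.trans (projEq_image L a T)

lemma ProjEq.convex {S : Set E} {T : Set F} (h : ProjEq S T) (hS : Convex ℝ S) : Convex ℝ T := by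
  obtain ⟨M, hM⟩ := h.symm
  rw [convex_iff_homog] at hS ⊢
  intro p hp q hq
  rw [hM] at hp hq ⊢
  rw [map_add]; exact hS _ hp _ hq

lemma ProjEq.exists_convexHull {V : Finset E} {T : Set F}
    (h : ProjEq (convexHull ℝ (V : Set E)) T) : ∃ W : Finset F, T = convexHull ℝ (W : Set F) := by
  classical
  have hc := h.convex (convex_convexHull ℝ _)
  obtain ⟨M, hM⟩ := h
  have hv : ∀ v ∈ V, M (v, 1) ∈ homog T := fun v hv => by
    rw [← hM, mem_homog_one]; exact subset_convexHull ℝ _ hv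
  refine ⟨V.image fun v => (M (v, 1)).2⁻¹ • (M (v, 1)).1, Set.Subset.antisymm ?_ ?_⟩
  · intro y hy
    have h1 : M.symm (y, 1) ∈ homog (convexHull ℝ (V : Set E)) := by
      rw [hM]; simpa [mem_homog_one] using hy
    set p := M.symm (y, 1) with hp
    obtain ⟨w, hw, hw1, hws⟩ := Finset.mem_convexHull'.1 h1.2
    have e1 : p = ∑ v ∈ V, (p.2 * w v) • (v, (1 : ℝ)) := by
      rw [homog_eq h1]
      simp only [mul_smul, ← Finset.smul_sum]
      congr 1
      · simp
      · ext
        · rw [Prod.fst_sum]; simp [hws]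
        · rw [Prod.snd_sum]; simp [hw1]
    have e2 : (y, (1 : ℝ)) = ∑ v ∈ V, (p.2 * w v * (M (v, 1)).2) •
        ((M (v, 1)).2⁻¹ • (M (v, 1)).1, (1 : ℝ)) := by
      have : (y, (1 : ℝ)) = M p := by simp [hp]
      rw [this]
      conv_lhs => rw [e1, map_sum]
      refine Finset.sum_congr rfl fun v hv' => ?_
      rw [map_smul]
      conv_lhs => rw [homog_eq (hv v hv')]
      rw [smul_smul]
    have e3 := congrArg Prod.fst e2
    have e4 := congrArg Prod.snd e2
    rw [Prod.fst_sum] at e3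
    rw [Prod.snd_sum] at e4
    simp only [Prod.smul_fst, Prod.smul_snd, smul_eq_mul, mul_one] at e3 e4
    rw [e3]
    refine (convex_convexHull ℝ _).sum_mem (fun v hv' => ?_) e4.symm fun v hv' => ?_
    · exact mul_nonneg (mul_nonneg h1.1.le (hw v hv')) (hv v hv').1.le
    · exact subset_convexHull ℝ _ (Finset.mem_coe.2 (Finset.mem_image_of_mem _ hv'))
  · refine convexHull_min ?_ hc
    intro y hy
    obtain ⟨v, hv', rfl⟩ := Finset.mem_image.1 (Finset.mem_coe.1 hy)
    exact (hv v hv').2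

lemma proj_mono {M : (E × ℝ) ≃ₗ[ℝ] (F × ℝ)} {S T : Set E} (h : S ⊆ T) : proj M S ⊆ proj M T :=
  fun _ hy => homog_mono h hy

lemma proj_symm_proj {M : (E × ℝ) ≃ₗ[ℝ] (F × ℝ)} {S : Set E} (h : ∀ p ∈ homog S, 0 < (M p).2) :
    proj M.symm (proj M S) = S := by
  ext x
  change M.symm.symm (x, 1) ∈ homog (proj M S) ↔ _
  rw [LinearEquiv.symm_symm, ← mem_proj_homog h, mem_homog_one]

lemma isExtreme_proj {M : (E × ℝ) ≃ₗ[ℝ] (F × ℝ)} {S T : Set E} (h : ∀ p ∈ homog S, 0 < (M p).2)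
    (hT : IsExtreme ℝ S T) : IsExtreme ℝ (proj M S) (proj M T) := by
  rw [isExtreme_iff_homog] at hT ⊢
  refine ⟨proj_mono hT.1, fun p hp q hq hpq => ?_⟩
  have hT' : ∀ p ∈ homog T, 0 < (M p).2 := fun p hp => h p (homog_mono hT.1 hp)
  obtain ⟨p, rfl⟩ := M.surjective p
  obtain ⟨q, rfl⟩ := M.surjective q
  rw [← map_add, ← mem_proj_homog hT'] at hpq
  rw [← mem_proj_homog h] at hp hq
  rw [← mem_proj_homog hT']
  exact hT.2 _ hp _ hq hpq

lemma ProjEq.nonempty_orderIso {S : Set E} {T : Set F} (h : ProjEq S T) :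
    Nonempty ({A : Set E // IsExtreme ℝ S A} ≃o {B : Set F // IsExtreme ℝ T B}) := by
  obtain ⟨M, hM⟩ := h
  have h1 : ∀ p ∈ homog S, 0 < (M p).2 := fun p hp => ((hM p).1 hp).1
  have h2 : ∀ p ∈ homog T, 0 < (M.symm p).2 := fun p hp => ((hM (M.symm p)).2 (by simpa)).1
  have e1 : proj M S = T := by
    ext y
    change M.symm (y, 1) ∈ homog S ↔ _
    rw [hM, LinearEquiv.apply_symm_apply, mem_homog_one]
  have e2 : proj M.symm T = S := by rw [← e1, proj_symm_proj h1]
  have s1 : ∀ A, IsExtreme ℝ S A → IsExtreme ℝ T (proj M A) := fun A hA => by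
    rw [← e1]; exact isExtreme_proj h1 hA
  have s2 : ∀ B, IsExtreme ℝ T B → IsExtreme ℝ S (proj M.symm B) := fun B hB => by
    rw [← e2]; exact isExtreme_proj h2 hB
  have t1 : ∀ A, IsExtreme ℝ S A → proj M.symm (proj M A) = A := fun A hA =>
    proj_symm_proj fun p hp => h1 p (homog_mono hA.subset hp)
  have t2 : ∀ B, IsExtreme ℝ T B → proj M (proj M.symm B) = B := fun B hB =>
    proj_symm_proj (M := M.symm) fun p hp => h2 p (homog_mono hB.subset hp)
  exact ⟨{ toFun A := ⟨proj M A, s1 A A.2⟩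
           invFun B := ⟨proj M.symm B, s2 B B.2⟩
           left_inv A := Subtype.ext (t1 A A.2)
           right_inv B := Subtype.ext (t2 B B.2)
           map_rel_iff' {A B} := ⟨fun h => by
              have := proj_mono (M := M.symm) (show proj M A.1 ⊆ proj M B.1 from h)
              rwa [t1 A A.2, t1 B B.2] at this, fun h => proj_mono h⟩ }⟩

end ProjectiveEquivalence

lemma ProjEq.nonempty_interior {E F : Type*} [NormedAddCommGroup E] [NormedSpace ℝ E]
    [NormedAddCommGroup F] [NormedSpace ℝ F] [FiniteDimensional ℝ F] {S : Set E} {T : Set F}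
    (h : ProjEq S T) (hS : (interior S).Nonempty) : (interior T).Nonempty := by
  obtain ⟨M, hM⟩ := h
  obtain ⟨x, hx⟩ := hS
  have hx1 : M (x, 1) ∈ homog T := by
    rw [← hM, mem_homog_one]; exact interior_subset hx
  have hc : Continuous M.symm := M.symm.toLinearMap.continuous_of_finiteDimensional
  have hc2 : Continuous fun y : F => M.symm (y, (1 : ℝ)) := hc.comp (by fun_prop)
  set y := (M (x, 1)).2⁻¹ • (M (x, 1)).1 with hy
  have ey : M.symm (y, (1 : ℝ)) = (M (x, 1)).2⁻¹ • (x, (1 : ℝ)) := by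
    rw [LinearEquiv.symm_apply_eq, map_smul]
    ext
    · simp [hy]
    · simp [hx1.1.ne']
  refine ⟨y, mem_interior_iff_mem_nhds.2 ?_⟩
  have hpos : 0 < (M.symm (y, (1 : ℝ))).2 := by
    rw [ey]; simpa using hx1.1
  have c1 : ContinuousAt (fun y : F => (M.symm (y, (1 : ℝ))).2) y := by fun_prop
  have c2 : ContinuousAt (fun y : F => (M.symm (y, (1 : ℝ))).2⁻¹ • (M.symm (y, (1 : ℝ))).1) y :=
    (c1.inv₀ hpos.ne').smul (by fun_prop)
  have e3 : (M.symm (y, (1 : ℝ))).2⁻¹ • (M.symm (y, (1 : ℝ))).1 = x := by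
    rw [ey]; simp [smul_smul, hx1.1.ne']
  have hxS : S ∈ nhds ((M.symm (y, (1 : ℝ))).2⁻¹ • (M.symm (y, (1 : ℝ))).1) := by
    rw [e3]; exact mem_interior_iff_mem_nhds.1 hx
  filter_upwards [c1.eventually (lt_mem_nhds hpos), c2 hxS] with z hz1 hz2
  rw [← mem_homog_one, ← M.apply_symm_apply (z, (1 : ℝ)), ← hM]
  exact ⟨hz1, hz2⟩

section Decompositions

/-- `X` decomposes into finitely many pieces, each satisfying `Q`, with disjoint interiors. -/
def Dec {E : Type*} [TopologicalSpace E] (Q : Set E → Prop) (X : Set E) : Prop :=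
  ∃ D : Set (Set E), D.Finite ∧ (∀ S ∈ D, Q S) ∧ ⋃₀ D = X ∧
    D.Pairwise fun S T => interior S ∩ interior T = ∅

variable {E : Type*} [TopologicalSpace E] {Q R : Set E → Prop} {X : Set E}

lemma Dec.self (h : Q X) : Dec Q X :=
  ⟨{X}, Set.finite_singleton X, by simpa using h, Set.sUnion_singleton X,
    Set.pairwise_singleton _ _⟩

lemma Dec.mono (h : Dec Q X) (hQ : ∀ S ⊆ X, Q S → R S) : Dec R X := by
  obtain ⟨D, h1, h2, h3, h4⟩ := h
  exact ⟨D, h1, fun S hS => hQ S (h3 ▸ Set.subset_sUnion_of_mem hS) (h2 S hS), h3, h4⟩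

lemma interior_inter_eq_empty_mono {A B A' B' : Set E} (h : interior A ∩ interior B = ∅)
    (hA : A' ⊆ A) (hB : B' ⊆ B) : interior A' ∩ interior B' = ∅ :=
  Set.eq_empty_of_subset_empty (h ▸ Set.inter_subset_inter (interior_mono hA) (interior_mono hB))

lemma Dec.bind (h : Dec Q X) (hQ : ∀ S ⊆ X, Q S → Dec R S) : Dec R X := by
  obtain ⟨D, h1, h2, h3, h4⟩ := h
  have hD : ∀ S ∈ D, S ⊆ X := fun S hS => h3 ▸ Set.subset_sUnion_of_mem hS
  have h5 : ∀ S : D, Dec R S.1 := fun S => hQ S (hD S S.2) (h2 S S.2)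
  choose f f1 f2 f3 f4 using h5
  have : Finite D := h1
  refine ⟨⋃ S, f S, Set.finite_iUnion f1, fun T hT => ?_, ?_, ?_⟩
  · obtain ⟨S, hS⟩ := Set.mem_iUnion.1 hT
    exact f2 S T hS
  · rw [Set.sUnion_iUnion]
    simp only [f3]
    rw [← Set.sUnion_eq_iUnion, h3]
  · intro S hS T hT hne
    obtain ⟨S', hS'⟩ := Set.mem_iUnion.1 hS
    obtain ⟨T', hT'⟩ := Set.mem_iUnion.1 hT
    by_cases he : S' = T'
    · subst he; exact f4 S' hS' hT' hne
    · exact interior_inter_eq_empty_mono (h4 S'.2 T'.2 fun h => he (Subtype.ext h))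
        (f3 S' ▸ Set.subset_sUnion_of_mem hS') (f3 T' ▸ Set.subset_sUnion_of_mem hT')

lemma Dec.union {A B : Set E} (hA : Dec Q A) (hB : Dec Q B) (hX : A ∪ B = X)
    (h : interior A ∩ interior B = ∅) : Dec Q X := by
  refine Dec.bind (Q := Dec Q) ⟨{A, B}, Set.toFinite _, ?_, by rw [Set.sUnion_pair, hX], ?_⟩
    fun S _ hS => hS
  · rintro S (rfl | rfl) <;> assumption
  · rintro S (rfl | rfl) T (rfl | rfl) hne
    · exact absurd rfl hne
    · exact h
    · rw [Set.inter_comm]; exact h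
    · exact absurd rfl hne

lemma Dec.image {F : Type*} [TopologicalSpace F] {Q' : Set F → Prop} (h : Dec Q X) (e : E ≃ₜ F)
    (hQ : ∀ S, Q S → Q' (e '' S)) : Dec Q' (e '' X) := by
  obtain ⟨D, h1, h2, h3, h4⟩ := h
  refine ⟨(fun S => e '' S) '' D, h1.image _, ?_, ?_, ?_⟩
  · rintro _ ⟨S, hS, rfl⟩; exact hQ S (h2 S hS)
  · rw [← h3, Set.sUnion_eq_biUnion, Set.image_sUnion]
    simp
  · rintro _ ⟨S, hS, rfl⟩ _ ⟨T, hT, rfl⟩ hne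
    have := h4 hS hT fun h => hne (by rw [h])
    rw [← e.image_interior, ← e.image_interior, ← Set.image_inter e.injective, this,
      Set.image_empty]

end Decompositions

section Affine

variable {E : Type*} [NormedAddCommGroup E] [NormedSpace ℝ E]

lemma affine_add (f : E →ᵃ[ℝ] ℝ) (p v : E) : f (p + v) = f p + f.linear v := by
  have := f.map_vadd p v
  simp only [vadd_eq_add] at this
  rw [add_comm p v, this, add_comm]

lemma exists_pos_add_smul_mem {S : Set E} {p : E} (hp : p ∈ interior S) (v : E) :
    ∃ ε : ℝ, 0 < ε ∧ p + ε • v ∈ S := by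
  have hc : ContinuousAt (fun ε : ℝ => p + ε • v) 0 := by fun_prop
  have h1 : ∀ᶠ ε : ℝ in nhds 0, p + ε • v ∈ S := by
    apply hc
    simpa using mem_interior_iff_mem_nhds.1 hp
  obtain ⟨ε, h2, h3⟩ := ((h1.filter_mono nhdsWithin_le_nhds).and
    (self_mem_nhdsWithin : Set.Ioi (0 : ℝ) ∈ nhdsWithin 0 (Set.Ioi 0))).exists
  exact ⟨ε, h3, h2⟩

lemma pos_of_mem_interior {S : Set E} {f : E →ᵃ[ℝ] ℝ} (hf : ∀ p ∈ S, 0 ≤ f p) {v : E}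
    (hv : f.linear v < 0) {p : E} (hp : p ∈ interior S) : 0 < f p := by
  obtain ⟨ε, h1, h2⟩ := exists_pos_add_smul_mem hp v
  have := hf _ h2
  rw [affine_add, map_smul, smul_eq_mul] at this
  nlinarith

lemma eq_zero_of_mem_interior {S : Set E} {f : E →ᵃ[ℝ] ℝ} (hf : ∀ p ∈ S, f p = 0) {p : E}
    (hp : p ∈ interior S) (q : E) : f q = 0 := by
  obtain ⟨ε, h1, h2⟩ := exists_pos_add_smul_mem hp (q - p)
  have h3 := hf _ h2
  have h4 := hf _ (interior_subset hp)
  rw [affine_add, map_smul, smul_eq_mul, h4, zero_add] at h3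
  have h5 := affine_add f p (q - p)
  rw [add_sub_cancel] at h5
  rw [h5, h4, zero_add]
  exact (mul_eq_zero.1 h3).resolve_left h1.ne'

/-- A bijective affine map of a finite-dimensional space as a homeomorphism. -/
def affHomeo {F : Type*} [NormedAddCommGroup F] [NormedSpace ℝ F] [FiniteDimensional ℝ E]
    (L : E ≃ₗ[ℝ] F) (a : F) : E ≃ₜ F :=
  L.toContinuousLinearEquiv.toHomeomorph.trans (Homeomorph.addLeft a)

@[simp] lemma affHomeo_apply {F : Type*} [NormedAddCommGroup F] [NormedSpace ℝ F]
    [FiniteDimensional ℝ E] (L : E ≃ₗ[ℝ] F) (a : F) (p : E) : affHomeo L a p = a + L p := rfl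

end Affine

section Columns

/-- The vertical direction. -/
def ez : Col := ((0, 0), 1)

/-- The linear part of the parametrization of a column. -/
def colL (a b c : Col) : Col →ₗ[ℝ] Col where
  toFun p := p.1.1 • (b - a) + p.1.2 • (c - a) + p.2 • ez
  map_add' p q := by simp only [Prod.fst_add, Prod.snd_add, add_smul]; abel
  map_smul' r p := by simp [smul_smul, smul_add]

lemma colL_apply (a b c p : Col) :
    colL a b c p = p.1.1 • (b - a) + p.1.2 • (c - a) + p.2 • ez := rfl

/-- The standard column. -/
def stdCol : Set Col := {p | 0 ≤ p.1.1 ∧ 0 ≤ p.1.2 ∧ p.1.1 + p.1.2 ≤ 1 ∧ 0 ≤ p.2}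

/-- The standard open column. -/
def stdColO : Set Col := {p | 0 < p.1.1 ∧ 0 < p.1.2 ∧ p.1.1 + p.1.2 < 1 ∧ 0 < p.2}

/-- The column with (slanted) triangular base `a b c`. -/
def col (a b c : Col) : Set Col := (fun p => a + colL a b c p) '' stdCol

/-- The open column over `a b c`. -/
def colO (a b c : Col) : Set Col := (fun p => a + colL a b c p) '' stdColO

/-- The column over `a b c` is nondegenerate. -/
def Nd (a b c : Col) : Prop := Function.Injective (colL a b c)

/-- The linear part of the parametrization of a nondegenerate column, as an equivalence. -/
def colE {a b c : Col} (h : Nd a b c) : Col ≃ₗ[ℝ] Col := LinearEquiv.ofInjectiveEndo _ h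

@[simp] lemma colE_apply {a b c : Col} (h : Nd a b c) (p : Col) : colE h p = colL a b c p := rfl

lemma nd_iff {a b c : Col} : Nd a b c ↔
    ∀ x y z : ℝ, x • (b - a) + y • (c - a) + z • ez = 0 → x = 0 ∧ y = 0 ∧ z = 0 := by
  rw [Nd, ← LinearMap.ker_eq_bot, LinearMap.ker_eq_bot']
  constructor
  · intro h x y z e
    have := h ((x, y), z) e
    simpa [Prod.ext_iff, and_assoc] using this
  · rintro h ⟨⟨x, y⟩, z⟩ e
    obtain ⟨rfl, rfl, rfl⟩ := h x y z e
    rfl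

lemma mem_col {a b c p : Col} : p ∈ col a b c ↔ ∃ x y z : ℝ, 0 ≤ x ∧ 0 ≤ y ∧ x + y ≤ 1 ∧ 0 ≤ z ∧
    p = a + (x • (b - a) + y • (c - a) + z • ez) := by
  constructor
  · rintro ⟨⟨⟨x, y⟩, z⟩, ⟨h1, h2, h3, h4⟩, rfl⟩
    exact ⟨x, y, z, h1, h2, h3, h4, rfl⟩
  · rintro ⟨x, y, z, h1, h2, h3, h4, rfl⟩
    exact ⟨((x, y), z), ⟨h1, h2, h3, h4⟩, rfl⟩

lemma mem_colO {a b c p : Col} : p ∈ colO a b c ↔ ∃ x y z : ℝ, 0 < x ∧ 0 < y ∧ x + y < 1 ∧ 0 < z ∧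
    p = a + (x • (b - a) + y • (c - a) + z • ez) := by
  constructor
  · rintro ⟨⟨⟨x, y⟩, z⟩, ⟨h1, h2, h3, h4⟩, rfl⟩
    exact ⟨x, y, z, h1, h2, h3, h4, rfl⟩
  · rintro ⟨x, y, z, h1, h2, h3, h4, rfl⟩
    exact ⟨((x, y), z), ⟨h1, h2, h3, h4⟩, rfl⟩

lemma interior_stdCol_subset : interior stdCol ⊆ stdColO := by
  intro p hp
  have key : ∀ (f : Col →ₗ[ℝ] ℝ) (r : ℝ) (v : Col), f v < 0 → (∀ q ∈ stdCol, 0 ≤ f q + r) →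
      0 < f p + r := by
    intro f r v hv hf
    have := pos_of_mem_interior (f := f.toAffineMap + AffineMap.const ℝ Col r) (S := stdCol)
      (by simpa using hf) (v := v) (by simpa using hv) hp
    simpa using this
  refine ⟨?_, ?_, ?_, ?_⟩
  · simpa using key (lin 1 0 0) 0 ((-1, 0), 0) (by simp) (fun q hq => by simpa using hq.1)
  · simpa using key (lin 0 1 0) 0 ((0, -1), 0) (by simp) (fun q hq => by simpa using hq.2.1)
  · have := key (lin (-1) (-1) 0) 1 ((1, 0), 0) (by simp) (fun q hq => by
      have := hq.2.2.1; simp; linarith)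
    simp at this; linarith
  · simpa using key (lin 0 0 1) 0 ((0, 0), -1) (by simp) (fun q hq => by simpa using hq.2.2.2)

lemma interior_col_subset {a b c : Col} (h : Nd a b c) : interior (col a b c) ⊆ colO a b c := by
  have : col a b c = affHomeo (colE h) a '' stdCol := rfl
  rw [this, ← (affHomeo (colE h) a).image_interior]
  exact Set.image_mono interior_stdCol_subset

lemma image_col {a b c : Col} (L : Col ≃ₗ[ℝ] Col) (t : Col) {r : ℝ} (hr : 0 < r)
    (hL : L ez = r • ez) : affHomeo L t '' col a b c = col (t + L a) (t + L b) (t + L c) := by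
  ext p
  simp only [Set.mem_image, mem_col]
  constructor
  · rintro ⟨_, ⟨x, y, z, h1, h2, h3, h4, rfl⟩, rfl⟩
    refine ⟨x, y, z * r, h1, h2, h3, by positivity, ?_⟩
    simp only [affHomeo_apply, map_add, map_smul, hL, map_sub]
    module
  · rintro ⟨x, y, z, h1, h2, h3, h4, rfl⟩
    refine ⟨_, ⟨x, y, z / r, h1, h2, h3, by positivity, rfl⟩, ?_⟩
    simp only [affHomeo_apply, map_add, map_smul, hL, map_sub, smul_smul,
      div_mul_cancel₀ _ hr.ne']
    module

lemma Nd.image {a b c : Col} (h : Nd a b c) (L : Col ≃ₗ[ℝ] Col) (t : Col) {r : ℝ} (hr : 0 < r)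
    (hL : L ez = r • ez) : Nd (t + L a) (t + L b) (t + L c) := by
  rw [nd_iff] at h ⊢
  intro x y z e
  have : L (x • (b - a) + y • (c - a) + (z / r) • ez) = 0 := by
    rw [← e]
    simp only [map_add, map_smul, hL, map_sub, smul_smul, div_mul_cancel₀ _ hr.ne']
    module
  rw [LinearEquiv.map_eq_zero_iff] at this
  obtain ⟨h1, h2, h3⟩ := h _ _ _ this
  exact ⟨h1, h2, by simpa [hr.ne'] using h3⟩

lemma stdCol_eq : stdCol = col ((0, 0), 0) ((1, 0), 0) ((0, 1), 0) := by
  ext p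
  have : (fun p => ((0, 0), 0) + colL ((0, 0), 0) ((1, 0), 0) ((0, 1), 0) p) = id := by
    funext p; ext <;> simp [colL_apply, ez]
  rw [col, this, Set.image_id]

lemma nd_std : Nd ((0, 0), 0) ((1, 0), 0) ((0, 1), 0) := by
  rw [nd_iff]
  intro x y z e
  simpa [ez, Prod.ext_iff, and_assoc] using e

lemma Nd.perm {a b c : Col} (h : Nd a b c) : Nd b c a := by
  rw [nd_iff] at h ⊢
  intro x y z e
  obtain ⟨h1, h2, h3⟩ := h (-x - y) x z (by rw [← e]; module)
  exact ⟨h2, by linarith, h3⟩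

lemma col_perm (a b c : Col) : col b c a = col a b c := by
  ext p
  simp only [mem_col]
  constructor
  · rintro ⟨x, y, z, h1, h2, h3, h4, rfl⟩
    exact ⟨1 - x - y, x, z, by linarith, h1, by linarith, h4, by module⟩
  · rintro ⟨x, y, z, h1, h2, h3, h4, rfl⟩
    exact ⟨y, 1 - x - y, z, h2, by linarith, by linarith, h4, by module⟩

lemma add_mem_col {a b c p : Col} (hp : p ∈ col a b c) {s : ℝ} (hs : 0 ≤ s) :
    p + s • ez ∈ col a b c := by
  rw [mem_col] at hp ⊢
  obtain ⟨x, y, z, h1, h2, h3, h4, rfl⟩ := hp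
  exact ⟨x, y, z + s, h1, h2, h3, by linarith, by module⟩

lemma convex_stdCol : Convex ℝ stdCol := by
  rintro p ⟨h1, h2, h3, h4⟩ q ⟨k1, k2, k3, k4⟩ α β hα hβ e
  refine ⟨?_, ?_, ?_, ?_⟩ <;> simp only [Prod.fst_add, Prod.snd_add, Prod.smul_fst,
    Prod.smul_snd, smul_eq_mul]
  · positivity
  · positivity
  · nlinarith
  · positivity

lemma convex_col (a b c : Col) : Convex ℝ (col a b c) := by
  have : (fun p => a + colL a b c p) =
      ((AffineMap.const ℝ Col a + (colL a b c).toAffineMap : Col →ᵃ[ℝ] Col) : Col → Col) := by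
    funext p; simp
  rw [col, this]
  exact convex_stdCol.affine_image _

lemma left_mem_col (a b c : Col) : a ∈ col a b c :=
  mem_col.2 ⟨0, 0, 0, le_rfl, le_rfl, by simp, le_rfl, by simp⟩

lemma hull_subset_col (a b c : Col) : convexHull ℝ {a, b, c} ⊆ col a b c := by
  refine convexHull_min ?_ (convex_col a b c)
  rintro p (rfl | rfl | rfl)
  · exact left_mem_col _ _ _
  · rw [← col_perm]; exact left_mem_col _ _ _
  · rw [← col_perm, ← col_perm]; exact left_mem_col _ _ _

lemma col_subset {X : Set Col} (hX : Convex ℝ X) (hup : ∀ p ∈ X, ∀ s : ℝ, 0 ≤ s → p + s • ez ∈ X)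
    {a b c : Col} (ha : a ∈ X) (hb : b ∈ X) (hc : c ∈ X) : col a b c ⊆ X := by
  intro p hp
  rw [mem_col] at hp
  obtain ⟨x, y, z, h1, h2, h3, h4, rfl⟩ := hp
  rw [← add_assoc]
  refine hup _ ?_ z h4
  have : a + (x • (b - a) + y • (c - a)) = ∑ i : Fin 3, ![1 - x - y, x, y] i • ![a, b, c] i := by
    simp [Fin.sum_univ_three]; module
  rw [this]
  refine hX.sum_mem (fun i _ => ?_) ?_ fun i _ => ?_
  · fin_cases i <;> simp <;> linarith
  · simp [Fin.sum_univ_three]; ring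
  · fin_cases i <;> simp [ha, hb, hc]

lemma col_subset_col {a b c a' b' c' : Col} (ha : a' ∈ col a b c) (hb : b' ∈ col a b c)
    (hc : c' ∈ col a b c) : col a' b' c' ⊆ col a b c :=
  col_subset (convex_col a b c) (fun _ hp _ hs => add_mem_col hp hs) ha hb hc

lemma coords_unique {a b c : Col} (h : Nd a b c) {x y z x' y' z' : ℝ}
    (e : a + (x • (b - a) + y • (c - a) + z • ez) = a + (x' • (b - a) + y' • (c - a) + z' • ez)) :
    x = x' ∧ y = y' ∧ z = z' := by
  have := nd_iff.1 h (x - x') (y - y') (z - z') (by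
    have := add_left_cancel e
    rw [← sub_eq_zero.2 this]; module)
  refine ⟨?_, ?_, ?_⟩ <;> linarith [this.1, this.2.1, this.2.2]

end Columns

section Subdivision

/-- The affine function `f` does not change sign strictly on the triangle `a b c`. -/
def Sgn (f : Col →ᵃ[ℝ] ℝ) (a b c : Col) : Prop :=
  (0 ≤ f a ∧ 0 ≤ f b ∧ 0 ≤ f c) ∨ (f a ≤ 0 ∧ f b ≤ 0 ∧ f c ≤ 0)

/-- The triangle `a' b' c'` has its vertices in the triangle `a b c`. -/
def SubTri (a b c a' b' c' : Col) : Prop :=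
  a' ∈ convexHull ℝ {a, b, c} ∧ b' ∈ convexHull ℝ {a, b, c} ∧ c' ∈ convexHull ℝ {a, b, c}

lemma nonneg_of_mem_hull {f : Col →ᵃ[ℝ] ℝ} {a b c p : Col} (ha : 0 ≤ f a) (hb : 0 ≤ f b)
    (hc : 0 ≤ f c) (hp : p ∈ convexHull ℝ {a, b, c}) : 0 ≤ f p := by
  refine convexHull_min (t := f ⁻¹' Set.Ici 0) ?_ ((convex_Ici 0).affine_preimage f) hp
  rintro q (rfl | rfl | rfl) <;> assumption

lemma nonpos_of_mem_hull {f : Col →ᵃ[ℝ] ℝ} {a b c p : Col} (ha : f a ≤ 0) (hb : f b ≤ 0)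
    (hc : f c ≤ 0) (hp : p ∈ convexHull ℝ {a, b, c}) : f p ≤ 0 := by
  refine convexHull_min (t := f ⁻¹' Set.Iic 0) ?_ ((convex_Iic 0).affine_preimage f) hp
  rintro q (rfl | rfl | rfl) <;> assumption

lemma Sgn.mono {f : Col →ᵃ[ℝ] ℝ} {a b c a' b' c' : Col} (h : Sgn f a b c)
    (hs : SubTri a b c a' b' c') : Sgn f a' b' c' := by
  obtain ⟨ha, hb, hc⟩ := hs
  rcases h with ⟨h1, h2, h3⟩ | ⟨h1, h2, h3⟩
  · exact Or.inl ⟨nonneg_of_mem_hull h1 h2 h3 ha, nonneg_of_mem_hull h1 h2 h3 hb,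
      nonneg_of_mem_hull h1 h2 h3 hc⟩
  · exact Or.inr ⟨nonpos_of_mem_hull h1 h2 h3 ha, nonpos_of_mem_hull h1 h2 h3 hb,
      nonpos_of_mem_hull h1 h2 h3 hc⟩

lemma SubTri.refl (a b c : Col) : SubTri a b c a b c :=
  ⟨subset_convexHull ℝ _ (by simp), subset_convexHull ℝ _ (by simp),
    subset_convexHull ℝ _ (by simp)⟩

lemma SubTri.hull {a b c a' b' c' : Col} (h : SubTri a b c a' b' c') :
    convexHull ℝ {a', b', c'} ⊆ convexHull ℝ {a, b, c} := by
  refine convexHull_min ?_ (convex_convexHull ℝ _)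
  rintro p (rfl | rfl | rfl)
  exacts [h.1, h.2.1, h.2.2]

lemma SubTri.trans {a b c a' b' c' x y z : Col} (h : SubTri a b c a' b' c')
    (h' : SubTri a' b' c' x y z) : SubTri a b c x y z :=
  ⟨h.hull h'.1, h.hull h'.2.1, h.hull h'.2.2⟩

lemma SubTri.col {a b c a' b' c' : Col} (h : SubTri a b c a' b' c') :
    col a' b' c' ⊆ col a b c :=
  col_subset_col (hull_subset_col _ _ _ h.1) (hull_subset_col _ _ _ h.2.1)
    (hull_subset_col _ _ _ h.2.2)

lemma SubTri.perm {a b c a' b' c' : Col} (h : SubTri b c a a' b' c') : SubTri a b c a' b' c' := by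
  have : ({b, c, a} : Set Col) = {a, b, c} := by ext; simp; tauto
  simpa only [SubTri, this] using h

lemma edge_mem_hull {a b c : Col} {t : ℝ} (h0 : 0 < t) (h1 : t < 1) :
    a + t • (b - a) ∈ convexHull ℝ {a, b, c} := by
  have := (convex_convexHull ℝ {a, b, c}) (subset_convexHull ℝ _ (by simp : a ∈ _))
    (subset_convexHull ℝ _ (by simp : b ∈ _)) (sub_nonneg.2 h1.le) h0.le (by ring)
  convert this using 1
  module

lemma Dec.split {Q : Set Col → Prop} {a b c d : Col} (h : Nd a b c) {t : ℝ} (h0 : 0 < t)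
    (h1 : t < 1) (hd : d = a + t • (b - a))
    (hA : Nd a d c → SubTri a b c a d c → Dec Q (col a d c))
    (hB : Nd d b c → SubTri a b c d b c → Dec Q (col d b c)) : Dec Q (col a b c) := by
  have hdm : d ∈ convexHull ℝ {a, b, c} := hd ▸ edge_mem_hull h0 h1
  have sA : SubTri a b c a d c := ⟨(SubTri.refl a b c).1, hdm, (SubTri.refl a b c).2.2⟩
  have sB : SubTri a b c d b c := ⟨hdm, (SubTri.refl a b c).2.1, (SubTri.refl a b c).2.2⟩
  have ht1 : 0 < 1 - t := by linarith
  have nA : Nd a d c := by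
    rw [nd_iff] at h ⊢
    intro x y z e
    obtain ⟨k1, k2, k3⟩ := h (x * t) y z (by rw [← e, hd]; module)
    exact ⟨by simpa [h0.ne'] using k1, k2, k3⟩
  have nB : Nd d b c := by
    rw [nd_iff] at h ⊢
    intro x y z e
    obtain ⟨k1, k2, k3⟩ := h (x * (1 - t) - y * t) y z (by rw [← e, hd]; module)
    subst k2
    refine ⟨?_, rfl, k3⟩
    simpa [ht1.ne'] using k1
  refine Dec.union (hA nA sA) (hB nB sB) (Set.Subset.antisymm
    (Set.union_subset sA.col sB.col) ?_) ?_
  · intro p hp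
    obtain ⟨x, y, z, k1, k2, k3, k4, rfl⟩ := mem_col.1 hp
    rcases le_total x (t * (1 - y)) with hx | hx
    · left
      rw [mem_col]
      refine ⟨x / t, y, z, by positivity, k2, ?_, k4, ?_⟩
      · rw [← le_sub_iff_add_le, div_le_iff₀ h0]; linarith
      · rw [hd]
        have : x = x / t * t := by field_simp
        conv_lhs => rw [this]
        module
    · right
      rw [mem_col]
      refine ⟨(x - t * (1 - y)) / (1 - t), y, z, div_nonneg (by linarith) ht1.le, k2, ?_, k4, ?_⟩
      · rw [← le_sub_iff_add_le, div_le_iff₀ ht1]; nlinarith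
      · rw [hd]
        have : x = (x - t * (1 - y)) / (1 - t) * (1 - t) + t * (1 - y) := by
          rw [div_mul_cancel₀ _ ht1.ne']; ring
        conv_lhs => rw [this]
        module
  · refine Set.eq_empty_of_forall_notMem fun p hp => ?_
    obtain ⟨x, y, z, k1, k2, k3, k4, e⟩ := mem_colO.1 (interior_col_subset nA hp.1)
    obtain ⟨x', y', z', l1, l2, l3, l4, e'⟩ := mem_colO.1 (interior_col_subset nB hp.2)
    have := coords_unique h (x := x * t) (y := y) (z := z)
      (x' := t + x' * (1 - t) - y' * t) (y' := y') (z' := z') (by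
        rw [hd] at e e'
        trans p
        · rw [e]; module
        · rw [e']; module)
    obtain ⟨m1, rfl, -⟩ := this
    have := mul_pos l1 ht1
    have := mul_lt_mul_of_pos_right k3 h0
    linarith

lemma exists_zero_on_edge {f : Col →ᵃ[ℝ] ℝ} {a b : Col} (h : f a * f b < 0) :
    ∃ t : ℝ, 0 < t ∧ t < 1 ∧ f (a + t • (b - a)) = 0 := by
  have hf : ∀ t : ℝ, f (a + t • (b - a)) = f a + t * (f b - f a) := fun t => by
    have h1 := affine_add f a (b - a)
    rw [add_sub_cancel] at h1
    rw [affine_add, map_smul, smul_eq_mul, h1]; ring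
  rcases mul_neg_iff.1 h with ⟨ha, hb⟩ | ⟨ha, hb⟩
  · refine ⟨f a / (f a - f b), by apply div_pos <;> linarith, ?_, ?_⟩
    · rw [div_lt_one] <;> linarith
    · rw [hf]
      have : f a - f b ≠ 0 := by linarith
      field_simp; ring
  · refine ⟨f a / (f a - f b), div_pos_of_neg_of_neg ha (by linarith), ?_, ?_⟩
    · rw [div_lt_one_of_neg] <;> linarith
    · rw [hf]
      have : f a - f b ≠ 0 := by linarith
      field_simp; ring

/-- A piece of `col a b c` that is a column over a subtriangle on which `Ψ` has constant signs. -/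
def SgnPiece (Ψ : Set (Col →ᵃ[ℝ] ℝ)) (a b c : Col) (S : Set Col) : Prop :=
  ∃ a' b' c', S = col a' b' c' ∧ Nd a' b' c' ∧ SubTri a b c a' b' c' ∧ ∀ f ∈ Ψ, Sgn f a' b' c'

lemma SgnPiece.mono {Ψ : Set (Col →ᵃ[ℝ] ℝ)} {a b c a' b' c' : Col} {S : Set Col}
    (h : SubTri a b c a' b' c') (hS : SgnPiece Ψ a' b' c' S) : SgnPiece Ψ a b c S := by
  obtain ⟨x, y, z, h1, h2, h3, h4⟩ := hS
  exact ⟨x, y, z, h1, h2, h.trans h3, h4⟩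

lemma dec_sgn_of_zero (f : Col →ᵃ[ℝ] ℝ) {a b c : Col} (h : Nd a b c) (hc : f c = 0) :
    Dec (SgnPiece {f} a b c) (col a b c) := by
  by_cases hab : f a * f b < 0
  · obtain ⟨t, h0, h1, ht⟩ := exists_zero_on_edge hab
    refine Dec.split h h0 h1 rfl (fun n s => Dec.self ⟨_, _, _, rfl, n, s, ?_⟩)
      (fun n s => Dec.self ⟨_, _, _, rfl, n, s, ?_⟩)
    · intro g hg
      rw [Set.mem_singleton_iff.1 hg]
      rcases le_total 0 (f a) with h | h
      · exact Or.inl ⟨h, ht.ge, hc.ge⟩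
      · exact Or.inr ⟨h, ht.le, hc.le⟩
    · intro g hg
      rw [Set.mem_singleton_iff.1 hg]
      rcases le_total 0 (f b) with h | h
      · exact Or.inl ⟨ht.ge, h, hc.ge⟩
      · exact Or.inr ⟨ht.le, h, hc.le⟩
  · refine Dec.self ⟨_, _, _, rfl, h, SubTri.refl a b c, ?_⟩
    intro g hg
    rw [Set.mem_singleton_iff.1 hg]
    rcases mul_nonneg_iff.1 (not_lt.1 hab) with ⟨h1, h2⟩ | ⟨h1, h2⟩
    · exact Or.inl ⟨h1, h2, hc.ge⟩
    · exact Or.inr ⟨h1, h2, hc.le⟩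

lemma dec_sgn_of_neg (f : Col →ᵃ[ℝ] ℝ) {a b c : Col} (h : Nd a b c) (hab : f a * f b < 0) :
    Dec (SgnPiece {f} a b c) (col a b c) := by
  obtain ⟨t, h0, h1, ht⟩ := exists_zero_on_edge hab
  refine Dec.split h h0 h1 rfl (fun n s => ?_) (fun n s => ?_)
  · rw [← col_perm, ← col_perm]
    exact (dec_sgn_of_zero f n.perm.perm ht).mono fun S _ hS =>
      (hS.mono (SubTri.refl _ _ _).perm.perm).mono s
  · rw [← col_perm]
    exact (dec_sgn_of_zero f n.perm ht).mono fun S _ hS =>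
      (hS.mono (SubTri.refl _ _ _).perm).mono s

lemma dec_sgn_single (f : Col →ᵃ[ℝ] ℝ) {a b c : Col} (h : Nd a b c) :
    Dec (SgnPiece {f} a b c) (col a b c) := by
  by_cases h1 : f a * f b < 0
  · exact dec_sgn_of_neg f h h1
  by_cases h2 : f b * f c < 0
  · rw [← col_perm]
    exact (dec_sgn_of_neg f h.perm h2).mono fun S _ hS => hS.mono (SubTri.refl _ _ _).perm
  by_cases h3 : f c * f a < 0
  · rw [← col_perm, ← col_perm]
    exact (dec_sgn_of_neg f h.perm.perm h3).mono fun S _ hS =>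
      hS.mono (SubTri.refl _ _ _).perm.perm
  refine Dec.self ⟨_, _, _, rfl, h, SubTri.refl a b c, ?_⟩
  intro g hg
  rw [Set.mem_singleton_iff.1 hg]
  rw [not_lt] at h1 h2 h3
  by_contra hn
  simp only [Sgn, not_or, not_and, not_le] at hn
  obtain ⟨k1, k2⟩ := hn
  rcases lt_trichotomy (f a) 0 with ha | ha | ha
  · have b0 : f b ≤ 0 := nonpos_of_mul_nonneg_right h1 ha
    have c0 : f c ≤ 0 := nonpos_of_mul_nonneg_left h3 ha
    linarith [k2 ha.le b0]
  · rcases lt_trichotomy (f b) 0 with hb | hb | hb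
    · have c0 : f c ≤ 0 := nonpos_of_mul_nonneg_right h2 hb
      linarith [k2 ha.le hb.le]
    · linarith [k1 ha.ge hb.ge, k2 ha.le hb.le]
    · have c0 : 0 ≤ f c := nonneg_of_mul_nonneg_right h2 hb
      linarith [k1 ha.ge hb.le]
  · have b0 : 0 ≤ f b := nonneg_of_mul_nonneg_right h1 ha
    have c0 : 0 ≤ f c := nonneg_of_mul_nonneg_left h3 ha
    linarith [k1 ha.le b0]

lemma dec_sgn {Ψ : Set (Col →ᵃ[ℝ] ℝ)} (hΨ : Ψ.Finite) {a b c : Col} (h : Nd a b c) :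
    Dec (SgnPiece Ψ a b c) (col a b c) := by
  induction Ψ, hΨ using Set.Finite.induction_on with
  | empty => exact Dec.self ⟨_, _, _, rfl, h, SubTri.refl a b c, by simp⟩
  | @insert f _ _ _ ih =>
    refine ih.bind ?_
    rintro _ - ⟨a', b', c', rfl, n, s, hs⟩
    refine (dec_sgn_single f n).mono ?_
    rintro _ - ⟨x, y, z, rfl, n', s', hs'⟩
    refine ⟨x, y, z, rfl, n', s.trans s', ?_⟩
    rintro g (rfl | hg)
    · exact hs' g rfl
    · exact (hs g hg).mono s'

end Subdivision

section Remainder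

lemma affine_tri (f : Col →ᵃ[ℝ] ℝ) (a b c : Col) (x y : ℝ) :
    f (a + (x • (b - a) + y • (c - a))) = (1 - x - y) * f a + x * f b + y * f c := by
  have h1 := affine_add f a (b - a)
  have h2 := affine_add f a (c - a)
  rw [add_sub_cancel] at h1 h2
  rw [affine_add, map_add, map_smul, map_smul, smul_eq_mul, smul_eq_mul, h1, h2]; ring

/-- The polyhedron cut out by the constraints in `G`. -/
def poly (G : Set (Col →ᵃ[ℝ] ℝ)) : Set Col := {p | ∀ g ∈ G, 0 ≤ g p}

/-- The amount by which `p` must be raised to reach the plane `k = 0`. -/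
def lift (k : Col →ᵃ[ℝ] ℝ) (p : Col) : ℝ := k p / -(k.linear ez)

/-- The value of `l` at the vertical projection to the plane `k = 0`. -/
def atTop (k l : Col →ᵃ[ℝ] ℝ) : Col →ᵃ[ℝ] ℝ := l + (l.linear ez / -(k.linear ez)) • k

lemma atTop_apply (k l : Col →ᵃ[ℝ] ℝ) (p : Col) : atTop k l p = l (p + lift k p • ez) := by
  rw [affine_add]
  simp [atTop, lift]
  ring

lemma lift_tri (k : Col →ᵃ[ℝ] ℝ) (a b c : Col) (x y : ℝ) :
    lift k (a + (x • (b - a) + y • (c - a))) =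
      (1 - x - y) * lift k a + x * lift k b + y * lift k c := by
  simp only [lift, affine_tri]; ring

lemma top_tri (k : Col →ᵃ[ℝ] ℝ) (a b c : Col) (x y z : ℝ) :
    (a + lift k a • ez) + (x • ((b + lift k b • ez) - (a + lift k a • ez)) +
      y • ((c + lift k c • ez) - (a + lift k a • ez)) + z • ez) =
    (a + (x • (b - a) + y • (c - a))) +
      (lift k (a + (x • (b - a) + y • (c - a))) + z) • ez := by
  rw [lift_tri]; module

lemma Sgn.nonneg_of {f : Col →ᵃ[ℝ] ℝ} {a b c : Col} (h : Sgn f a b c) {x y : ℝ} (hx : 0 < x)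
    (hy : 0 < y) (hxy : x + y < 1) (hf : 0 ≤ f (a + (x • (b - a) + y • (c - a)))) :
    0 ≤ f a ∧ 0 ≤ f b ∧ 0 ≤ f c := by
  rcases h with h | ⟨h1, h2, h3⟩
  · exact h
  · rw [affine_tri] at hf
    have k1 : (1 - x - y) * f a ≤ 0 := mul_nonpos_of_nonneg_of_nonpos (by linarith) h1
    have k2 := mul_nonpos_of_nonneg_of_nonpos hx.le h2
    have k3 := mul_nonpos_of_nonneg_of_nonpos hy.le h3
    refine ⟨?_, ?_, ?_⟩
    · exact nonneg_of_mul_nonneg_right (by linarith : 0 ≤ (1 - x - y) * f a) (by linarith)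
    · exact nonneg_of_mul_nonneg_right (by linarith : 0 ≤ x * f b) hx
    · exact nonneg_of_mul_nonneg_right (by linarith : 0 ≤ y * f c) hy

lemma height_nonneg {a b c : Col} (h : Nd a b c) {p : Col} (hp : p ∈ convexHull ℝ {a, b, c})
    {s : ℝ} (hs : p + s • ez ∈ col a b c) : 0 ≤ s := by
  let f : Col →ₗ[ℝ] ℝ := (LinearMap.snd ℝ (ℝ × ℝ) ℝ).comp (colE h).symm.toLinearMap
  have hf : ∀ x y z : ℝ, f (x • (b - a) + y • (c - a) + z • ez) = z := fun x y z => by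
    have : x • (b - a) + y • (c - a) + z • ez = colE h ((x, y), z) := rfl
    rw [this]
    change ((colE h).symm (colE h ((x, y), z))).2 = z
    rw [LinearEquiv.symm_apply_apply]
  let H : Col →ᵃ[ℝ] ℝ := f.toAffineMap - AffineMap.const ℝ Col (f a)
  have hH : ∀ q, H q = f (q - a) := fun q => by simp [H]
  have e : ∀ q, H (q + s • ez) = H q + s := fun q => by
    have := hf 0 0 1
    simp only [zero_smul, zero_add, one_smul] at this
    simp [H, this]; ring
  have ha : H a = 0 := by simp [hH]
  have hb : H b = 0 := by have := hf 1 0 0; simpa [hH] using this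
  have hc : H c = 0 := by have := hf 0 1 0; simpa [hH] using this
  have h1 := nonpos_of_mem_hull ha.le hb.le hc.le hp
  obtain ⟨x, y, z, -, -, -, hz, e'⟩ := mem_col.1 hs
  have h2 := e p
  rw [e', hH, add_sub_cancel_left, hf] at h2
  linarith

variable {a b c : Col} {ι : Type*} [Finite ι] {G : ι → Set (Col →ᵃ[ℝ] ℝ)}

/-- The functions whose signs control the shape of the top of `⋃ j, poly (G j)`. -/
def topFns (G : ι → Set (Col →ᵃ[ℝ] ℝ)) : Set (Col →ᵃ[ℝ] ℝ) :=
  (fun q : (Col →ᵃ[ℝ] ℝ) × (Col →ᵃ[ℝ] ℝ) => atTop q.1 q.2) '' ((⋃ j, G j) ×ˢ ⋃ j, G j)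

lemma exists_top {G : Set (Col →ᵃ[ℝ] ℝ)} (hG : G.Finite) (hup : ∃ k ∈ G, k.linear ez < 0)
    {v : Col} {s : ℝ} (hv : v + s • ez ∈ poly G) :
    ∃ k ∈ G, k.linear ez < 0 ∧ s ≤ lift k v ∧ ∀ l ∈ G, 0 ≤ atTop k l v := by
  obtain ⟨k, ⟨hk, hk0⟩, hmin⟩ := Set.exists_min_image {k ∈ G | k.linear ez < 0} (fun k => lift k v)
    (hG.subset (Set.sep_subset _ _)) (by obtain ⟨k, h1, h2⟩ := hup; exact ⟨k, h1, h2⟩)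
  have hle : ∀ k ∈ G, k.linear ez < 0 → s ≤ lift k v := fun k hk hk0 => by
    have := hv k hk
    rw [affine_add, map_smul, smul_eq_mul] at this
    rw [lift, le_div_iff₀ (by linarith)]; linarith
  refine ⟨k, hk, hk0, hle k hk hk0, fun l hl => ?_⟩
  rw [atTop_apply, affine_add, map_smul, smul_eq_mul]
  by_cases hl0 : l.linear ez < 0
  · have := hmin l ⟨hl, hl0⟩
    rw [lift.eq_def l v, le_div_iff₀ (by linarith)] at this
    linarith
  · have h1 := hv l hl
    rw [affine_add, map_smul, smul_eq_mul] at h1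
    have := mul_le_mul_of_nonneg_right (hle k hk hk0) (not_lt.1 hl0)
    linarith

lemma exists_cap (h : Nd a b c) (hG : ∀ j, (G j).Finite) (hsub : ∀ j, poly (G j) ⊆ col a b c)
    (hup : ∀ j, ∃ k ∈ G j, k.linear ez < 0)
    (hdown : ∀ j p (s : ℝ), 0 ≤ s → p + s • ez ∈ poly (G j) → p ∈ col a b c → ∃ k, p ∈ poly (G k))
    {a' b' c' : Col} (h' : Nd a' b' c') (hs : SubTri a b c a' b' c')
    (hsgn : ∀ f ∈ topFns G, Sgn f a' b' c') :
    ∃ x y z, Nd x y z ∧ col x y z ⊆ col a' b' c' ∧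
      (∀ p ∈ col a' b' c', p ∈ col x y z ∨ ∃ j, p ∈ poly (G j)) ∧
      ∀ j, colO x y z ∩ poly (G j) = ∅ := by
  let u₀ : Col := a' + ((1 / 3 : ℝ) • (b' - a') + (1 / 3 : ℝ) • (c' - a'))
  let Feas : Set (Col →ᵃ[ℝ] ℝ) :=
    {k ∈ ⋃ j, G j | k.linear ez < 0 ∧ ∃ j, ∀ l ∈ G j, 0 ≤ atTop k l u₀}
  have hfin : (⋃ j, G j).Finite := Set.finite_iUnion hG
  have hS : ∀ k ∈ ⋃ j, G j, ∀ l ∈ ⋃ j, G j, Sgn (atTop k l) a' b' c' := fun k hk l hl =>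
    hsgn _ ⟨(k, l), ⟨hk, hl⟩, rfl⟩
  have key : ∀ k ∈ ⋃ j, G j, ∀ l ∈ ⋃ j, G j, ∀ x y x' y' : ℝ, 0 < x → 0 < y → x + y < 1 →
      0 < x' → 0 < y' → x' + y' < 1 →
      0 ≤ atTop k l (a' + (x • (b' - a') + y • (c' - a'))) →
      0 ≤ atTop k l (a' + (x' • (b' - a') + y' • (c' - a'))) := by
    intro k hk l hl x y x' y' hx hy hxy hx' hy' hxy' hh
    obtain ⟨h1, h2, h3⟩ := (hS k hk l hl).nonneg_of hx hy hxy hh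
    rw [affine_tri]
    have : 0 ≤ 1 - x' - y' := by linarith
    positivity
  have hA : ∀ j (x y s : ℝ), 0 < x → 0 < y → x + y < 1 →
      (a' + (x • (b' - a') + y • (c' - a'))) + s • ez ∈ poly (G j) →
      ∃ k ∈ Feas, s ≤ lift k (a' + (x • (b' - a') + y • (c' - a'))) := by
    intro j x y s hx hy hxy hp
    obtain ⟨k, hk, hk0, hle, hl⟩ := exists_top (hG j) (hup j) hp
    have hk' : k ∈ ⋃ j, G j := Set.mem_iUnion.2 ⟨j, hk⟩
    refine ⟨k, ⟨hk', hk0, j, fun l hl' => ?_⟩, hle⟩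
    exact key k hk' l (Set.mem_iUnion.2 ⟨j, hl'⟩) x y _ _ hx hy hxy (by norm_num) (by norm_num)
      (by norm_num) (hl l hl')
  rcases Set.eq_empty_or_nonempty Feas with he | hne
  · refine ⟨a', b', c', h', le_rfl, fun p hp => Or.inl hp, fun j => ?_⟩
    refine Set.eq_empty_of_forall_notMem fun p ⟨hp, hpj⟩ => ?_
    obtain ⟨x, y, z, hx, hy, hxy, hz, rfl⟩ := mem_colO.1 hp
    rw [← add_assoc] at hpj
    obtain ⟨k, hk, -⟩ := hA j x y z hx hy hxy hpj
    rw [he] at hk; exact hk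
  · obtain ⟨m, ⟨hm, hm0, j, hj⟩, hmax⟩ := Set.exists_max_image Feas (fun k => lift k u₀)
      (hfin.subset (Set.sep_subset _ _)) hne
    have hpos : ∀ l ∈ G j, 0 ≤ atTop m l a' ∧ 0 ≤ atTop m l b' ∧ 0 ≤ atTop m l c' := fun l hl =>
      (hS m hm l (Set.mem_iUnion.2 ⟨j, hl⟩)).nonneg_of (by norm_num) (by norm_num) (by norm_num)
        (hj l hl)
    have hta : a' + lift m a' • ez ∈ poly (G j) := fun l hl => by
      rw [← atTop_apply]; exact (hpos l hl).1
    have htb : b' + lift m b' • ez ∈ poly (G j) := fun l hl => by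
      rw [← atTop_apply]; exact (hpos l hl).2.1
    have htc : c' + lift m c' • ez ∈ poly (G j) := fun l hl => by
      rw [← atTop_apply]; exact (hpos l hl).2.2
    have sa := height_nonneg h hs.1 (hsub j hta)
    have sb := height_nonneg h hs.2.1 (hsub j htb)
    have sc := height_nonneg h hs.2.2 (hsub j htc)
    refine ⟨a' + lift m a' • ez, b' + lift m b' • ez, c' + lift m c' • ez, ?_, ?_, ?_, ?_⟩
    · rw [nd_iff] at h' ⊢
      intro x y z e
      obtain ⟨h1, h2, h3⟩ := h' x y
        (z + x * (lift m b' - lift m a') + y * (lift m c' - lift m a')) (by rw [← e]; module)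
      subst h1 h2
      exact ⟨rfl, rfl, by simpa using h3⟩
    · have hh := hull_subset_col a' b' c'
      exact col_subset_col (add_mem_col (hh (SubTri.refl _ _ _).1) sa)
        (add_mem_col (hh (SubTri.refl _ _ _).2.1) sb) (add_mem_col (hh (SubTri.refl _ _ _).2.2) sc)
    · intro p hp
      have hp' := hs.col hp
      obtain ⟨x, y, z, hx, hy, hxy, hz, rfl⟩ := mem_col.1 hp
      rcases le_total z (lift m (a' + (x • (b' - a') + y • (c' - a')))) with hzl | hzl
      · right
        refine hdown j _ (lift m (a' + (x • (b' - a') + y • (c' - a'))) - z) (by linarith) ?_ hp'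
        intro l hl
        have e : a' + (x • (b' - a') + y • (c' - a') + z • ez) +
            (lift m (a' + (x • (b' - a') + y • (c' - a'))) - z) • ez =
            (a' + (x • (b' - a') + y • (c' - a'))) +
            lift m (a' + (x • (b' - a') + y • (c' - a'))) • ez := by module
        rw [e, ← atTop_apply, affine_tri]
        obtain ⟨k1, k2, k3⟩ := hpos l hl
        have : 0 ≤ 1 - x - y := by linarith
        positivity
      · left
        rw [mem_col]
        refine ⟨x, y, z - lift m (a' + (x • (b' - a') + y • (c' - a'))), hx, hy, hxy,
          by linarith, ?_⟩
        rw [top_tri]; module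
    · intro i
      refine Set.eq_empty_of_forall_notMem fun p ⟨hp, hpi⟩ => ?_
      obtain ⟨x, y, z, hx, hy, hxy, hz, rfl⟩ := mem_colO.1 hp
      rw [top_tri] at hpi
      obtain ⟨k, hk, hle⟩ := hA i x y _ hx hy hxy hpi
      have h1 := hmax k hk
      have hk0 : 0 < -(k.linear ez) := by linarith [hk.2.1]
      have hm0' : 0 < -(m.linear ez) := by linarith
      have ev : ∀ q, atTop k m q = -(m.linear ez) * (lift m q - lift k q) := fun q => by
        simp only [atTop, lift, AffineMap.coe_add, AffineMap.coe_smul, Pi.add_apply, Pi.smul_apply,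
          smul_eq_mul]
        have : m q = -(m.linear ez) * (m q / -(m.linear ez)) := by
          rw [mul_div_assoc', mul_div_cancel_left₀ _ hm0'.ne']
        linear_combination this
      have h2 := key k hk.1 m hm (1 / 3) (1 / 3) x y (by norm_num) (by norm_num) (by norm_num)
        hx hy hxy (by
          rw [ev]
          exact mul_nonneg hm0'.le (by simpa [u₀] using h1))
      rw [ev] at h2
      have h3 := nonneg_of_mul_nonneg_right h2 hm0'
      linarith

/-- A column containing finitely many polyhedra whose union is downward closed decomposes into
these polyhedra and columns not meeting them. -/
theorem dec_remainder (h : Nd a b c) (hG : ∀ j, (G j).Finite)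
    (hsub : ∀ j, poly (G j) ⊆ col a b c) (hup : ∀ j, ∃ k ∈ G j, k.linear ez < 0)
    (hdown : ∀ j p (s : ℝ), 0 ≤ s → p + s • ez ∈ poly (G j) → p ∈ col a b c → ∃ k, p ∈ poly (G k))
    (hdis : ∀ i j, i ≠ j → interior (poly (G i)) ∩ interior (poly (G j)) = ∅) :
    Dec (fun S => (∃ j, S = poly (G j)) ∨ ∃ x y z, S = col x y z ∧ Nd x y z ∧
      ∀ j, colO x y z ∩ poly (G j) = ∅) (col a b c) := by
  have hfin : (topFns G).Finite :=
    ((Set.finite_iUnion hG).prod (Set.finite_iUnion hG)).image _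
  obtain ⟨D, h1, h2, h3, h4⟩ := dec_sgn hfin h
  have h5 : ∀ S : D, ∃ R : Set Col, (∃ x y z, R = col x y z ∧ Nd x y z ∧
      ∀ j, colO x y z ∩ poly (G j) = ∅) ∧ R ⊆ S.1 ∧ ∀ p ∈ S.1, p ∈ R ∨ ∃ j, p ∈ poly (G j) := by
    rintro ⟨S, hS⟩
    obtain ⟨a', b', c', rfl, n, s, hs⟩ := h2 S hS
    obtain ⟨x, y, z, k1, k2, k3, k4⟩ := exists_cap h hG hsub hup hdown n s hs
    exact ⟨_, ⟨x, y, z, rfl, k1, k4⟩, k2, k3⟩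
  choose R k1 k2 k3 using h5
  have : Finite D := h1
  have k4 : ∀ j S, interior (poly (G j)) ∩ interior (R S) = ∅ := fun j S => by
    obtain ⟨x, y, z, e, n, ho⟩ := k1 S
    rw [e]
    refine Set.eq_empty_of_subset_empty fun p hp => ?_
    rw [← ho j]
    exact ⟨interior_col_subset n hp.2, interior_subset hp.1⟩
  refine ⟨Set.range (fun j => poly (G j)) ∪ Set.range R,
    (Set.finite_range _).union (Set.finite_range _), ?_, ?_, ?_⟩
  · rintro _ (⟨j, rfl⟩ | ⟨S, rfl⟩)
    · exact Or.inl ⟨j, rfl⟩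
    · exact Or.inr (k1 S)
  · refine Set.Subset.antisymm (Set.sUnion_subset ?_) fun p hp => ?_
    · rintro _ (⟨j, rfl⟩ | ⟨S, rfl⟩)
      · exact hsub j
      · exact (k2 S).trans (h3 ▸ Set.subset_sUnion_of_mem S.2)
    · rw [← h3] at hp
      obtain ⟨S, hS, hpS⟩ := hp
      rcases k3 ⟨S, hS⟩ p hpS with hp | ⟨j, hp⟩
      · exact ⟨_, Or.inr ⟨_, rfl⟩, hp⟩
      · exact ⟨_, Or.inl ⟨j, rfl⟩, hp⟩
  · rintro _ (⟨i, rfl⟩ | ⟨S, rfl⟩) _ (⟨j, rfl⟩ | ⟨T, rfl⟩) hne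
    · exact hdis i j fun h => hne (by rw [h])
    · exact k4 i T
    · rw [Set.inter_comm]; exact k4 j S
    · refine interior_inter_eq_empty_mono (h4 S.2 T.2 fun h => hne ?_) (k2 S) (k2 T)
      rw [Subtype.ext h]

end Remainder

section Tiles

lemma isOpen_stdColO : IsOpen stdColO := by
  have h1 : Continuous fun p : Col => p.1.1 := by fun_prop
  have h2 : Continuous fun p : Col => p.1.2 := by fun_prop
  have h3 : Continuous fun p : Col => p.2 := by fun_prop
  exact (isOpen_lt continuous_const h1).inter ((isOpen_lt continuous_const h2).inter
    ((isOpen_lt (h1.add h2) continuous_const).inter (isOpen_lt continuous_const h3)))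

lemma isOpen_colO {a b c : Col} (h : Nd a b c) : IsOpen (colO a b c) :=
  (affHomeo (colE h) a).isOpen_image.2 isOpen_stdColO

lemma colO_nonempty (a b c : Col) : (colO a b c).Nonempty :=
  ⟨_, mem_colO.2 ⟨1 / 3, 1 / 3, 1, by norm_num, by norm_num, by norm_num, by norm_num, rfl⟩⟩

lemma exists_avoid {E : Type*} [NormedAddCommGroup E] [NormedSpace ℝ E] [FiniteDimensional ℝ E]
    {Ψ : Set (E →ᵃ[ℝ] ℝ)} (hΨ : Ψ.Finite) (h : ∀ f ∈ Ψ, ∃ p, f p ≠ 0) {U : Set E} (hU : IsOpen U)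
    (hne : U.Nonempty) : ∃ p ∈ U, ∀ f ∈ Ψ, f p ≠ 0 := by
  induction Ψ, hΨ using Set.Finite.induction_on generalizing U with
  | empty => obtain ⟨p, hp⟩ := hne; exact ⟨p, hp, by simp⟩
  | @insert f S _ _ ih =>
    obtain ⟨p, hp⟩ := hne
    have : ∃ q ∈ U, f q ≠ 0 := by
      by_contra! hc
      obtain ⟨q, hq⟩ := h f (Set.mem_insert _ _)
      exact hq (eq_zero_of_mem_interior hc (by rwa [hU.interior_eq]) q)
    obtain ⟨q, hq, hf⟩ := this
    have ho : IsOpen (U ∩ {p | f p ≠ 0}) :=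
      hU.inter (isOpen_ne_fun f.continuous_of_finiteDimensional continuous_const)
    obtain ⟨p, h1, h2⟩ := ih (fun g hg => h g (Set.mem_insert_of_mem _ hg)) ho ⟨q, hq, hf⟩
    refine ⟨p, h1.1, ?_⟩
    rintro g (rfl | hg)
    · exact h1.2
    · exact h2 g hg

variable {W : Type*} [AddCommGroup W] [Module ℝ W]

lemma mem_ccone_subtype {N : Submodule ℝ W} {S : Finset W} (hS : ∀ s ∈ S, s ∈ N)
    [DecidablePred (· ∈ N)] (x : N) : x ∈ ccone (S.subtype (· ∈ N)) ↔ (x : W) ∈ ccone S := by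
  classical
  constructor
  · rintro ⟨c, h1, h2⟩
    refine ⟨fun s => if h : s ∈ N then c ⟨s, h⟩ else 0, fun s hs => ?_, ?_⟩
    · simp only [hS s hs, dif_pos]
      exact h1 _ (by simpa using hs)
    · rw [← h2, ← Finset.sum_subtype_of_mem _ hS, Submodule.coe_sum]
      exact Finset.sum_congr rfl fun s _ => by simp
  · rintro ⟨c, h1, h2⟩
    refine ⟨fun s => c s, fun s hs => h1 _ (by simpa using hs), Subtype.ext ?_⟩
    rw [← h2, ← Finset.sum_subtype_of_mem _ hS, Submodule.coe_sum]
    simp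

lemma Irred.subtype [DecidableEq W] {N : Submodule ℝ W} {S : Finset W} (hS : ∀ s ∈ S, s ∈ N)
    [DecidablePred (· ∈ N)] (h : Irred S) : Irred (S.subtype (· ∈ N)) := by
  intro s hs hm
  have e : (S.subtype (· ∈ N)).erase s = (S.erase s.1).subtype (· ∈ N) := by
    ext x
    rw [Finset.mem_erase, Finset.mem_subtype, Finset.mem_subtype, Finset.mem_erase, ne_eq, ne_eq,
      Subtype.ext_iff]
  rw [e, mem_ccone_subtype fun x hx => hS x (Finset.mem_of_mem_erase hx)] at hm
  exact h s.1 (by simpa using hs) hm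

/-- The splitting of a space along the kernel of `f` and a vector `e` with `f e = 1`. -/
def splitE (f : W →ₗ[ℝ] ℝ) (e : W) (he : f e = 1) : W ≃ₗ[ℝ] (LinearMap.ker f × ℝ) where
  toFun p := (⟨p - f p • e, by
    rw [LinearMap.mem_ker, map_sub, map_smul, he, smul_eq_mul, mul_one, sub_self]⟩, f p)
  invFun q := q.1 + q.2 • e
  map_add' p q := by
    refine Prod.ext (Subtype.ext ?_) (map_add f p q)
    change p + q - f (p + q) • e = (p - f p • e) + (q - f q • e)
    rw [map_add]; module
  map_smul' r p := Prod.ext (Subtype.ext (by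
      change r • p - f (r • p) • e = r • (p - f p • e)
      rw [map_smul, smul_eq_mul]; module)) (map_smul f r p)
  left_inv p := by simp
  right_inv q := by
    have h0 : f (q.1 + q.2 • e) = q.2 := by
      rw [map_add, LinearMap.mem_ker.1 q.1.2, map_smul, he, zero_add, smul_eq_mul, mul_one]
    refine Prod.ext (Subtype.ext ?_) h0
    change (q.1 : W) + q.2 • e - f (q.1 + q.2 • e) • e = q.1
    rw [h0, add_sub_cancel_right]

lemma splitE_symm_apply (f : W →ₗ[ℝ] ℝ) (e : W) (he : f e = 1) (q : LinearMap.ker f × ℝ) :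
    (splitE f e he).symm q = q.1 + q.2 • e := rfl

/-- The constraint on `Y` that corresponds to `0 ≤ φ` under the projective map given by `M`. -/
def fn (M : W ≃ₗ[ℝ] Col × ℝ) (φ : Module.Dual ℝ W) : Col →ᵃ[ℝ] ℝ :=
  (φ.comp (M.symm.toLinearMap.comp (LinearMap.inl ℝ Col ℝ))).toAffineMap +
    AffineMap.const ℝ Col (φ (M.symm (0, 1)))

lemma fn_apply (M : W ≃ₗ[ℝ] Col × ℝ) (φ : Module.Dual ℝ W) (Y : Col) :
    fn M φ Y = φ (M.symm (Y, 1)) := by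
  simp [fn, ← map_add]

lemma fn_linear (M : W ≃ₗ[ℝ] Col × ℝ) (φ : Module.Dual ℝ W) (v : Col) :
    (fn M φ).linear v = φ (M.symm (v, 0)) := by
  simp [fn]

/-- The tile that corresponds to the cone cut out by `Φ`. -/
def tile (M : W ≃ₗ[ℝ] Col × ℝ) (Φ : Finset (Module.Dual ℝ W)) : Set Col := poly (fn M '' Φ)

lemma mem_tile {M : W ≃ₗ[ℝ] Col × ℝ} {Φ : Finset (Module.Dual ℝ W)} {Y : Col} :
    Y ∈ tile M Φ ↔ ∀ φ ∈ Φ, 0 ≤ φ (M.symm (Y, 1)) := by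
  simp [tile, poly, fn_apply]

lemma projEq_tile {E : Type*} [AddCommGroup E] [Module ℝ E] {P : Set E}
    {Φ : Finset (Module.Dual ℝ (E × ℝ))} (hP : ∀ p, p ∈ homog P ↔ p ≠ 0 ∧ ∀ φ ∈ Φ, 0 ≤ φ p)
    {M : (E × ℝ) ≃ₗ[ℝ] Col × ℝ} (hM : ∀ p, p ≠ 0 → (∀ φ ∈ Φ, 0 ≤ φ p) → 0 < (M p).2) :
    ProjEq P (tile M Φ) := by
  have : tile M Φ = proj M P := by
    ext Y
    rw [mem_tile, proj, Set.mem_ofPred_eq, hP, and_iff_right]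
    intro h
    rw [LinearEquiv.map_eq_zero_iff] at h
    simpa using congrArg Prod.snd h
  rw [this]
  exact projEq_proj fun p hp => hM p ((hP p).1 hp).1 ((hP p).1 hp).2

end Tiles

section Facets

variable {W : Type*} [AddCommGroup W] [Module ℝ W] [FiniteDimensional ℝ W] [DecidableEq W]
  [DecidableEq (Module.Dual ℝ W)]
  {V : Finset W} {Φ : Finset (Module.Dual ℝ W)} {t : W →ₗ[ℝ] ℝ}

namespace ConePair

variable (h : ConePair V Φ t)

include h

omit [FiniteDimensional ℝ W] in
lemma pos_of_mem {x : W} (hx : ∀ φ ∈ Φ, 0 ≤ φ x) (h0 : x ≠ 0) : 0 < t x := by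
  obtain ⟨c, h1, rfl⟩ := (h.mem_iff x).2 hx
  rw [map_sum]
  have hn : ∀ s ∈ V, 0 ≤ t (c s • s) := fun s hs => by
    rw [map_smul, smul_eq_mul]; exact mul_nonneg (h1 s hs) (h.tpos s hs).le
  refine lt_of_le_of_ne (Finset.sum_nonneg hn) fun e => h0 (Finset.sum_eq_zero fun s hs => ?_)
  have := (Finset.sum_eq_zero_iff_of_nonneg hn).1 e.symm s hs
  rw [map_smul, smul_eq_mul, mul_eq_zero] at this
  rw [this.resolve_right (h.tpos s hs).ne', zero_smul]

lemma exists_ne_zero_of_ne {φ ψ : Module.Dual ℝ W} (hφ : φ ∈ Φ) (hψ : ψ ∈ Φ) (hne : φ ≠ ψ) :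
    ∃ v ∈ V, φ v = 0 ∧ ψ v ≠ 0 := by
  by_contra! hc
  obtain ⟨r, hr⟩ := h.eq_smul_facet hφ hc
  exact h.ne_smul hφ hψ hne r hr

omit [FiniteDimensional ℝ W] in
lemma exists_pos {v : W} (hv : v ∈ V) : ∃ φ ∈ Φ, 0 < φ v := by
  by_contra! hc
  have h1 := h.tpos v hv
  have h2 := h.pos_of_mem (x := -v) (fun φ hφ => by
    rw [map_neg]; linarith [hc φ hφ]) (by
      intro h0
      rw [neg_eq_zero.1 h0, map_zero] at h1
      exact h1.false)
  rw [map_neg] at h2; linarith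

lemma exists_beyond {φ₀ : Module.Dual ℝ W} (hφ₀ : φ₀ ∈ Φ) :
    ∃ e, φ₀ e = 1 ∧ ∀ φ ∈ Φ, φ ≠ φ₀ → φ e < 0 := by
  obtain ⟨o, ho⟩ := h.exists_interior
  set w := ∑ v ∈ V.filter (fun v => φ₀ v = 0), v with hw
  have w0 : φ₀ w = 0 := by
    rw [hw, map_sum]
    exact Finset.sum_eq_zero fun v hv => (Finset.mem_filter.1 hv).2
  have w1 : ∀ φ ∈ Φ, φ ≠ φ₀ → 0 < φ w := fun φ hφ hne => by
    obtain ⟨v, hv, h1, h2⟩ := h.exists_ne_zero_of_ne hφ₀ hφ hne.symm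
    rw [hw, map_sum]
    refine Finset.sum_pos' (fun v hv => h.nonneg (Finset.mem_filter.1 hv).1 hφ)
      ⟨v, Finset.mem_filter.2 ⟨hv, h1⟩, lt_of_le_of_ne (h.nonneg hv hφ) h2.symm⟩
  obtain ⟨ε, hε, hle⟩ := exists_pos_forall_le (Φ.filter fun φ => φ ≠ φ₀) (fun φ => φ w)
    (fun φ => 2 * φ o) (fun φ hφ => w1 φ (Finset.mem_filter.1 hφ).1 (Finset.mem_filter.1 hφ).2)
  have hp := ho φ₀ hφ₀
  refine ⟨(φ₀ o)⁻¹ • (o - ε⁻¹ • w), by simp [w0, hp.ne'], fun φ hφ hne => ?_⟩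
  rw [map_smul, smul_eq_mul]
  refine mul_neg_of_pos_of_neg (inv_pos.2 hp) ?_
  have h1 := hle φ (Finset.mem_filter.2 ⟨hφ, hne⟩)
  have h2 := ho φ hφ
  rw [abs_of_pos (by linarith)] at h1
  rw [map_sub, map_smul, smul_eq_mul, sub_neg, ← div_eq_inv_mul, lt_div_iff₀ hε]
  nlinarith

lemma cellDecomp_facet (hd : Module.finrank ℝ W = 4) {φ₀ : Module.Dual ℝ W} (hφ₀ : φ₀ ∈ Φ)
    (h5 : (V.filter (φ₀ · = 0)).card ≤ 5) :
    CellDecomp {x : LinearMap.ker φ₀ | ∀ φ ∈ Φ, 0 ≤ φ x} := by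
  classical
  have hS : ∀ s ∈ V.filter (φ₀ · = 0), s ∈ LinearMap.ker φ₀ := fun s hs =>
    (Finset.mem_filter.1 hs).2
  have hk : Module.finrank ℝ (LinearMap.ker φ₀) = 3 := by
    have := Module.Dual.finrank_ker_add_one_of_ne_zero (h.facet_ne_zero hφ₀)
    omega
  have hc : ((V.filter (φ₀ · = 0)).subtype (· ∈ LinearMap.ker φ₀)).card =
      (V.filter (φ₀ · = 0)).card := by
    rw [Finset.card_subtype, Finset.filter_true_of_mem hS]
  have h3 := h.card_facet hφ₀
  have := cellDecomp_ccone hk ((h.irredV.mono (Finset.filter_subset _ _)).subtype hS)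
    (t := t.comp (LinearMap.ker φ₀).subtype) (fun g hg => h.tpos _ (by simp at hg; exact hg))
    (by rw [hc]; omega) (by rw [hc]; exact h5)
  convert this using 1
  ext x
  rw [mem_ccone_subtype hS, Set.mem_ofPred_eq, ← h.mem_iff]
  constructor
  · rintro ⟨c, h1, h2⟩
    have hn : ∀ s ∈ V, 0 ≤ φ₀ (c s • s) := fun s hs => by
      rw [map_smul, smul_eq_mul]; exact mul_nonneg (h1 s hs) (h.nonneg hs hφ₀)
    have h4 : φ₀ (∑ s ∈ V, c s • s) = 0 := by rw [h2]; exact x.2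
    rw [map_sum, Finset.sum_eq_zero_iff_of_nonneg hn] at h4
    refine ⟨c, fun s hs => h1 s (Finset.mem_filter.1 hs).1, ?_⟩
    rw [← h2, Finset.sum_filter_of_ne]
    intro s hs hne
    have := h4 s hs
    rw [map_smul, smul_eq_mul, mul_eq_zero] at this
    exact this.resolve_left fun h0 => hne (by rw [h0, zero_smul])
  · exact fun hx => ccone_mono (Finset.filter_subset _ _) hx

end ConePair

end Facets

section Fill

/-- The change of coordinates `((x, y), w), z ↦ ((x, y), z), x + y + w`. -/
def slantE : (Col × ℝ) ≃ₗ[ℝ] (Col × ℝ) where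
  toFun p := ((p.1.1, p.2), p.1.1.1 + p.1.1.2 + p.1.2)
  invFun q := ((q.1.1, q.2 - q.1.1.1 - q.1.1.2), q.1.2)
  map_add' p q := by
    ext <;> simp
    ring
  map_smul' r p := by
    ext <;> simp
    ring
  left_inv p := by
    ext <;> simp
    ring
  right_inv q := by ext <;> simp

/-- The map `Y ↦ X` parametrizing the standard simplex. -/
def simplexMap : Col →ᵃ[ℝ] Col :=
  (LinearMap.prod (LinearMap.fst ℝ (ℝ × ℝ) ℝ) (lin (-1) (-1) 0)).toAffineMap +
    AffineMap.const ℝ Col ((0, 0), 1)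

lemma simplexMap_apply (Y : Col) : simplexMap Y = (Y.1, 1 - Y.1.1 - Y.1.2) := by
  ext <;> simp [simplexMap]
  ring

lemma eq_zero_of_simplexMap {f : Col →ₗ[ℝ] ℝ} (h : ∀ Y, f (simplexMap Y) = 0) : f = 0 := by
  have h1 := h ((1, 0), 0)
  have h2 := h ((0, 1), 0)
  have h3 := h 0
  simp only [simplexMap_apply] at h1 h2 h3
  norm_num at h1 h2 h3
  ext
  · simpa using h1
  · simpa using h2
  · simpa using h3

lemma exists_max_cell {E : Type*} [AddCommGroup E] [Module ℝ E] {K : Set E} {ι : Type} [Finite ι]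
    [Nonempty ι] {g : ι → Col →ₗ[ℝ] ℝ} {κ : ι → E ≃ₗ[ℝ] Col}
    (hK : ∀ j x, x ∈ K ↔ κ j x ∈ oct ∧ ∀ k, g k (κ j x) ≤ g j (κ j x)) {X : Col} (hX : X ∈ oct) :
    ∃ j, (κ j).symm X ∈ K := by
  obtain ⟨j, hj⟩ := Finite.exists_max fun j => g j X
  exact ⟨j, (hK j _).2 (by simpa using ⟨hX, hj⟩)⟩

variable {W : Type*} [AddCommGroup W] [Module ℝ W] [FiniteDimensional ℝ W] [DecidableEq W]
  [DecidableEq (Module.Dual ℝ W)]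
  {V : Finset W} {Φ : Finset (Module.Dual ℝ W)} {t : W →ₗ[ℝ] ℝ}

/-- `S` is the image of the cone cut out by `Φ` under a projective map. -/
def IsTile (Φ : Finset (Module.Dual ℝ W)) (S : Set Col) : Prop :=
  ∃ M : W ≃ₗ[ℝ] Col × ℝ, S = tile M Φ ∧ ∀ p, p ≠ 0 → (∀ φ ∈ Φ, 0 ≤ φ p) → 0 < (M p).2

/-- The coordinates in which the facet `φ = 0` is at the bottom. -/
def bottomE (φ : Module.Dual ℝ W) (e : W) (he : φ e = 1) (κ : LinearMap.ker φ ≃ₗ[ℝ] Col) :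
    W ≃ₗ[ℝ] Col × ℝ :=
  (splitE φ e he).trans ((κ.prodCongr (LinearEquiv.refl ℝ ℝ)).trans slantE)

omit [FiniteDimensional ℝ W] [DecidableEq W] [DecidableEq (Module.Dual ℝ W)] in
lemma bottomE_symm_apply (φ : Module.Dual ℝ W) (e : W) (he : φ e = 1)
    (κ : LinearMap.ker φ ≃ₗ[ℝ] Col) (Y : Col) (s : ℝ) : (bottomE φ e he κ).symm (Y, s) =
      κ.symm (Y.1, s - Y.1.1 - Y.1.2) + Y.2 • e := rfl

namespace ConePair

variable (h : ConePair V Φ t)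

include h

lemma exists_ne (hd : Module.finrank ℝ W = 4) {φ₀ : Module.Dual ℝ W} (hφ₀ : φ₀ ∈ Φ) :
    ∃ φ ∈ Φ, φ ≠ φ₀ := by
  have h1 := h.card_facet hφ₀
  obtain ⟨v, hv⟩ := Finset.card_pos.1 (show 0 < (V.filter (φ₀ · = 0)).card by omega)
  obtain ⟨hv, h0⟩ := Finset.mem_filter.1 hv
  obtain ⟨φ, hφ, hp⟩ := h.exists_pos hv
  exact ⟨φ, hφ, fun e => hp.ne' (by rw [e, h0])⟩

theorem dec_stdCol (hd : Module.finrank ℝ W = 4) (hV : V.Nonempty) :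
    Dec (fun S => IsTile Φ S ∨ ∃ a b c, S = col a b c ∧ Nd a b c ∧
      (0 < a.2 ∨ 0 < b.2 ∨ 0 < c.2)) stdCol := by
  obtain ⟨φ₀, hφ₀, h5⟩ := h.exists_small_facet hd hV
  obtain ⟨e, he, hneg⟩ := h.exists_beyond hφ₀
  obtain ⟨φ₁, hφ₁, hne₁⟩ := h.exists_ne hd hφ₀
  obtain ⟨ι, _, g, κ, hg, hK, j₀, -⟩ := h.cellDecomp_facet hd hφ₀ h5
  have : Nonempty ι := ⟨j₀⟩
  let M : ι → W ≃ₗ[ℝ] Col × ℝ := fun j => bottomE φ₀ e he (κ j)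
  have hM : ∀ j Y, (M j).symm (Y, 1) = (κ j).symm (simplexMap Y) + Y.2 • e := fun j Y => by
    rw [bottomE_symm_apply, simplexMap_apply]
  have hle : ∀ φ ∈ Φ, φ ≠ φ₀ → ∀ x : W, ∀ z : ℝ, 0 ≤ z → 0 ≤ φ (x + z • e) → 0 ≤ φ x :=
    fun φ hφ hn x z hz hx => by
      rw [map_add, map_smul, smul_eq_mul] at hx
      nlinarith [hneg φ hφ hn]
  have hz : ∀ (x : LinearMap.ker φ₀) (z : ℝ), φ₀ (x + z • e) = z := fun x z => by
    rw [map_add, LinearMap.mem_ker.1 x.2, map_smul, he, smul_eq_mul, mul_one, zero_add]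
  have hmem : ∀ (x : LinearMap.ker φ₀) (z : ℝ), (∀ φ ∈ Φ, 0 ≤ φ (x + z • e)) →
      0 ≤ z ∧ ∀ φ ∈ Φ, 0 ≤ φ x := fun x z hx => by
    have h1 : 0 ≤ z := by simpa [hz] using hx φ₀ hφ₀
    refine ⟨h1, fun φ hφ => ?_⟩
    by_cases hn : φ = φ₀
    · rw [hn, LinearMap.mem_ker.1 x.2]
    · exact hle φ hφ hn _ z h1 (hx φ hφ)
  have hcell : ∀ j Y, Y ∈ tile (M j) Φ → 0 ≤ Y.2 ∧ simplexMap Y ∈ oct ∧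
      ∀ k, g k (simplexMap Y) ≤ g j (simplexMap Y) := fun j Y hY => by
    rw [mem_tile] at hY
    simp only [hM] at hY
    obtain ⟨h1, h2⟩ := hmem _ _ hY
    exact ⟨h1, by simpa using (hK j _).1 h2⟩
  have hstd : ∀ j, tile (M j) Φ ⊆ stdCol := fun j Y hY => by
    obtain ⟨h1, h2, -⟩ := hcell j Y hY
    rw [simplexMap_apply] at h2
    exact ⟨h2.1, h2.2.1, by linarith [h2.2.2], h1⟩
  have key := dec_remainder (G := fun j => fn (M j) '' Φ) nd_std
    (fun j => Φ.finite_toSet.image _) (fun j => by rw [← stdCol_eq]; exact hstd j)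
    (fun j => ⟨_, ⟨φ₁, hφ₁, rfl⟩, by
      rw [fn_linear, bottomE_symm_apply]
      have e1 : (ez.1, 0 - ez.1.1 - ez.1.2) = (0 : Col) := by simp [ez]
      rw [e1, map_zero, Submodule.coe_zero, zero_add, ez, one_smul]
      exact hneg φ₁ hφ₁ hne₁⟩)
    (fun j p s hs hp hpc => ⟨j, by
      rw [← stdCol_eq] at hpc
      change _ ∈ tile (M j) Φ at hp
      change _ ∈ tile (M j) Φ
      rw [mem_tile] at hp ⊢
      have e1 : simplexMap (p + s • ez) = simplexMap p := by simp [simplexMap_apply, ez]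
      have e2 : (p + s • ez).2 = p.2 + s := by simp [ez]
      simp only [hM, e1, e2, add_smul, ← add_assoc] at hp
      intro φ hφ
      rw [hM]
      by_cases hn : φ = φ₀
      · rw [hn, hz]; exact hpc.2.2.2
      · exact hle φ hφ hn _ s hs (hp φ hφ)⟩)
    (fun i j hij => by
      rw [← interior_inter, Set.eq_empty_iff_forall_notMem]
      intro p hp
      refine hij (hg (sub_eq_zero.1 (eq_zero_of_simplexMap fun Y => ?_)))
      refine eq_zero_of_mem_interior (f := (g i - g j).toAffineMap.comp simplexMap)
        (fun q hq => ?_) hp Y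
      have h1 := (hcell i q hq.1).2.2 j
      have h2 := (hcell j q hq.2).2.2 i
      simp only [AffineMap.comp_apply, LinearMap.coe_toAffineMap, LinearMap.sub_apply]
      linarith)
  rw [← stdCol_eq] at key
  refine key.mono fun S hS hQ => ?_
  obtain ⟨j, rfl⟩ | ⟨a, b, c, rfl, n, hdisj⟩ := hQ
  · refine Or.inl ⟨M j, rfl, fun p hp hpΦ => ?_⟩
    obtain ⟨q, rfl⟩ := (splitE φ₀ e he).symm.surjective p
    rw [splitE_symm_apply] at hpΦ
    obtain ⟨h1, h2⟩ := hmem _ _ hpΦ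
    obtain ⟨⟨o1, o2, o3⟩, -⟩ := (hK j _).1 h2
    have e1 : (M j ((splitE φ₀ e he).symm q)).2 =
        (κ j q.1).1.1 + (κ j q.1).1.2 + (κ j q.1).2 := by
      simp [M, bottomE, slantE]
    rw [e1]
    by_contra hc
    have hk : κ j q.1 = 0 := by
      ext <;> simp <;> linarith
    rw [LinearEquiv.map_eq_zero_iff] at hk
    have h4 := hpΦ φ₁ hφ₁
    rw [hk, Submodule.coe_zero, zero_add, map_smul, smul_eq_mul] at h4
    have h5 : q.2 = 0 := by nlinarith [hneg φ₁ hφ₁ hne₁]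
    exact hp (by rw [splitE_symm_apply, hk, h5]; simp)
  · refine Or.inr ⟨a, b, c, rfl, n, ?_⟩
    by_contra! hc
    have ha := hS (left_mem_col a b c)
    have hb := hS (by rw [← col_perm]; exact left_mem_col b c a)
    have hc' := hS (by rw [← col_perm, ← col_perm]; exact left_mem_col c a b)
    have ha0 : a.2 = 0 := le_antisymm hc.1 ha.2.2.2
    have hb0 : b.2 = 0 := le_antisymm hc.2.1 hb.2.2.2
    have hc0 : c.2 = 0 := le_antisymm hc.2.2 hc'.2.2.2
    obtain ⟨p, hp, hav⟩ := exists_avoid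
      (Ψ := (fun q : ι × Module.Dual ℝ W =>
        ((q.2.comp (LinearMap.ker φ₀).subtype).comp
          (κ q.1).symm.toLinearMap).toAffineMap.comp simplexMap) ''
          (Set.univ ×ˢ ((Φ.erase φ₀ : Finset _) : Set (Module.Dual ℝ W))))
      ((Set.finite_univ.prod (Finset.finite_toSet _)).image _) (by
        rintro _ ⟨⟨j, φ⟩, ⟨-, hφ⟩, rfl⟩
        obtain ⟨hn, hφ⟩ := Finset.mem_erase.1 hφ
        obtain ⟨v, hv, h1, h2⟩ := h.exists_ne_zero_of_ne hφ₀ hφ hn.symm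
        by_contra! h3
        have h4 := eq_zero_of_simplexMap (f := (φ.comp (LinearMap.ker φ₀).subtype).comp
          (κ j).symm.toLinearMap) h3
        have h5 := LinearMap.congr_fun h4 (κ j ⟨v, h1⟩)
        simp at h5
        exact h2 h5) (isOpen_colO n) (colO_nonempty a b c)
    obtain ⟨x, y, z, h1, h2, h3, h4, rfl⟩ := mem_colO.1 hp
    have hbase := hS (mem_col.2 ⟨x, y, z, h1.le, h2.le, h3.le, h4.le, rfl⟩)
    set p := a + (x • (b - a) + y • (c - a) + z • ez) with hpdef
    obtain ⟨j, hj⟩ := exists_max_cell hK (X := simplexMap p) (by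
      rw [simplexMap_apply]
      exact ⟨hbase.1, hbase.2.1, by simp only; linarith [hbase.2.2.1]⟩)
    obtain ⟨ε, hε, hεle⟩ := exists_pos_forall_le (Φ.erase φ₀)
      (fun φ => φ ((κ j).symm (simplexMap p))) (fun φ => φ e) (fun φ hφ =>
        lt_of_le_of_ne (hj φ (Finset.mem_erase.1 hφ).2)
          (hav _ ⟨(j, φ), ⟨Set.mem_univ _, hφ⟩, rfl⟩).symm)
    refine Set.eq_empty_iff_forall_notMem.1 (hdisj j)
      (a + (x • (b - a) + y • (c - a) + ε • ez))
      ⟨mem_colO.2 ⟨x, y, ε, h1, h2, h3, hε, rfl⟩, ?_⟩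
    change _ ∈ tile (M j) Φ
    rw [mem_tile]
    have e1 : simplexMap (a + (x • (b - a) + y • (c - a) + ε • ez)) = simplexMap p := by
      simp [simplexMap_apply, ez, hpdef]
    have e2 : (a + (x • (b - a) + y • (c - a) + ε • ez)).2 = ε := by
      simp [ez, ha0, hb0, hc0]
    intro φ hφ
    rw [hM, e1, e2]
    by_cases hn : φ = φ₀
    · rw [hn, hz]; exact hε.le
    · have := hεle φ (Finset.mem_erase.2 ⟨hn, hφ⟩)
      rw [map_add, map_smul, smul_eq_mul]
      nlinarith [abs_of_neg (hneg φ hφ hn)]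

end ConePair

end Fill

section Shear

lemma cellDecomp_dual {N : Type*} [AddCommGroup N] [Module ℝ N] [FiniteDimensional ℝ N]
    (hN : Module.finrank ℝ N = 3) (Φ : Finset (Module.Dual ℝ N)) (h5 : Φ.card ≤ 5)
    (ho : ∃ o, ∀ φ ∈ Φ, 0 < φ o) (h0 : ∀ x, (∀ φ ∈ Φ, φ x = 0) → x = 0) :
    CellDecomp {x : N | ∀ φ ∈ Φ, 0 ≤ φ x} := by
  classical
  obtain ⟨o, ho⟩ := ho
  obtain ⟨S, hS⟩ := exists_generators Φ
  obtain ⟨T, -, hc, hT⟩ := exists_irred S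
  obtain ⟨Ψ, hΨ, hcΨ, hIΨ⟩ := exists_irred Φ
  have hmem : ∀ x, x ∈ ccone T ↔ ∀ φ ∈ Φ, 0 ≤ φ x := fun x => by rw [hc, hS]
  have hpos : ∀ g ∈ T, 0 < (∑ φ ∈ Φ, φ) g := fun g hg => by
    have hn := (hmem g).1 (mem_ccone_of_mem hg)
    rw [LinearMap.sum_apply]
    refine lt_of_le_of_ne (Finset.sum_nonneg hn) fun e => ?_
    have := h0 g ((Finset.sum_eq_zero_iff_of_nonneg hn).1 e.symm)
    exact hT g hg (by rw [this]; exact zero_mem_ccone _)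
  have hp : ConePair T Ψ (∑ φ ∈ Φ, φ) :=
    { irredV := hT
      irredΦ := hIΨ
      mem_iff := fun x => by
        rw [hmem]
        refine ⟨fun hx φ hφ => hx φ (hΨ hφ), fun hx φ hφ => ?_⟩
        exact nonneg_of_mem_ccone (φ := Module.Dual.eval ℝ N x) hx
          (by rw [hcΨ]; exact mem_ccone_of_mem hφ)
      tpos := hpos
      exists_interior := ⟨o, fun φ hφ => ho φ (hΨ hφ)⟩ }
  have h3 : 3 ≤ T.card := by
    by_contra! hlt
    have h1 := (finrank_span_finset_le_card (R := ℝ) T).trans_lt hlt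
    have h2 : Submodule.span ℝ (T : Set N) < ⊤ := lt_top_iff_ne_top.2 fun e => by
      rw [Set.finrank, e, finrank_top] at h1
      omega
    obtain ⟨f, hf, hle⟩ := Submodule.exists_le_ker_of_lt_top _ h2
    have hfT : ∀ x ∈ ccone T, f x = 0 := by
      rintro x ⟨c, -, rfl⟩
      rw [map_sum]
      exact Finset.sum_eq_zero fun s hs => by
        rw [map_smul, LinearMap.mem_ker.1 (hle (Submodule.subset_span hs)), smul_zero]
    refine hf (LinearMap.ext fun x => ?_)
    obtain ⟨ε, hε, hεle⟩ := exists_pos_forall_le Φ (fun φ => φ o) (fun φ => φ x) ho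
    have e1 := hfT o ((hmem _).2 fun φ hφ => (ho φ hφ).le)
    have e2 := hfT (o + ε • x) ((hmem _).2 fun φ hφ => by
      rw [map_add, map_smul, smul_eq_mul]
      nlinarith [hεle φ hφ, neg_abs_le (φ x)])
    rw [map_add, map_smul, e1, zero_add, smul_eq_zero] at e2
    exact e2.resolve_left hε.ne'
  have := cellDecomp_ccone hN hT hpos h3
    ((hp.card_le_card hN).trans ((Finset.card_le_card hΨ).trans h5))
  convert this using 1
  ext x
  exact (hmem x).symm

namespace ConePair

variable {W : Type*} [AddCommGroup W] [Module ℝ W] [FiniteDimensional ℝ W] [DecidableEq W]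
  [DecidableEq (Module.Dual ℝ W)]
  {V : Finset W} {Φ : Finset (Module.Dual ℝ W)} {t : W →ₗ[ℝ] ℝ}

lemma cellDecomp_vertex (h : ConePair V Φ t) (hd : Module.finrank ℝ W = 4) {v : W} (hv : v ∈ V)
    (h5 : (Φ.filter (· v = 0)).card ≤ 5) {f : Module.Dual ℝ W} (hf : f v = 1) :
    CellDecomp {x : LinearMap.ker f | ∀ φ ∈ Φ, φ v = 0 → 0 ≤ φ x} := by
  classical
  have hf0 : f ≠ 0 := by rintro rfl; simp at hf
  have hk : Module.finrank ℝ (LinearMap.ker f) = 3 := by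
    have := Module.Dual.finrank_ker_add_one_of_ne_zero hf0
    omega
  have key := cellDecomp_dual hk
    ((Φ.filter (· v = 0)).image fun φ => φ.comp (LinearMap.ker f).subtype)
    (Finset.card_image_le.trans h5) (by
      obtain ⟨o, ho⟩ := h.exists_interior
      refine ⟨⟨o - f o • v, by
        rw [LinearMap.mem_ker, map_sub, map_smul, hf, smul_eq_mul, mul_one, sub_self]⟩, ?_⟩
      intro ψ hψ
      obtain ⟨φ, hφ, rfl⟩ := Finset.mem_image.1 hψ
      obtain ⟨hφ, h0⟩ := Finset.mem_filter.1 hφ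
      simpa [h0] using ho φ hφ) (by
      intro x hx
      obtain ⟨r, hr⟩ := h.eq_smul_vertex (x := (x : W)) hv fun φ hφ h0 =>
        hx _ (Finset.mem_image.2 ⟨φ, Finset.mem_filter.2 ⟨hφ, h0⟩, rfl⟩)
      have h1 := LinearMap.mem_ker.1 x.2
      rw [hr, map_smul, hf, smul_eq_mul, mul_one] at h1
      exact Subtype.ext (by rw [hr, h1, zero_smul]; rfl))
  convert key using 1
  ext x
  simp only [Set.mem_ofPred_eq, Finset.forall_mem_image, Finset.mem_filter, and_imp]
  rfl

end ConePair

lemma exists_bound {ι : Type*} [Finite ι] (n : ι → Col →ₗ[ℝ] ℝ) :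
    ∃ B : ℝ, 0 ≤ B ∧ ∀ i, ∀ Y ∈ oct, |n i Y| ≤ B * (Y.1.1 + Y.1.2 + Y.2) := by
  obtain ⟨B, hB⟩ := (Set.finite_range fun i =>
    |n i ((1, 0), 0)| + |n i ((0, 1), 0)| + |n i ((0, 0), 1)|).bddAbove
  refine ⟨max B 0, le_max_right _ _, fun i Y hY => ?_⟩
  have h1 := hB ⟨i, rfl⟩
  have h2 := le_max_left B 0
  have e : Y = Y.1.1 • ((1, 0), 0) + Y.1.2 • ((0, 1), 0) + Y.2 • ((0, 0), 1) := by
    ext <;> simp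
  obtain ⟨o1, o2, o3⟩ := hY
  have a1 := abs_nonneg (n i ((1, 0), 0))
  have a2 := abs_nonneg (n i ((0, 1), 0))
  have a3 := abs_nonneg (n i ((0, 0), 1))
  conv_lhs => rw [e]
  rw [map_add, map_add, map_smul, map_smul, map_smul]
  refine (abs_add_three _ _ _).trans ?_
  simp only [smul_eq_mul, abs_mul, abs_of_nonneg o1, abs_of_nonneg o2, abs_of_nonneg o3]
  simp only at h1
  nlinarith

/-- Given the cells of the octant and linear forms on each of them, there are shears such that the
truncated cells form a body close to a column below the first axis and closed under moving down. -/
lemma exists_cell_shears {ι κ : Type*} [Finite ι] [Finite κ] [Nonempty κ]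
    (g : ι → Col →ₗ[ℝ] ℝ) {j₀ : ι}
    (hj₀ : ∀ k, k ≠ j₀ → g k ((1, 0), 0) < g j₀ ((1, 0), 0)) (n : ι → κ → Col →ₗ[ℝ] ℝ) :
    ∃ (l : ι → Col →ₗ[ℝ] ℝ) (α : ℝ), 0 < α ∧ (∀ j, ∀ Y ∈ oct, 0 ≤ l j Y) ∧
      (∀ j φ, 0 < n j φ ez + l j ez) ∧
      (∀ j k φ, ∀ Y ∈ oct, g k ez < g j ez → n k φ Y + l k Y ≤ n j φ Y + l j Y) ∧
      (∀ j, ∀ Y ∈ oct, (∀ k, g k Y ≤ g j Y) → (∀ φ, n j φ Y + l j Y ≤ 1) →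
        α * Y.1.1 + Y.1.2 ≤ 1) ∧
      ∀ φ, n j₀ φ ((1, 0), 0) + l j₀ ((1, 0), 0) ≤ α := by
  classical
  obtain ⟨B, hB, hn⟩ := exists_bound fun q : ι × κ => n q.1 q.2
  replace hn : ∀ j φ, ∀ Y ∈ oct, |n j φ Y| ≤ B * (Y.1.1 + Y.1.2 + Y.2) := fun j φ => hn (j, φ)
  let R : ι → Set ι := fun j => {k | g k ez < g j ez}
  let lam : ι → ℝ := fun j => B + 1 + 2 * B * (R j).ncard
  have hlam : ∀ j, B + 1 ≤ lam j := fun j => by simp only [lam]; nlinarith [hB, (Nat.cast_nonneg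
    (R j).ncard : (0 : ℝ) ≤ _)]
  have hlam2 : ∀ j k, g k ez < g j ez → lam k + 2 * B ≤ lam j := fun j k hjk => by
    have h1 : (R k).ncard < (R j).ncard := Set.ncard_lt_ncard
      ⟨fun i hi => lt_trans hi hjk, fun hs => lt_irrefl (g k ez) (hs hjk)⟩ (Set.toFinite _)
    have h2 : ((R k).ncard : ℝ) + 1 ≤ (R j).ncard := by exact_mod_cast h1
    simp only [lam]
    nlinarith
  obtain ⟨φ₀, hφ₀⟩ := Finite.exists_max fun φ => n j₀ φ ((1, 0), 0)
  set α := n j₀ φ₀ ((1, 0), 0) + lam j₀ with hα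
  have o1 : (((1, 0), 0) : Col) ∈ oct := ⟨by simp, by simp, by simp⟩
  have hα1 : 1 ≤ α := by
    have := neg_le_of_abs_le (hn j₀ φ₀ _ o1)
    simp only [add_zero, mul_one] at this
    linarith [hlam j₀]
  obtain ⟨B', hB', hg⟩ := exists_bound fun j => g j - g j₀
  obtain ⟨δ, hδ, hδg⟩ : ∃ δ : ℝ, 0 < δ ∧ ∀ k, k ≠ j₀ →
      δ ≤ g j₀ ((1, 0), 0) - g k ((1, 0), 0) := by
    have := Fintype.ofFinite ι
    obtain ⟨δ, hδ, hle⟩ := exists_pos_forall_le (Finset.univ.filter (· ≠ j₀))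
      (fun k => g j₀ ((1, 0), 0) - g k ((1, 0), 0)) (fun _ => 1)
      (fun k hk => sub_pos.2 (hj₀ k (Finset.mem_filter.1 hk).2))
    exact ⟨δ, hδ, fun k hk => by simpa using hle k (by simpa using hk)⟩
  set μ := α * (B' / δ) + 1 with hμ
  have hμ1 : 0 ≤ α * (B' / δ) := mul_nonneg (by linarith) (div_nonneg hB' hδ.le)
  refine ⟨fun j => lin (lam j) (lam j + μ) (lam j + μ), α, by linarith, fun j Y hY => ?_,
    fun j φ => ?_, fun j k φ Y hY hjk => ?_, fun j Y hY hc hφ => ?_, fun φ => ?_⟩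
  · obtain ⟨h1, h2, h3⟩ := hY
    have := hlam j
    rw [lin_apply]
    have : 0 ≤ lam j := by linarith
    have : 0 ≤ lam j + μ := by linarith
    positivity
  · have := neg_le_of_abs_le (hn j φ ez ⟨by simp [ez], by simp [ez], by simp [ez]⟩)
    simp only [ez, lin_apply] at this ⊢
    linarith [hlam j]
  · have h1 := le_of_abs_le (hn k φ Y hY)
    have h2 := neg_le_of_abs_le (hn j φ Y hY)
    have h3 := hlam2 j k hjk
    obtain ⟨o1, o2, o3⟩ := hY
    have h4 := mul_le_mul_of_nonneg_right h3 (by linarith : 0 ≤ Y.1.1 + Y.1.2 + Y.2)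
    simp only [lin_apply]
    nlinarith
  · by_cases hj : j = j₀
    · subst hj
      have h1 := hφ φ₀
      have e : Y = Y.1.1 • ((1, 0), 0) + ((0, Y.1.2), Y.2) := by ext <;> simp
      have h2 := neg_le_of_abs_le (hn j φ₀ ((0, Y.1.2), Y.2) ⟨le_rfl, hY.2.1, hY.2.2⟩)
      have h3 : n j φ₀ Y = Y.1.1 * n j φ₀ ((1, 0), 0) + n j φ₀ ((0, Y.1.2), Y.2) := by
        conv_lhs => rw [e]
        rw [map_add, map_smul, smul_eq_mul]
      rw [h3, lin_apply] at h1
      obtain ⟨o1, o2, o3⟩ := hY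
      have h4 := mul_le_mul_of_nonneg_right (hlam j) (by linarith : 0 ≤ Y.1.2 + Y.2)
      have h5 : 0 ≤ μ * (Y.1.2 + Y.2) := mul_nonneg (by linarith) (by linarith)
      simp only at h2
      rw [hα]
      nlinarith
    · have e : Y = Y.1.1 • ((1, 0), 0) + ((0, Y.1.2), Y.2) := by ext <;> simp
      have h1 := hc j₀
      have h2 := le_of_abs_le (hg j ((0, Y.1.2), Y.2) ⟨le_rfl, hY.2.1, hY.2.2⟩)
      have h3 : ∀ k, g k Y = Y.1.1 * g k ((1, 0), 0) + g k ((0, Y.1.2), Y.2) := fun k => by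
        conv_lhs => rw [e]
        rw [map_add, map_smul, smul_eq_mul]
      rw [h3, h3] at h1
      simp only [LinearMap.sub_apply] at h2
      have h5 := hφ φ₀
      have h6 := neg_le_of_abs_le (hn j φ₀ Y hY)
      obtain ⟨o1, o2, o3⟩ := hY
      have h4 : Y.1.1 ≤ B' / δ * (Y.1.2 + Y.2) := by
        rw [div_mul_eq_mul_div, le_div_iff₀ hδ]
        nlinarith [hδg j hj]
      have h7 := mul_le_mul_of_nonneg_right (hlam j) (by linarith : 0 ≤ Y.1.1 + Y.1.2 + Y.2)
      have h8 := mul_le_mul_of_nonneg_left h4 (by linarith : 0 ≤ α)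
      rw [lin_apply] at h5
      rw [hμ] at h5
      nlinarith
  · rw [lin_apply, hα]
    have := hφ₀ φ
    simp only at this ⊢
    linarith

end Shear

section Corner

lemma colO_perm (a b c : Col) : colO b c a = colO a b c := by
  ext p
  simp only [mem_colO]
  constructor
  · rintro ⟨x, y, z, h1, h2, h3, h4, rfl⟩
    exact ⟨1 - x - y, x, z, by linarith, h1, by linarith, h4, by module⟩
  · rintro ⟨x, y, z, h1, h2, h3, h4, rfl⟩
    exact ⟨y, 1 - x - y, z, h2, by linarith, by linarith, h4, by module⟩

lemma colO_subset_col (a b c : Col) : colO a b c ⊆ col a b c := fun p hp => by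
  obtain ⟨x, y, z, h1, h2, h3, h4, rfl⟩ := mem_colO.1 hp
  exact mem_col.2 ⟨x, y, z, h1.le, h2.le, h3.le, h4.le, rfl⟩

/-- An open column contains points near its first vertex in a fixed direction. -/
lemma exists_direction (a b c : Col) :
    ∃ d : Col, ∀ r : ℝ, 0 < r → r ≤ 1 → a + r • d ∈ colO a b c := by
  refine ⟨(1 / 3 : ℝ) • (b - a) + (1 / 3 : ℝ) • (c - a) + (1 : ℝ) • ez, fun r hr h1 => ?_⟩
  exact mem_colO.2 ⟨r / 3, r / 3, r, by positivity, by positivity, by linarith, hr, by module⟩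

lemma exists_small_forall_lt {κ : Type*} (I : Finset κ) (F : κ → Col →ₗ[ℝ] ℝ) (b : κ → ℝ)
    (a d : Col) (h : ∀ i ∈ I, F i a < b i) :
    ∃ ε : ℝ, 0 < ε ∧ ∀ r, 0 ≤ r → r ≤ ε → ∀ i ∈ I, F i (a + r • d) < b i := by
  obtain ⟨ε, hε, hle⟩ := exists_pos_forall_le I (fun i => (b i - F i a) / 2) (fun i => F i d)
    (fun i hi => by linarith [h i hi])
  refine ⟨ε, hε, fun r hr hrε i hi => ?_⟩
  have h1 := hle i hi
  have h2 := mul_le_mul_of_nonneg_right hrε (abs_nonneg (F i d))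
  have h3 := mul_le_mul_of_nonneg_left (le_abs_self (F i d)) hr
  rw [map_add, map_smul, smul_eq_mul]
  linarith [h i hi]

/-- Near a point of the first axis, the segment in a direction of the octant lies in one cell. -/
lemma exists_cell_near {ι : Type} [Finite ι] {g : ι → Col →ₗ[ℝ] ℝ} {j₀ : ι}
    (hj₀ : ∀ k, k ≠ j₀ → g k ((1, 0), 0) < g j₀ ((1, 0), 0)) {τ : ℝ} (hτ : 0 ≤ τ) (d : Col) :
    ∃ j, (j = j₀ ∨ τ = 0) ∧ ∃ ε : ℝ, 0 < ε ∧ ∀ r, 0 ≤ r → r ≤ ε →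
      ∀ k, g k (τ • ((1, 0), 0) + r • d) ≤ g j (τ • ((1, 0), 0) + r • d) := by
  classical
  have := Fintype.ofFinite ι
  obtain h0 | h0 := hτ.eq_or_lt
  · have : Nonempty ι := ⟨j₀⟩
    obtain ⟨j, hj⟩ := Finite.exists_max fun j => g j d
    refine ⟨j, Or.inr h0.symm, 1, one_pos, fun r hr _ k => ?_⟩
    rw [← h0, zero_smul, zero_add, map_smul, map_smul]
    exact smul_le_smul_of_nonneg_left (hj k) hr
  · obtain ⟨ε, hε, hle⟩ := exists_small_forall_lt (Finset.univ.filter (· ≠ j₀))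
      (fun k => g k - g j₀) 0 (τ • ((1, 0), 0)) d (fun k hk => by
        have := hj₀ k (Finset.mem_filter.1 hk).2
        rw [map_smul, LinearMap.sub_apply, smul_eq_mul]
        exact mul_neg_of_pos_of_neg h0 (sub_neg.2 this))
    refine ⟨j₀, Or.inl rfl, ε, hε, fun r hr hrε k => ?_⟩
    by_cases hk : k = j₀
    · rw [hk]
    · have := hle r hr hrε k (by simpa using hk)
      rw [LinearMap.sub_apply] at this
      simp only [Pi.zero_apply] at this
      linarith

variable {W : Type*} [AddCommGroup W] [Module ℝ W] [FiniteDimensional ℝ W] [DecidableEq W]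
  [DecidableEq (Module.Dual ℝ W)]
  {V : Finset W} {Φ : Finset (Module.Dual ℝ W)} {t : W →ₗ[ℝ] ℝ}

/-- The shear `(Y, s) ↦ (Y, s + l Y)`. -/
def shearE (l : Col →ₗ[ℝ] ℝ) : (Col × ℝ) ≃ₗ[ℝ] (Col × ℝ) where
  toFun p := (p.1, p.2 + l p.1)
  invFun p := (p.1, p.2 - l p.1)
  map_add' p q := Prod.ext rfl (by simp; ring)
  map_smul' r p := Prod.ext rfl (by simp; ring)
  left_inv p := by simp
  right_inv p := by simp

/-- The coordinates in which the vertex `e` is at infinity. -/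
def vertexE (f : Module.Dual ℝ W) (e : W) (he : f e = 1) (κ : LinearMap.ker f ≃ₗ[ℝ] Col)
    (l : Col →ₗ[ℝ] ℝ) : W ≃ₗ[ℝ] Col × ℝ :=
  (splitE f e he).trans ((κ.prodCongr (LinearEquiv.refl ℝ ℝ)).trans (shearE l))

omit [FiniteDimensional ℝ W] [DecidableEq W] [DecidableEq (Module.Dual ℝ W)] in
lemma vertexE_symm_apply (f : Module.Dual ℝ W) (e : W) (he : f e = 1)
    (κ : LinearMap.ker f ≃ₗ[ℝ] Col) (l : Col →ₗ[ℝ] ℝ) (Y : Col) (s : ℝ) :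
    (vertexE f e he κ l).symm (Y, s) = κ.symm Y + (s - l Y) • e := rfl

namespace ConePair

theorem dec_corner (h : ConePair V Φ t) (hd : Module.finrank ℝ W = 4) (hV : V.Nonempty) :
    ∃ α : ℝ, 0 < α ∧ Dec (fun S => IsTile Φ S ∨ ∃ a b c, S = col a b c ∧ Nd a b c ∧
      ∀ τ : ℝ, 0 ≤ τ → τ * α < 1 → a ≠ τ • ((1, 0), 0) ∧ b ≠ τ • ((1, 0), 0) ∧
        c ≠ τ • ((1, 0), 0)) (col 0 ((α⁻¹, 0), 0) ((0, 1), 0)) := by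
  obtain ⟨v, hv, h5⟩ := h.exists_small_vertex hd hV
  obtain ⟨f, hf, hft⟩ : ∃ f : Module.Dual ℝ W, f v = 1 ∧ ∀ x, 0 < t x → 0 < f x := by
    have := h.tpos v hv
    refine ⟨(t v)⁻¹ • t, by simp [this.ne'], fun x hx => ?_⟩
    rw [LinearMap.smul_apply, smul_eq_mul]
    positivity
  obtain ⟨ι, _, g, κ, hg, hK, j₀, hj₀⟩ := h.cellDecomp_vertex hd hv h5 hf
  let Ψ := {φ : Module.Dual ℝ W // φ ∈ Φ ∧ 0 < φ v}
  let n : ι → Ψ → Col →ₗ[ℝ] ℝ := fun j φ =>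
    (-(φ.1 v)⁻¹) • ((φ.1.comp (LinearMap.ker f).subtype).comp (κ j).symm.toLinearMap)
  have hn : ∀ j φ Y, n j φ Y * φ.1 v = -φ.1 ((κ j).symm Y) := fun j φ Y => by
    have := φ.2.2.ne'
    simp [n]
    field_simp
  have : Finite Ψ := Finite.Set.subset (Φ : Set (Module.Dual ℝ W)) fun φ hφ => hφ.1
  have : Nonempty Ψ := by
    obtain ⟨φ, h1, h2⟩ := h.exists_pos hv
    exact ⟨⟨φ, h1, h2⟩⟩
  have : Nonempty ι := ⟨j₀⟩
  obtain ⟨l, α, hα, hl, hez, hlt, hin, hax⟩ := exists_cell_shears g hj₀ n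
  let M : ι → W ≃ₗ[ℝ] Col × ℝ := fun j => vertexE f v hf (κ j) (l j)
  have hval : ∀ j (φ : Ψ) Y, φ.1 ((M j).symm (Y, 1)) = φ.1 v * (1 - (n j φ Y + l j Y)) :=
    fun j φ Y => by
      rw [vertexE_symm_apply, map_add, map_smul, smul_eq_mul]
      linarith [hn j φ Y]
  have hmem : ∀ j Y, Y ∈ tile (M j) Φ ↔ (Y ∈ oct ∧ ∀ k, g k Y ≤ g j Y) ∧
      ∀ φ, n j φ Y + l j Y ≤ 1 := fun j Y => by
    have hKj := hK j ((κ j).symm Y)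
    rw [LinearEquiv.apply_symm_apply] at hKj
    rw [mem_tile, ← hKj]
    constructor
    · refine fun hY => ⟨fun φ hφ h0 => ?_, fun φ => ?_⟩
      · simpa [M, vertexE_symm_apply, h0] using hY φ hφ
      · have h1 := hY φ.1 φ.2.1
        rw [hval] at h1
        linarith [nonneg_of_mul_nonneg_right h1 φ.2.2]
    · rintro ⟨h1, h2⟩ φ hφ
      obtain h0 | h0 := (h.nonneg hv hφ).eq_or_lt
      · simpa [M, vertexE_symm_apply, ← h0] using h1 φ hφ h0.symm
      · rw [hval j ⟨φ, hφ, h0⟩]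
        exact mul_nonneg h0.le (by linarith [h2 ⟨φ, hφ, h0⟩])
  have hcol : ∀ Y : Col, Y ∈ col 0 ((α⁻¹, 0), 0) ((0, 1), 0) ↔ Y ∈ oct ∧ α * Y.1.1 + Y.1.2 ≤ 1 := by
    intro Y
    rw [mem_col]
    constructor
    · rintro ⟨x, y, z, h1, h2, h3, h4, rfl⟩
      have : 0 ≤ x * α⁻¹ := by positivity
      refine ⟨⟨by simpa [ez] using this, by simpa [ez] using h2, by simpa [ez] using h4⟩, ?_⟩
      have e : α * (x * α⁻¹) = x := by field_simp
      simpa [ez, e] using h3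
    · rintro ⟨⟨h1, h2, h3⟩, h4⟩
      refine ⟨α * Y.1.1, Y.1.2, Y.2, mul_nonneg hα.le h1, h2, h4, h3, ?_⟩
      have e : α * Y.1.1 * α⁻¹ = Y.1.1 := by field_simp
      ext <;> simp [ez, e]
  have hnd : Nd 0 ((α⁻¹, 0), 0) ((0, 1), 0) := by
    rw [nd_iff]
    intro x y z e
    simpa [ez, Prod.ext_iff, and_assoc, hα.ne'] using e
  have key := dec_remainder (G := fun j => fn (M j) '' Φ) hnd
    (fun j => Φ.finite_toSet.image _)
    (fun j Y hY => by
      have h1 := (hmem j Y).1 hY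
      exact (hcol Y).2 ⟨h1.1.1, hin j Y h1.1.1 h1.1.2 h1.2⟩)
    (fun j => by
      obtain ⟨φ⟩ := (inferInstance : Nonempty Ψ)
      refine ⟨_, ⟨φ.1, φ.2.1, rfl⟩, ?_⟩
      rw [fn_linear, vertexE_symm_apply, map_add, map_smul, smul_eq_mul]
      have h1 := hn j φ ez
      nlinarith [mul_pos (hez j φ) φ.2.2])
    (fun j p s hs hp hpc => by
      obtain ⟨⟨-, h1⟩, h2⟩ := (hmem j _).1 hp
      obtain ⟨ho, -⟩ := (hcol p).1 hpc
      have h3 : ∀ φ, n j φ p + l j p ≤ 1 := fun φ => by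
        have h4 := h2 φ
        rw [map_add, map_add, map_smul, map_smul, smul_eq_mul, smul_eq_mul] at h4
        nlinarith [mul_nonneg hs (hez j φ).le]
      obtain ⟨k, hk⟩ := Finite.exists_max fun j => g j p
      obtain h4 | h4 := (hk j).eq_or_lt
      · exact ⟨j, (hmem j p).2 ⟨⟨ho, fun i => h4 ▸ hk i⟩, h3⟩⟩
      · refine ⟨k, (hmem k p).2 ⟨⟨ho, hk⟩, fun φ => ?_⟩⟩
        refine (hlt j k φ p ho ?_).trans (h3 φ)
        have h5 := h1 k
        rw [map_add, map_add, map_smul, map_smul, smul_eq_mul, smul_eq_mul] at h5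
        by_contra! h6
        nlinarith [mul_le_mul_of_nonneg_left h6 hs])
    (fun i j hij => by
      rw [← interior_inter, Set.eq_empty_iff_forall_notMem]
      intro p hp
      refine hij (hg (sub_eq_zero.1 (LinearMap.ext fun Y => ?_)))
      refine eq_zero_of_mem_interior (f := (g i - g j).toAffineMap) (fun q hq => ?_) hp Y
      have h1 := ((hmem i q).1 hq.1).1.2 j
      have h2 := ((hmem j q).1 hq.2).1.2 i
      simp only [LinearMap.coe_toAffineMap, LinearMap.sub_apply]
      linarith)
  have hvert : ∀ a b c : Col, col a b c ⊆ col 0 ((α⁻¹, 0), 0) ((0, 1), 0) →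
      (∀ j, colO a b c ∩ poly (fn (M j) '' Φ) = ∅) → ∀ τ : ℝ, 0 ≤ τ → τ * α < 1 →
      a ≠ τ • ((1, 0), 0) := by
    rintro a b c hS hdisj τ hτ hτα rfl
    obtain ⟨d, hd⟩ := exists_direction (τ • ((1, 0), 0)) b c
    obtain ⟨j, hj, ε, hε, hcell⟩ := exists_cell_near hj₀ hτ d
    have := Fintype.ofFinite Ψ
    obtain ⟨ε', hε', hlt'⟩ := exists_small_forall_lt (Finset.univ (α := Ψ))
      (fun φ => n j φ + l j) 1 (τ • ((1, 0), 0)) d (fun φ _ => by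
        rw [map_smul, LinearMap.add_apply, smul_eq_mul, Pi.one_apply]
        obtain rfl | h0 := hj
        · exact (mul_le_mul_of_nonneg_left (hax φ) hτ).trans_lt hτα
        · rw [h0, zero_mul]; exact one_pos)
    set r := min 1 (min ε ε')
    have hr : 0 < r := lt_min one_pos (lt_min hε hε')
    have hr1 : r ≤ 1 := min_le_left _ _
    have hr2 : r ≤ ε := (min_le_right _ _).trans (min_le_left _ _)
    have hr3 : r ≤ ε' := (min_le_right _ _).trans (min_le_right _ _)
    have hp := hd r hr hr1
    refine Set.eq_empty_iff_forall_notMem.1 (hdisj j) _ ⟨hp, (hmem j _).2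
      ⟨⟨((hcol _).1 (hS (colO_subset_col _ _ _ hp))).1, hcell r hr.le hr2⟩, fun φ => ?_⟩⟩
    exact (hlt' r hr.le hr3 φ (Finset.mem_univ _)).le
  refine ⟨α, hα, key.mono fun S hS hQ => ?_⟩
  obtain ⟨j, rfl⟩ | ⟨a, b, c, rfl, nd, hdisj⟩ := hQ
  · refine Or.inl ⟨M j, rfl, fun p hp hpΦ => ?_⟩
    obtain ⟨q, rfl⟩ := (splitE f v hf).symm.surjective p
    have h1 : 0 < f ((splitE f v hf).symm q) := hft _ (h.pos_of_mem hpΦ hp)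
    have h2 : κ j q.1 ∈ oct := ((hK j q.1).1 fun φ hφ h0 => by
      have := hpΦ φ hφ
      rwa [splitE_symm_apply, map_add, map_smul, h0, smul_zero, add_zero] at this).1
    have e1 : (M j ((splitE f v hf).symm q)).2 = q.2 + l j (κ j q.1) := by
      simp [M, vertexE, shearE]
    rw [splitE_symm_apply, map_add, LinearMap.mem_ker.1 q.1.2, map_smul, hf] at h1
    rw [e1]
    have := hl j _ h2
    simp at h1
    linarith
  · refine Or.inr ⟨a, b, c, rfl, nd, fun τ hτ hτα => ⟨hvert a b c hS hdisj τ hτ hτα,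
      hvert b c a (by rwa [col_perm]) (by simpa only [colO_perm] using hdisj) τ hτ hτα,
      hvert c a b (by rwa [col_perm, col_perm]) (by simpa only [colO_perm] using hdisj) τ hτ hτα⟩⟩

end ConePair

end Corner

section Raising

/-- `S` is a column over a triangle above height `M`. -/
def IsHighCol (M : ℝ) (S : Set Col) : Prop :=
  ∃ a b c, S = col a b c ∧ Nd a b c ∧ M ≤ a.2 ∧ M ≤ b.2 ∧ M ≤ c.2

lemma IsHighCol.le_height {M : ℝ} {S : Set Col} (h : IsHighCol M S) {p : Col} (hp : p ∈ S) :
    M ≤ p.2 := by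
  obtain ⟨a, b, c, rfl, -, ha, hb, hc⟩ := h
  obtain ⟨x, y, z, h1, h2, h3, h4, rfl⟩ := mem_col.1 hp
  simp only [ez, Prod.snd_add, Prod.smul_snd, Prod.snd_sub, smul_eq_mul, mul_one]
  nlinarith [mul_le_mul_of_nonneg_left hb h1, mul_le_mul_of_nonneg_left hc h2,
    mul_le_mul_of_nonneg_left ha (by linarith : 0 ≤ 1 - x - y)]

lemma Dec.exists_uniform {E : Type*} [TopologicalSpace E] {Q : ℝ → Set E → Prop} {X : Set E}
    (hQ : ∀ S ε ε', ε ≤ ε' → Q ε' S → Q ε S) (h : Dec (fun S => ∃ ε > 0, Q ε S) X) :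
    ∃ ε > 0, Dec (Q ε) X := by
  obtain ⟨D, h1, h2, h3, h4⟩ := h
  have : ∃ ε > 0, ∀ S ∈ D, Q ε S := by
    clear h3 h4
    induction D, h1 using Set.Finite.induction_on with
    | empty => exact ⟨1, one_pos, by simp⟩
    | @insert S D _ _ ih =>
      obtain ⟨ε, hε, h⟩ := ih fun T hT => h2 T (Set.mem_insert_of_mem _ hT)
      obtain ⟨ε', hε', h'⟩ := h2 S (Set.mem_insert _ _)
      refine ⟨min ε ε', lt_min hε hε', ?_⟩
      rintro R (rfl | hR)
      · exact hQ _ _ _ (min_le_right _ _) h'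
      · exact hQ _ _ _ (min_le_left _ _) (h R hR)
  obtain ⟨ε, hε, h⟩ := this
  exact ⟨ε, hε, D, h1, h, h3, h4⟩

/-- The diagonal map `((x, y), z) ↦ ((p x, y), q z)`. -/
def scaleE (p q : ℝ) (hp : p ≠ 0) (hq : q ≠ 0) : Col ≃ₗ[ℝ] Col :=
  ((LinearEquiv.smulOfNeZero ℝ ℝ p hp).prodCongr (LinearEquiv.refl ℝ ℝ)).prodCongr
    (LinearEquiv.smulOfNeZero ℝ ℝ q hq)

lemma scaleE_apply (p q : ℝ) (hp : p ≠ 0) (hq : q ≠ 0) (Y : Col) :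
    scaleE p q hp hq Y = ((p * Y.1.1, Y.1.2), q * Y.2) := rfl

variable {T : Set Col → Prop}
  (hinv : ∀ S (L : Col ≃ₗ[ℝ] Col) (a : Col), T S → T (affHomeo L a '' S))

include hinv

/-- A column decomposes into tiles and columns without vertices on the half-open edge `[a, b)`. -/
lemma dec_avoid_edge {α : ℝ} (hα : 0 < α)
    (hC : Dec (fun S => T S ∨ ∃ a b c, S = col a b c ∧ Nd a b c ∧
      ∀ τ : ℝ, 0 ≤ τ → τ * α < 1 → a ≠ τ • ((1, 0), 0) ∧ b ≠ τ • ((1, 0), 0) ∧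
        c ≠ τ • ((1, 0), 0)) (col 0 ((α⁻¹, 0), 0) ((0, 1), 0)))
    {a b c : Col} (h : Nd a b c) :
    Dec (fun S => T S ∨ ∃ x y z, S = col x y z ∧ Nd x y z ∧
      ∀ τ : ℝ, 0 ≤ τ → τ < 1 → x ≠ a + τ • (b - a) ∧ y ≠ a + τ • (b - a) ∧
        z ≠ a + τ • (b - a)) (col a b c) := by
  let L : Col ≃ₗ[ℝ] Col := (scaleE α 1 hα.ne' one_ne_zero).trans (colE h)
  have hL : ∀ p : Col, L p = (α * p.1.1) • (b - a) + p.1.2 • (c - a) + p.2 • ez := fun p => by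
    simp [L, scaleE_apply, colL_apply]
  have hz : L ez = (1 : ℝ) • ez := by simp [hL, ez]
  have e1 : affHomeo L a '' col 0 ((α⁻¹, 0), 0) ((0, 1), 0) = col a b c := by
    rw [image_col L a one_pos hz]
    congr 1
    · simp
    · simp [hL, hα.ne']
    · simp [hL]
  rw [← e1]
  refine hC.image _ fun S hS => ?_
  obtain hS | ⟨x, y, z, rfl, nd, hne⟩ := hS
  · exact Or.inl (hinv S L a hS)
  · refine Or.inr ⟨_, _, _, image_col L a one_pos hz, nd.image L a one_pos hz, fun τ h0 h1 => ?_⟩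
    have e2 : τ • (b - a) = L ((τ * α⁻¹) • ((1, 0), 0)) := by
      rw [hL]
      simp [mul_comm α, hα.ne']
    obtain ⟨n1, n2, n3⟩ := hne (τ * α⁻¹) (by positivity) (by simpa [hα.ne'] using h1)
    rw [e2]
    simp only [ne_eq, add_right_inj, EmbeddingLike.apply_eq_iff_eq]
    exact ⟨n1, n2, n3⟩

theorem dec_high
    (hF : Dec (fun S => T S ∨ ∃ a b c, S = col a b c ∧ Nd a b c ∧
      (0 < a.2 ∨ 0 < b.2 ∨ 0 < c.2)) stdCol)
    (hC : ∀ a b c, Nd a b c → Dec (fun S => T S ∨ ∃ x y z, S = col x y z ∧ Nd x y z ∧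
      ∀ τ : ℝ, 0 ≤ τ → τ < 1 → x ≠ a + τ • (b - a) ∧ y ≠ a + τ • (b - a) ∧
        z ≠ a + τ • (b - a)) (col a b c))
    {a b c : Col} (h : Nd a b c) (M : ℝ) : Dec (fun S => T S ∨ IsHighCol M S) (col a b c) := by
  have hvert : ∀ {x y z : Col} {X : Set Col}, col x y z ⊆ X → x ∈ X ∧ y ∈ X ∧ z ∈ X :=
    fun {x y z X} hX => ⟨hX (left_mem_col x y z), hX (by rw [← col_perm]; exact left_mem_col y z x),
      hX (by rw [← col_perm, ← col_perm]; exact left_mem_col z x y)⟩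
  have two_vertices_raised :
      Dec (fun S => T S ∨ ∃ a b c, S = col a b c ∧ Nd a b c ∧ 0 < b.2 ∧ 0 < c.2)
      stdCol := by
    have h1 : Dec (fun S => T S ∨ ∃ a b c, S = col a b c ∧ Nd a b c ∧ 0 < c.2) stdCol := by
      refine hF.mono fun S _ hS => hS.imp_right ?_
      rintro ⟨a, b, c, rfl, n, h1 | h1 | h1⟩
      · exact ⟨b, c, a, (col_perm a b c).symm, n.perm, h1⟩
      · exact ⟨c, a, b, by rw [col_perm, col_perm], n.perm.perm, h1⟩
      · exact ⟨a, b, c, rfl, n, h1⟩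
    refine h1.bind fun S hS hQ => ?_
    obtain hT | ⟨a, b, c, rfl, n, hc⟩ := hQ
    · exact Dec.self (Or.inl hT)
    refine (hC a b c n).mono fun S hSc hQ => hQ.imp_right ?_
    rintro ⟨x, y, z, rfl, n', hne⟩
    obtain ⟨ha, hb, -⟩ := hvert hS
    have key : ∀ p ∈ col a b c, (∀ τ : ℝ, 0 ≤ τ → τ < 1 → p ≠ a + τ • (b - a)) →
        p = b ∨ 0 < p.2 := by
      intro p hp hpne
      refine (hS hp).2.2.2.eq_or_lt.imp_left fun h0 => ?_
      obtain ⟨u, v, w, h1, h2, h3, h4, rfl⟩ := mem_col.1 hp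
      have e0 : (a + (u • (b - a) + v • (c - a) + w • ez)).2 =
          (1 - u - v) * a.2 + u * b.2 + v * c.2 + w := by simp [ez]; ring
      rw [e0] at h0
      have g1 := mul_nonneg (by linarith : 0 ≤ 1 - u - v) ha.2.2.2
      have g2 := mul_nonneg h1 hb.2.2.2
      have g3 := mul_nonneg h2 hc.le
      have hv : v = 0 := (mul_eq_zero.1 (by linarith : v * c.2 = 0)).resolve_right hc.ne'
      have hw : w = 0 := by linarith
      subst hv hw
      have e1 : a + (u • (b - a) + (0 : ℝ) • (c - a) + (0 : ℝ) • ez) = a + u • (b - a) := by simp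
      rw [e1] at hpne ⊢
      have hu : u = 1 := le_antisymm (by linarith) (by
        by_contra! hlt
        exact hpne u h1 hlt rfl)
      rw [hu, one_smul, add_sub_cancel]
    obtain ⟨hx, hy, hz⟩ := hvert hSc
    have kx := key x hx fun τ h0 h1 => (hne τ h0 h1).1
    have ky := key y hy fun τ h0 h1 => (hne τ h0 h1).2.1
    have kz := key z hz fun τ h0 h1 => (hne τ h0 h1).2.2
    have ne : ∀ {x y z : Col}, Nd x y z → x ≠ y := by
      rintro x _ z n rfl
      have := (nd_iff.1 n 1 0 0 (by simp)).1
      exact one_ne_zero this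
    by_cases hxb : x = b
    · exact ⟨x, y, z, rfl, n', ky.resolve_left fun e => ne n' (hxb.trans e.symm),
        kz.resolve_left fun e => ne n'.perm.perm (e.trans hxb.symm)⟩
    by_cases hyb : y = b
    · exact ⟨y, z, x, (col_perm _ _ _).symm, n'.perm,
        kz.resolve_left fun e => ne n'.perm (hyb.trans e.symm), kx.resolve_left hxb⟩
    · exact ⟨z, x, y, by rw [col_perm, col_perm], n'.perm.perm, kx.resolve_left hxb,
        ky.resolve_left hyb⟩
  have all_vertices_raised : Dec (fun S => ∃ ε > 0, (T S ∨ IsHighCol ε S) ∧ S ⊆ stdCol) stdCol := by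
    refine Dec.mono (Q := fun S => ∃ ε > 0, (T S ∨ IsHighCol ε S)) ?_
      fun S hS ⟨ε, hε, h⟩ => ⟨ε, hε, h, hS⟩
    refine two_vertices_raised.bind fun S hS hQ => ?_
    obtain hT | ⟨a, b, c, rfl, n, hb, hc⟩ := hQ
    · exact Dec.self ⟨1, one_pos, Or.inl hT⟩
    refine (hC a b c n).mono fun S hSc hQ => ?_
    obtain hT | ⟨x, y, z, rfl, n', hne⟩ := hQ
    · exact ⟨1, one_pos, Or.inl hT⟩
    have ha := (hvert hS).1
    have key : ∀ p ∈ col a b c, p ≠ a + (0 : ℝ) • (b - a) → 0 < p.2 := by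
      intro p hp hpne
      refine (hS hp).2.2.2.lt_of_ne fun h0 => hpne ?_
      obtain ⟨u, v, w, h1, h2, h3, h4, rfl⟩ := mem_col.1 hp
      have e0 : (a + (u • (b - a) + v • (c - a) + w • ez)).2 =
          (1 - u - v) * a.2 + u * b.2 + v * c.2 + w := by simp [ez]; ring
      rw [e0] at h0
      have g1 := mul_nonneg (by linarith : 0 ≤ 1 - u - v) ha.2.2.2
      have g2 := mul_nonneg h1 hb.le
      have g3 := mul_nonneg h2 hc.le
      have hu : u = 0 := (mul_eq_zero.1 (by linarith : u * b.2 = 0)).resolve_right hb.ne'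
      have hv : v = 0 := (mul_eq_zero.1 (by linarith : v * c.2 = 0)).resolve_right hc.ne'
      have hw : w = 0 := by linarith
      subst hu hv hw
      simp
    obtain ⟨hx, hy, hz⟩ := hvert hSc
    obtain ⟨nx, ny, nz⟩ := hne 0 le_rfl one_pos
    exact ⟨min x.2 (min y.2 z.2), lt_min (key x hx nx) (lt_min (key y hy ny) (key z hz nz)),
      Or.inr ⟨x, y, z, rfl, n', min_le_left _ _, (min_le_right _ _).trans (min_le_left _ _),
        (min_le_right _ _).trans (min_le_right _ _)⟩⟩
  obtain ⟨ε, hε, hdec⟩ := Dec.exists_uniform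
    (Q := fun ε S => (T S ∨ IsHighCol ε S) ∧ S ⊆ stdCol) (by
      rintro S ε ε' hle ⟨hS | ⟨x, y, z, e, n, hx, hy, hz⟩, hs⟩
      · exact ⟨Or.inl hS, hs⟩
      · exact ⟨Or.inr ⟨x, y, z, e, n, hle.trans hx, hle.trans hy, hle.trans hz⟩, hs⟩)
    all_vertices_raised
  set m := min a.2 (min b.2 c.2)
  have ma : m ≤ a.2 := min_le_left _ _
  have mb : m ≤ b.2 := (min_le_right _ _).trans (min_le_left _ _)
  have mc : m ≤ c.2 := (min_le_right _ _).trans (min_le_right _ _)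
  obtain ⟨K, hK, hKM⟩ : ∃ K : ℝ, 0 < K ∧ M - m ≤ K * ε :=
    ⟨max ((M - m) / ε) 1, lt_max_of_lt_right one_pos, by
      rw [← div_le_iff₀ hε]; exact le_max_left _ _⟩
  let L : Col ≃ₗ[ℝ] Col := (scaleE 1 K one_ne_zero hK.ne').trans (colE h)
  have hL : ∀ p : Col, L p = p.1.1 • (b - a) + p.1.2 • (c - a) + (K * p.2) • ez := fun p => by
    simp [L, scaleE_apply, colL_apply]
  have hLz : L ez = K • ez := by simp [hL, ez]
  have e1 : affHomeo L a '' stdCol = col a b c := by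
    rw [stdCol_eq, image_col L a hK hLz]
    congr 1
    · simp [hL]
    · simp [hL]
    · simp [hL]
  rw [← e1]
  refine hdec.image _ fun S ⟨hS, hSs⟩ => ?_
  refine hS.imp (hinv S L a) ?_
  rintro ⟨x, y, z, rfl, n, hx, hy, hz⟩
  refine ⟨_, _, _, image_col L a hK hLz, n.image L a hK hLz, ?_⟩
  have key : ∀ p ∈ stdCol, ε ≤ p.2 → M ≤ (a + L p).2 := by
    rintro p ⟨h1, h2, h3, -⟩ h5
    have e0 : (a + L p).2 = (1 - p.1.1 - p.1.2) * a.2 + p.1.1 * b.2 + p.1.2 * c.2 + K * p.2 := by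
      simp [hL, ez]; ring
    rw [e0]
    nlinarith [mul_le_mul_of_nonneg_left mb h1, mul_le_mul_of_nonneg_left mc h2,
      mul_le_mul_of_nonneg_left ma (by linarith : 0 ≤ 1 - p.1.1 - p.1.2),
      mul_le_mul_of_nonneg_left h5 hK.le]
  obtain ⟨sx, sy, sz⟩ := hvert hSs
  exact ⟨key x sx hx, key y sy hy, key z sz hz⟩

end Raising
section Exhaust

variable {T : Set Col → Prop}

lemma exists_refine
    (hM : ∀ a b c, Nd a b c → ∀ M : ℝ, Dec (fun S => T S ∨ IsHighCol M S) (col a b c))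
    {m : ℝ} (M : ℝ) {D : Set (Set Col)} (hf : D.Finite) (hD : ∀ S ∈ D, T S ∨ IsHighCol m S)
    (hd : D.Pairwise fun S R => interior S ∩ interior R = ∅) :
    ∃ D' : Set (Set Col), D'.Finite ∧ (∀ S ∈ D', T S ∨ IsHighCol M S) ∧ ⋃₀ D' = ⋃₀ D ∧
      (D'.Pairwise fun S R => interior S ∩ interior R = ∅) ∧ (∀ S ∈ D, T S → S ∈ D') ∧
      ∀ S ∈ D', (S ∈ D ∧ T S) ∨ ∀ p ∈ S, m ≤ p.2 := by
  have : ∀ S ∈ D, ∃ G : Set (Set Col), G.Finite ∧ (∀ R ∈ G, T R ∨ IsHighCol M R) ∧ ⋃₀ G = S ∧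
      (G.Pairwise fun S R => interior S ∩ interior R = ∅) ∧ (T S → G = {S}) := by
    intro S hS
    by_cases hT : T S
    · exact ⟨{S}, Set.finite_singleton _, by simp [hT], by simp, by simp, fun _ => rfl⟩
    · obtain ⟨a, b, c, rfl, n, -⟩ := (hD S hS).resolve_left hT
      obtain ⟨G, h1, h2, h3, h4⟩ := hM a b c n M
      exact ⟨G, h1, h2, h3, h4, fun h => absurd h hT⟩
  choose! g g1 g2 g3 g4 g5 using this
  refine ⟨⋃ S ∈ D, g S, hf.biUnion g1, ?_, ?_, ?_, ?_, ?_⟩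
  · simp only [Set.mem_iUnion]
    rintro R ⟨S, hS, hR⟩
    exact g2 S hS R hR
  · simp only [Set.sUnion_iUnion]
    rw [Set.sUnion_eq_biUnion]
    exact Set.iUnion₂_congr g3
  · simp only [Set.Pairwise, Set.mem_iUnion]
    rintro R ⟨S, hS, hR⟩ R' ⟨S', hS', hR'⟩ hne
    by_cases h : S = S'
    · subst h
      exact g4 S hS hR hR' hne
    · exact interior_inter_eq_empty_mono (hd hS hS' h)
        ((Set.subset_sUnion_of_mem hR).trans (g3 S hS).subset)
        ((Set.subset_sUnion_of_mem hR').trans (g3 S' hS').subset)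
  · intro S hS hT
    simp only [Set.mem_iUnion]
    exact ⟨S, hS, by rw [g5 S hS hT]; rfl⟩
  · simp only [Set.mem_iUnion]
    rintro R ⟨S, hS, hR⟩
    by_cases hT : T S
    · rw [g5 S hS hT] at hR
      obtain rfl : R = S := hR
      exact Or.inl ⟨hS, hT⟩
    · exact Or.inr fun p hp => ((hD S hS).resolve_left hT).le_height
        (g3 S hS ▸ Set.mem_sUnion_of_mem hp hR)

/-- Repeatedly raising the columns that are not tiles exhausts the standard column by tiles. -/
theorem exists_tiling_stdCol
    (hM : ∀ a b c, Nd a b c → ∀ M : ℝ, Dec (fun S => T S ∨ IsHighCol M S) (col a b c)) :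
    ∃ 𝒯 : Set (Set Col), (∀ S ∈ 𝒯, T S) ∧ ⋃₀ 𝒯 = stdCol ∧
      (𝒯.Pairwise fun S R => interior S ∩ interior R = ∅) ∧
      ∀ M : ℝ, {S ∈ 𝒯 | ∃ p ∈ S, p.2 < M}.Finite := by
  have refine_next : ∀ (n : ℕ) (D : Set (Set Col)), D.Finite → (∀ S ∈ D, T S ∨ IsHighCol n S) →
      (D.Pairwise fun S R => interior S ∩ interior R = ∅) → _ :=
    fun n D h1 h2 h3 => exists_refine hM (n + 1 : ℕ) h1 h2 h3
  choose! F f1 f2 f3 f4 f5 f6 using refine_next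
  let D : ℕ → Set (Set Col) := fun n => n.rec {stdCol} F
  have good : ∀ n, (D n).Finite ∧ (∀ S ∈ D n, T S ∨ IsHighCol n S) ∧
      ((D n).Pairwise fun S R => interior S ∩ interior R = ∅) ∧ ⋃₀ D n = stdCol := by
    intro n
    induction n with
    | zero =>
      refine ⟨Set.finite_singleton _, ?_, Set.pairwise_singleton _ _, Set.sUnion_singleton _⟩
      rintro _ rfl
      exact Or.inr ⟨_, _, _, stdCol_eq, nd_std, by simp, by simp, by simp⟩
    | succ n ih =>
      obtain ⟨h1, h2, h3, h4⟩ := ih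
      exact ⟨f1 n _ h1 h2 h3, f2 n _ h1 h2 h3, f4 n _ h1 h2 h3, (f3 n _ h1 h2 h3).trans h4⟩
  have mono : ∀ {n m}, n ≤ m → ∀ S ∈ D n, T S → S ∈ D m := by
    intro n m h S hS hT
    induction m, h using Nat.le_induction with
    | base => exact hS
    | succ m _ ih =>
      obtain ⟨h1, h2, h3, -⟩ := good m
      exact f5 m _ h1 h2 h3 S ih hT
  have down : ∀ {n m}, n ≤ m → ∀ S ∈ D m, (∃ p ∈ S, p.2 < n) → S ∈ D n := by
    rintro n m h S hS ⟨p, hp, hpn⟩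
    induction m, h using Nat.le_induction with
    | base => exact hS
    | succ m hm ih =>
      obtain ⟨h1, h2, h3, -⟩ := good m
      refine ih ((f6 m _ h1 h2 h3 S hS).resolve_right fun h => ?_).1
      have : (n : ℝ) ≤ m := by exact_mod_cast hm
      linarith [h p hp]
  refine ⟨{S | T S ∧ ∃ n, S ∈ D n}, fun S hS => hS.1, ?_, ?_, fun M => ?_⟩
  · ext p
    constructor
    · rintro ⟨S, ⟨-, n, hS⟩, hp⟩
      rw [← (good n).2.2.2]
      exact ⟨S, hS, hp⟩
    · intro hp
      obtain ⟨n, hn⟩ := exists_nat_gt p.2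
      obtain ⟨-, h2, -, h4⟩ := good n
      rw [← h4] at hp
      obtain ⟨S, hS, hpS⟩ := hp
      exact ⟨S, ⟨(h2 S hS).resolve_right fun h => hn.not_ge (h.le_height hpS), n, hS⟩, hpS⟩
  · rintro S ⟨hS, n, hSn⟩ R ⟨hR, m, hRm⟩ hne
    exact (good (max n m)).2.2.1 (mono (le_max_left _ _) S hSn hS)
      (mono (le_max_right _ _) R hRm hR) hne
  · obtain ⟨n, hn⟩ := exists_nat_gt M
    refine (good n).1.subset ?_
    rintro S ⟨⟨hS, m, hSm⟩, p, hp, hpM⟩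
    obtain h | h := le_total m n
    · exact mono h S hSm hS
    · exact down h S hSm ⟨p, hp, hpM.trans hn⟩

end Exhaust
section WholeSpace

/-- The linear part of `stdPlace`. -/
def signE (σ τ : Bool) : Col ≃ₗ[ℝ] Col :=
  (if σ then LinearEquiv.refl ℝ (ℝ × ℝ) else LinearEquiv.neg ℝ).prodCongr
    (if τ then LinearEquiv.refl ℝ ℝ else LinearEquiv.neg ℝ)

/-- The translation part of `stdPlace`. -/
def placeOffset (i : (Bool × Bool) × ℤ × ℤ) : Col :=
  ((if i.1.1 then (i.2.1 : ℝ) else i.2.1 + 1, if i.1.1 then (i.2.2 : ℝ) else i.2.2 + 1), 0)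

/-- The affine maps whose images of the standard column tile space. -/
def stdPlace (i : (Bool × Bool) × ℤ × ℤ) : Col ≃ₜ Col :=
  affHomeo (signE i.1.1 i.1.2) (placeOffset i)

lemma stdPlace_apply (σ τ : Bool) (k l : ℤ) (p : Col) : stdPlace ((σ, τ), k, l) p =
    ((if σ then k + p.1.1 else k + 1 - p.1.1, if σ then l + p.1.2 else l + 1 - p.1.2),
      if τ then p.2 else -p.2) := by
  obtain ⟨⟨x, y⟩, z⟩ := p
  cases σ <;> cases τ <;> simp [stdPlace, signE, placeOffset, sub_eq_add_neg]

lemma exists_stdPlace (p : Col) : ∃ i, p ∈ stdPlace i '' stdCol := by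
  obtain ⟨⟨x, y⟩, z⟩ := p
  have e : ∀ x : ℝ, (⌊x⌋ : ℝ) = x - Int.fract x := fun x => (Int.self_sub_fract x).symm
  have fx := Int.fract_nonneg x
  have fy := Int.fract_nonneg y
  have gx := (Int.fract_lt_one x).le
  have gy := (Int.fract_lt_one y).le
  obtain h | h := le_total (Int.fract x + Int.fract y) 1 <;> obtain h' | h' := le_total 0 z
  · exact ⟨((true, true), ⌊x⌋, ⌊y⌋), ((Int.fract x, Int.fract y), z), ⟨fx, fy, h, h'⟩, by
      simp [stdPlace_apply]⟩
  · exact ⟨((true, false), ⌊x⌋, ⌊y⌋), ((Int.fract x, Int.fract y), -z),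
      ⟨fx, fy, h, neg_nonneg.2 h'⟩, by simp [stdPlace_apply]⟩
  · refine ⟨((false, true), ⌊x⌋, ⌊y⌋), ((1 - Int.fract x, 1 - Int.fract y), z),
      ⟨sub_nonneg.2 gx, sub_nonneg.2 gy, ?_, h'⟩, ?_⟩
    · dsimp only; linarith
    · rw [stdPlace_apply]
      ext <;> simp only [Bool.false_eq_true, if_false, if_true] <;> linarith [e x, e y]
  · refine ⟨((false, false), ⌊x⌋, ⌊y⌋), ((1 - Int.fract x, 1 - Int.fract y), -z),
      ⟨sub_nonneg.2 gx, sub_nonneg.2 gy, ?_, neg_nonneg.2 h'⟩, ?_⟩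
    · dsimp only; linarith
    · rw [stdPlace_apply]
      ext <;> simp only [Bool.false_eq_true, if_false] <;> linarith [e x, e y]

/-- The cell of a generic point. -/
def placeIndex (p : Col) : (Bool × Bool) × ℤ × ℤ :=
  ((decide (Int.fract p.1.1 + Int.fract p.1.2 < 1), decide (0 < p.2)), ⌊p.1.1⌋, ⌊p.1.2⌋)

lemma placeIndex_stdPlace (i : (Bool × Bool) × ℤ × ℤ) {q : Col} (hq : q ∈ stdColO) :
    placeIndex (stdPlace i q) = i := by
  obtain ⟨⟨σ, τ⟩, k, l⟩ := i
  obtain ⟨⟨x, y⟩, z⟩ := q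
  obtain ⟨hx, hy, hxy, hz⟩ := hq
  dsimp only at hx hy hxy hz
  have f1 : ∀ (k : ℤ) (u : ℝ), 0 < u → u < 1 → ⌊k + u⌋ = k ∧ Int.fract (k + u) = u :=
    fun k u h0 h1 => ⟨by rw [Int.floor_eq_iff]; constructor <;> linarith, by
      rw [Int.fract_intCast_add, Int.fract_eq_self.2 ⟨h0.le, h1⟩]⟩
  have f2 : ∀ (k : ℤ) (u : ℝ), 0 < u → u < 1 → ⌊k + 1 - u⌋ = k ∧ Int.fract (k + 1 - u) = 1 - u :=
    fun k u h0 h1 => by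
      rw [add_sub_assoc]
      exact f1 k (1 - u) (by linarith) (by linarith)
  obtain ⟨a1, a2⟩ := f1 k x hx (by linarith)
  obtain ⟨a3, a4⟩ := f1 l y hy (by linarith)
  obtain ⟨b1, b2⟩ := f2 k x hx (by linarith)
  obtain ⟨b3, b4⟩ := f2 l y hy (by linarith)
  rw [stdPlace_apply]
  have c : ¬ (1 - x + (1 - y) < 1) := by linarith
  cases σ <;> cases τ <;> simp [placeIndex, a1, a2, a3, a4, b1, b2, b3, b4, hz, hz.le, hxy, c]

lemma finite_stdPlace {K : Set Col} {N : ℝ} (hK : ∀ p ∈ K, ‖p‖ ≤ N) :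
    {i | (stdPlace i '' stdCol ∩ K).Nonempty}.Finite := by
  have hfin : ((Set.univ : Set (Bool × Bool)) ×ˢ
      (Set.Icc (⌊-N - 1⌋) ⌈N + 1⌉ ×ˢ Set.Icc (⌊-N - 1⌋) ⌈N + 1⌉)).Finite :=
    Set.finite_univ.prod ((Set.finite_Icc _ _).prod (Set.finite_Icc _ _))
  refine hfin.subset ?_
  rintro ⟨⟨σ, τ⟩, k, l⟩ ⟨_, ⟨⟨⟨x, y⟩, z⟩, ⟨hx, hy, hxy, hz⟩, rfl⟩, hp⟩
  dsimp only at hx hy hxy hz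
  have hp := hK _ hp
  rw [stdPlace_apply] at hp
  obtain ⟨h1, h2⟩ := abs_le.1 ((norm_fst_le _).trans ((norm_fst_le _).trans hp))
  obtain ⟨h3, h4⟩ := abs_le.1 ((norm_snd_le _).trans ((norm_fst_le _).trans hp))
  dsimp only at h1 h2 h3 h4
  have key : ∀ k : ℤ, -N - 1 ≤ k → k ≤ N + 1 → k ∈ Set.Icc (⌊-N - 1⌋) ⌈N + 1⌉ :=
    fun k h h' => ⟨by exact_mod_cast (Int.floor_le (-N - 1)).trans h,
      by exact_mod_cast h'.trans (Int.le_ceil _)⟩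
  refine ⟨trivial, key k ?_ ?_, key l ?_ ?_⟩ <;> cases σ <;>
    simp only [Bool.false_eq_true, if_false, if_true] at h1 h2 h3 h4 <;> linarith

lemma abs_stdPlace_snd (i : (Bool × Bool) × ℤ × ℤ) {q : Col} (hq : q ∈ stdCol) :
    |(stdPlace i q).2| = q.2 := by
  obtain ⟨⟨σ, τ⟩, k, l⟩ := i
  rw [stdPlace_apply]
  cases τ <;> simp [abs_of_nonneg hq.2.2.2]

/-- Congruent copies of a tiling of the standard column tile space. -/
theorem exists_tiling_col {T : Set Col → Prop}
    (hinv : ∀ S (L : Col ≃ₗ[ℝ] Col) (a : Col), T S → T (affHomeo L a '' S))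
    {𝒯 : Set (Set Col)} (h1 : ∀ S ∈ 𝒯, T S) (h2 : ⋃₀ 𝒯 = stdCol)
    (h3 : 𝒯.Pairwise fun S R => interior S ∩ interior R = ∅)
    (h4 : ∀ M : ℝ, {S ∈ 𝒯 | ∃ p ∈ S, p.2 < M}.Finite) :
    ∃ 𝒰 : Set (Set Col), (∀ S ∈ 𝒰, T S) ∧ ⋃₀ 𝒰 = Set.univ ∧
      (𝒰.Pairwise fun S R => interior S ∩ interior R = ∅) ∧
      ∀ K : Set Col, IsCompact K → {S ∈ 𝒰 | (S ∩ K).Nonempty}.Finite := by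
  have hsub : ∀ S ∈ 𝒯, S ⊆ stdCol := fun S hS => h2 ▸ Set.subset_sUnion_of_mem hS
  refine ⟨{R | ∃ i, ∃ S ∈ 𝒯, R = stdPlace i '' S}, ?_, ?_, ?_, ?_⟩
  · rintro _ ⟨i, S, hS, rfl⟩
    exact hinv S _ _ (h1 S hS)
  · refine Set.eq_univ_of_forall fun p => ?_
    obtain ⟨i, q, hq, rfl⟩ := exists_stdPlace p
    rw [← h2] at hq
    obtain ⟨S, hS, hq⟩ := hq
    exact ⟨_, ⟨i, S, hS, rfl⟩, Set.mem_image_of_mem _ hq⟩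
  · rintro _ ⟨i, S, hS, rfl⟩ _ ⟨j, R, hR, rfl⟩ hne
    rw [← (stdPlace i).image_interior, ← (stdPlace j).image_interior]
    by_cases hij : i = j
    · subst hij
      rw [← Set.image_inter (stdPlace i).injective, h3 hS hR (by rintro rfl; exact hne rfl),
        Set.image_empty]
    · refine Set.eq_empty_of_forall_notMem ?_
      rintro _ ⟨⟨p, hp, rfl⟩, q, hq, e⟩
      apply hij
      rw [← placeIndex_stdPlace i (interior_stdCol_subset (interior_mono (hsub S hS) hp)), ← e,
        placeIndex_stdPlace j (interior_stdCol_subset (interior_mono (hsub R hR) hq))]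
  · intro K hK
    obtain ⟨N, hN⟩ := hK.isBounded.exists_norm_le
    refine ((finite_stdPlace hN).biUnion fun i _ =>
      (h4 (N + 1)).image fun S => stdPlace i '' S).subset ?_
    rintro _ ⟨⟨i, S, hS, rfl⟩, _, ⟨q, hq, rfl⟩, hqK⟩
    refine Set.mem_biUnion (x := i) ⟨_, Set.mem_image_of_mem _ (hsub S hS hq), hqK⟩
      ⟨S, ⟨hS, q, hq, ?_⟩, rfl⟩
    rw [← abs_stdPlace_snd i (hsub S hS hq)]
    exact ((norm_snd_le _).trans (hN _ hqK)).trans_lt (lt_add_one N)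

end WholeSpace
section Cone

variable {E : Type*} [AddCommGroup E] [Module ℝ E] [DecidableEq (E × ℝ)]

lemma mem_homog_convexHull {V : Finset E} {p : E × ℝ} :
    p ∈ homog (convexHull ℝ (V : Set E)) ↔
      p ≠ 0 ∧ p ∈ ccone (V.image fun v => (v, (1 : ℝ))) := by
  set S := V.image fun v => (v, (1 : ℝ)) with hS
  have hconv : ∀ x ∈ convexHull ℝ (V : Set E), (x, (1 : ℝ)) ∈ ccone S := by
    refine convexHull_min (t := {x | (x, (1 : ℝ)) ∈ ccone S}) ?_ ?_
    · exact fun v hv => mem_ccone_of_mem (Finset.mem_image_of_mem _ hv)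
    · intro x hx y hy a b ha hb hab
      have : (a • x + b • y, (1 : ℝ)) = a • (x, (1 : ℝ)) + b • (y, (1 : ℝ)) := by simp [hab]
      rw [Set.mem_ofPred_eq, this]
      exact add_mem_ccone (smul_mem_ccone ha hx) (smul_mem_ccone hb hy)
  constructor
  · intro hp
    refine ⟨fun h0 => hp.1.ne' (by rw [h0]; rfl), ?_⟩
    rw [homog_eq hp]
    exact smul_mem_ccone hp.1.le (hconv _ hp.2)
  · rintro ⟨h0, c, hc, rfl⟩
    refine Or.resolve_left ?_ h0
    refine Finset.sum_induction _ (fun q => q = 0 ∨ q ∈ homog (convexHull ℝ (V : Set E))) ?_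
      (Or.inl rfl) fun s hs => ?_
    · rintro a b (rfl | ha) (rfl | hb)
      · simp
      · exact Or.inr (by rwa [zero_add])
      · exact Or.inr (by rwa [add_zero])
      · exact Or.inr (convex_iff_homog.1 (convex_convexHull ℝ _) a ha b hb)
    · obtain h | h := (hc s hs).eq_or_lt
      · exact Or.inl (by rw [← h, zero_smul])
      · obtain ⟨v, hv, rfl⟩ := Finset.mem_image.1 hs
        exact Or.inr (smul_mem_homog h (mem_homog_one.2 (subset_convexHull ℝ _ hv)))

end Cone

lemma dual_eq_zero_of_interior {E : Type*} [NormedAddCommGroup E] [NormedSpace ℝ E] {P : Set E}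
    (hP : (interior P).Nonempty) {ψ : Module.Dual ℝ (E × ℝ)}
    (h : ∀ x ∈ P, ψ (x, 1) = 0) : ψ = 0 := by
  obtain ⟨x, hx⟩ := hP
  have h1 : ∀ d : E, ψ (d, 0) = 0 := by
    intro d
    have hc : Filter.Tendsto (fun r : ℝ => x + r • d) (nhds 0) (nhds x) := by
      have : Continuous fun r : ℝ => x + r • d := by fun_prop
      simpa using this.tendsto 0
    have h2 : ∀ᶠ r : ℝ in nhdsWithin 0 (Set.Ioi 0), x + r • d ∈ P :=
      (hc.eventually (mem_interior_iff_mem_nhds.1 hx)).filter_mono nhdsWithin_le_nhds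
    obtain ⟨r, hr, hr0⟩ := (h2.and self_mem_nhdsWithin).exists
    have e : r • ((d, 0) : E × ℝ) = (x + r • d, 1) - (x, 1) := by simp
    have := congrArg ψ e
    rw [map_sub, h _ hr, h _ (interior_subset hx), map_smul, smul_eq_mul, sub_zero,
      mul_eq_zero] at this
    exact this.resolve_left (ne_of_gt hr0)
  have h2 : ψ (0, 1) = 0 := by
    have : ((0, 1) : E × ℝ) = (x, 1) - (x, 0) := by simp
    rw [this, map_sub, h _ (interior_subset hx), h1, sub_zero]
  ext d
  · simpa using h1 d
  · simpa using h2

/-- Space decomposes into projective images of any given convex polytope. -/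
theorem exists_projEq_tiling (P : Set (Euc 3)) (hP : IsConvexPolytope P) :
    ∃ 𝒯 : Set (Set Col), (∀ S ∈ 𝒯, ProjEq P S) ∧ ⋃₀ 𝒯 = Set.univ ∧
      (𝒯.Pairwise fun S R => interior S ∩ interior R = ∅) ∧
      ∀ K : Set Col, IsCompact K → {S ∈ 𝒯 | (S ∩ K).Nonempty}.Finite := by
  classical
  obtain ⟨⟨U, hU⟩, hint⟩ := hP
  obtain ⟨V, hVU, hVc, hV⟩ := exists_irred (U.image fun v => (v, (1 : ℝ)))
  have hhom : ∀ p, p ∈ homog P ↔ p ≠ 0 ∧ p ∈ ccone V := fun p => by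
    rw [hU, hVc, mem_homog_convexHull]
  have ht : ∀ v ∈ V, 0 < LinearMap.snd ℝ (Euc 3) ℝ v := fun v hv => by
    obtain ⟨u, -, rfl⟩ := Finset.mem_image.1 (hVU hv)
    simp
  obtain ⟨Φ, h⟩ := exists_conePair hV ht fun ψ hψ =>
    dual_eq_zero_of_interior hint fun x hx => by
      obtain ⟨c, -, hc⟩ := ((hhom _).1 (mem_homog_one.2 hx)).2
      rw [← hc, map_sum]
      exact Finset.sum_eq_zero fun s hs => by rw [map_smul, hψ s hs, smul_zero]
  have hP' : ∀ p, p ∈ homog P ↔ p ≠ 0 ∧ ∀ φ ∈ Φ, 0 ≤ φ p := fun p => by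
    rw [hhom, h.mem_iff]
  have hd : Module.finrank ℝ (Euc 3 × ℝ) = 4 := by simp
  have hne : V.Nonempty := by
    obtain ⟨x, hx⟩ := hint
    obtain ⟨h0, c, -, hc⟩ := (hhom _).1 (mem_homog_one.2 (interior_subset hx))
    rw [Finset.nonempty_iff_ne_empty]
    rintro rfl
    exact h0 (by simpa using hc.symm)
  have htile : ∀ S, IsTile Φ S → ProjEq P S := by
    rintro _ ⟨M, rfl, hM⟩
    exact projEq_tile hP' hM
  have hinv : ∀ S (L : Col ≃ₗ[ℝ] Col) (a : Col), ProjEq P S → ProjEq P (affHomeo L a '' S) :=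
    fun S L a hS => hS.image L a
  obtain ⟨α, hα, hC⟩ := h.dec_corner hd hne
  have hC' := hC.mono fun S _ hS => Or.imp_left (htile S) hS
  have hF := (h.dec_stdCol hd hne).mono fun S _ hS => Or.imp_left (htile S) hS
  obtain ⟨𝒯, h1, h2, h3, h4⟩ := exists_tiling_stdCol fun a b c n M =>
    dec_high hinv hF (fun a b c n => dec_avoid_edge hinv hα hC' n) n M
  exact exists_tiling_col hinv h1 h2 h3 h4

/-- every convex 3-polytope is a combinatorial space-filler: it is the
combinatorial prototile of a locally finite monotypic tiling of `ℝ³` (not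
necessarily face-to-face). -/
theorem every_convex_polyhedron_is_combinatorial_space_filler (P : Set (Euc 3))
    (hP : IsConvexPolytope P) :
    ∃ 𝒯 : Set (Set (Euc 3)), IsTiling 𝒯 ∧ LocallyFiniteTiling 𝒯 ∧
      ∀ T ∈ 𝒯, IsConvexPolytope T ∧ CombEquiv T P := by
  obtain ⟨𝒯, h1, h2, h3, h4⟩ := exists_projEq_tiling P hP
  let e : Col ≃ₜ Euc 3 :=
    affHomeo (LinearEquiv.ofFinrankEq Col (Euc 3) (by simp)) 0
  have hproj : ∀ S ∈ 𝒯, ProjEq P (e '' S) := fun S hS => (h1 S hS).image _ 0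
  have hpoly : ∀ S ∈ 𝒯, IsConvexPolytope (e '' S) := fun S hS => by
    obtain ⟨⟨U, rfl⟩, hint⟩ := hP
    exact ⟨(hproj S hS).exists_convexHull, (hproj S hS).nonempty_interior hint⟩
  refine ⟨(fun S => e '' S) '' 𝒯, ⟨?_, ?_, ?_⟩, fun K hK => ?_, ?_⟩
  · rintro _ ⟨S, hS, rfl⟩
    obtain ⟨⟨U, hU⟩, -⟩ := hpoly S hS
    dsimp only
    rw [hU]
    exact (U.finite_toSet.isCompact_convexHull (𝕜 := ℝ)).isClosed
  · rw [← Set.image_sUnion, h2, Set.image_univ, e.surjective.range_eq]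
  · rintro _ ⟨S, hS, rfl⟩ _ ⟨R, hR, rfl⟩ hne
    dsimp only
    rw [← e.image_interior, ← e.image_interior, ← Set.image_inter e.injective,
      h3 hS hR (by rintro rfl; exact hne rfl), Set.image_empty]
  · refine ((h4 (e ⁻¹' K) (e.isCompact_preimage.2 hK)).image fun S => e '' S).subset ?_
    rintro _ ⟨⟨S, hS, rfl⟩, _, ⟨q, hq, rfl⟩, hqK⟩
    exact ⟨S, ⟨hS, q, hq, hqK⟩, rfl⟩
  · rintro _ ⟨S, hS, rfl⟩
    exact ⟨hpoly S hS, (hproj S hS).symm.nonempty_orderIso⟩
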